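/- Let F be a real-analytic function on a connected open set U ⊆ ℝ^d containing the unit cube [0,1]^d, let D ⊆ [0,1]^d be closed, and let L be an admissible differential operator of type (α,β) with (α,β) ≠ (1,(0,…,0)). Then there exists a finite constant C such that for every c > 0 with |LF(x)| ≥ c for all x ∈ D and every ε > 0, the Lebesgue measure of {x ∈ D : |F(x)| ≤ ε} is at most C · ε^{α/(|β|+1−α)} · c^{−1/(|β|+1−α)} (here |β| = β_1+…+β_d, and the exponent |β|+1−α is a positive integer for every nontrivial admissible type). -/

import Mathlib

open MeasureTheory
open scoped ENNReal

/-- The partial derivative `∂/∂x_i` of a scalar function on `ℝ^d`. -/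
noncomputable def pderiv' {d : ℕ} (i : Fin d) (f : (Fin d → ℝ) → ℝ) : (Fin d → ℝ) → ℝ :=
  fun x => fderiv ℝ f x (Pi.single i 1)

/-- The classes `𝓛^{α,β}` of admissible differential operators of type `(α,β)`:
`𝓛^{1,0}` contains exactly the identity, and `L ∈ 𝓛^{α,β}` when there are distinct indices
`i_1,…,i_n` and operators `L_k ∈ 𝓛^{α_k,β_k}` with `α = Σ α_k`,
`β = Σ β_k + e_{i_1} + ⋯ + e_{i_n}` and `L F = det [∂_{x_{i_r}} (L_k F)]` for all smooth `F`. -/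
inductive IsAdmissible (d : ℕ) :
    ℕ → (Fin d → ℕ) → (((Fin d → ℝ) → ℝ) → (Fin d → ℝ) → ℝ) → Prop
  | id : IsAdmissible d 1 0 (fun F => F)
  | det (n : ℕ) (hn : 1 ≤ n) (hnd : n ≤ d) (i : Fin n → Fin d)
      (hi : Function.Injective i) (αs : Fin n → ℕ) (βs : Fin n → Fin d → ℕ)
      (Ls : Fin n → ((Fin d → ℝ) → ℝ) → (Fin d → ℝ) → ℝ)
      (hLs : ∀ k, IsAdmissible d (αs k) (βs k) (Ls k))
      (L : ((Fin d → ℝ) → ℝ) → (Fin d → ℝ) → ℝ)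
      (hL : ∀ F : (Fin d → ℝ) → ℝ, ∀ x, ContDiffAt ℝ (⊤ : ℕ∞) F x →
        L F x = (Matrix.of fun r k : Fin n => pderiv' (i r) (Ls k F) x).det) :
      IsAdmissible d (∑ k, αs k) ((∑ k, βs k) + ∑ k, Pi.single (i k) 1) L

namespace Sublevel

open Filter Topology
open scoped NNReal

section

variable {σ : Type} [Fintype σ]

/-- The value of the monomial with exponent `γ` at a tuple of polyradii. -/
noncomputable def monoVal {R : Type*} [CommMonoid R] (z : σ → R) (γ : σ →₀ ℕ) : R :=
  ∏ i, z i ^ γ i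

theorem monoVal_add {R : Type*} [CommMonoid R] (z : σ → R) (γ δ : σ →₀ ℕ) :
    monoVal z (γ + δ) = monoVal z γ * monoVal z δ := by
  simp [monoVal, pow_add, Finset.prod_mul_distrib]

theorem monoVal_zero {R : Type*} [CommMonoid R] (z : σ → R) : monoVal z 0 = 1 := by
  simp [monoVal]

theorem norm_monoVal_le {𝕜 : Type*} [RCLike 𝕜] {z : σ → 𝕜} {ρ : σ → ℝ≥0}
    (h : ∀ i, ‖z i‖ ≤ ρ i) (γ : σ →₀ ℕ) : ‖monoVal z γ‖ ≤ monoVal ρ γ := by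
  simp only [monoVal, norm_prod, norm_pow, NNReal.coe_prod, NNReal.coe_pow]
  exact Finset.prod_le_prod (fun i _ => by positivity) fun i _ => by gcongr; exact h i

theorem monoVal_mono {ρ ρ' : σ → ℝ≥0} (h : ρ ≤ ρ') (γ : σ →₀ ℕ) : monoVal ρ γ ≤ monoVal ρ' γ :=
  Finset.prod_le_prod (fun i _ => zero_le) fun i _ => by gcongr; exact h i

theorem monoVal_pos {ρ : σ → ℝ≥0} (h : ∀ i, 0 < ρ i) (γ : σ →₀ ℕ) : 0 < monoVal ρ γ :=
  Finset.prod_pos fun i _ => pow_pos (h i) _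

theorem exists_multilinear_monoVal (𝕜 : Type*) [RCLike 𝕜] (k : ℕ) (γ : σ →₀ ℕ)
    (h : γ.degree = k) :
    ∃ M : ContinuousMultilinearMap 𝕜 (fun _ : Fin k => σ → 𝕜) 𝕜,
      (∀ z, M (fun _ => z) = monoVal z γ) ∧ ‖M‖ ≤ 1 := by
  classical
  have hl : (Finsupp.toMultiset γ).toList.length = k := by
    rw [Multiset.length_toList, Finsupp.card_toMultiset, ← h]; rfl
  obtain ⟨s, hs⟩ : ∃ s : Fin k → σ, ∀ z : σ → 𝕜, ∏ j, z (s j) = monoVal z γ := by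
    subst hl
    refine ⟨fun j => (Finsupp.toMultiset γ).toList.get j, fun z => ?_⟩
    have h1 : ∏ j, z ((Finsupp.toMultiset γ).toList.get j)
        = ((Finsupp.toMultiset γ).toList.map z).prod := by
      rw [← List.prod_ofFn]; congr 1
      apply List.ext_get <;> simp
    rw [h1, ← Multiset.prod_coe, ← Multiset.map_coe, Multiset.coe_toList, Finsupp.toMultiset_map,
      Finsupp.prod_toMultiset, Finsupp.prod_mapDomain_index (by simp) (by simp [pow_add]),
      Finsupp.prod_fintype _ _ (by simp)]
    rfl
  refine ⟨(ContinuousMultilinearMap.mkPiAlgebraFin 𝕜 k 𝕜).compContinuousLinearMap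
    (fun j => ContinuousLinearMap.proj (s j)), fun z => ?_, ?_⟩
  · rw [← hs]
    simp [ContinuousMultilinearMap.compContinuousLinearMap_apply, List.prod_ofFn]
  · refine ContinuousMultilinearMap.opNorm_le_bound zero_le_one fun m => ?_
    simp only [ContinuousMultilinearMap.compContinuousLinearMap_apply,
      ContinuousMultilinearMap.mkPiAlgebraFin_apply, List.prod_ofFn, one_mul, norm_prod]
    exact Finset.prod_le_prod (fun _ _ => norm_nonneg _) fun j _ => norm_le_pi_norm (m j) (s j)

theorem hasFPowerSeries_of_summable {𝕜 : Type*} [RCLike 𝕜] {f : (σ → 𝕜) → 𝕜}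
    {c : (σ →₀ ℕ) → 𝕜} {ρ : ℝ≥0} (hρ : 0 < ρ)
    (hs : Summable fun γ => ‖c γ‖ * monoVal (fun _ => ρ) γ)
    (hf : ∀ z : σ → 𝕜, (∀ i, ‖z i‖ ≤ ρ) → HasSum (fun γ => c γ * monoVal z γ) (f z)) :
    AnalyticAt 𝕜 f 0 := by
  classical
  choose M hM hM1 using exists_multilinear_monoVal (σ := σ) 𝕜
  have hfin (k : ℕ) : Finite {γ : σ →₀ ℕ // γ.degree = k} := by
    refine (Set.Finite.subset (Finset.univ.finsuppAntidiag k).finite_toSet fun γ hγ => ?_).to_subtype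
    have hγ' : γ.degree = k := hγ
    simp [Finset.mem_finsuppAntidiag, ← hγ', Finsupp.degree_eq_sum]
  have := fun k => Fintype.ofFinite {γ : σ →₀ ℕ // γ.degree = k}
  let p : FormalMultilinearSeries 𝕜 (σ → 𝕜) 𝕜 := fun k =>
    ∑ γ : {γ : σ →₀ ℕ // γ.degree = k}, c γ • M k γ.1 γ.2
  have hval (γ : σ →₀ ℕ) : monoVal (fun _ => ρ) γ = ρ ^ γ.degree := by
    simp [monoVal, Finset.prod_pow_eq_pow_sum, Finsupp.degree_eq_sum]
  have hrad : (ρ : ℝ≥0∞) ≤ p.radius := by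
    apply FormalMultilinearSeries.le_radius_of_summable
    have h1 := ((Equiv.sigmaFiberEquiv (fun γ : σ →₀ ℕ => γ.degree)).summable_iff.2 hs).sigma
    refine Summable.of_nonneg_of_le (fun _ => by positivity) (fun k => ?_) h1
    rw [tsum_fintype]
    simp only [p]
    refine (mul_le_mul_of_nonneg_right (norm_sum_le _ _) (by positivity)).trans ?_
    rw [Finset.sum_mul]
    refine Finset.sum_le_sum fun γ _ => ?_
    simp only [Function.comp, Equiv.sigmaFiberEquiv_apply]
    rw [hval, γ.2, norm_smul]
    push_cast
    gcongr
    exact mul_le_of_le_one_right (norm_nonneg _) (hM1 _ _ _)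
  refine ⟨p, ρ, hrad, by exact_mod_cast hρ, fun {y} hy => ?_⟩
  have hy' : ∀ i, ‖y i‖ ≤ ρ := by
    intro i
    have : ‖y‖ < ρ := by simpa [Metric.mem_eball, edist_zero_right, enorm] using hy
    exact (norm_le_pi_norm y i).trans this.le
  have h1 := (Equiv.sigmaFiberEquiv (fun γ : σ →₀ ℕ => γ.degree)).hasSum_iff.2 (hf y hy')
  rw [zero_add]
  refine h1.sigma fun k => ?_
  have h2 := hasSum_fintype (fun γ : {γ : σ →₀ ℕ // γ.degree = k} => c γ * monoVal y γ.1)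
  have h3 : ∑ γ : {γ : σ →₀ ℕ // γ.degree = k}, c γ * monoVal y γ.1 = p k fun _ => y := by
    simp [p, hM]
  rw [← h3]
  exact h2

theorem monoVal_sum_single {R : Type*} [CommMonoid R] (z : σ → R) {k : ℕ} (s : Fin k → σ) :
    monoVal z (∑ j, Finsupp.single (s j) 1) = ∏ j, z (s j) := by
  classical
  simp only [monoVal, Finsupp.coe_finsetSum, Finset.sum_apply, ← Finset.prod_pow_eq_pow_sum]
  rw [Finset.prod_comm]
  refine Finset.prod_congr rfl fun j _ => ?_
  simp [Finsupp.single_apply, pow_ite]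

theorem exists_coeff_of_analyticAt {𝕜 : Type*} [RCLike 𝕜] {f : (σ → 𝕜) → 𝕜}
    (hf : AnalyticAt 𝕜 f 0) :
    ∃ (c : (σ →₀ ℕ) → 𝕜) (ρ : ℝ≥0), 0 < ρ ∧
      (Summable fun γ => ‖c γ‖ * monoVal (fun _ => ρ) γ) ∧
      ∀ z : σ → 𝕜, (∀ i, ‖z i‖ ≤ ρ) → HasSum (fun γ => c γ * monoVal z γ) (f z) := by
  classical
  obtain ⟨p, r, hp⟩ := hf
  obtain ⟨r', hr'0, hr'⟩ : ∃ r' : ℝ≥0, 0 < r' ∧ (r' : ℝ≥0∞) < r := by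
    obtain ⟨r', h1, h2⟩ := ENNReal.lt_iff_exists_nnreal_btwn.1 hp.r_pos
    exact ⟨r', by exact_mod_cast h1, h2⟩
  let d : ℝ≥0 := Fintype.card σ + 1
  have hd : 1 ≤ d := by simp [d]
  have hd0 : 0 < d := by positivity
  let ρ : ℝ≥0 := r' / d
  have hρ0 : 0 < ρ := by positivity
  have hρr : ρ ≤ r' := div_le_self zero_le hd
  let ex : (Σ k : ℕ, (Fin k → σ)) → (σ →₀ ℕ) := fun x => ∑ j, Finsupp.single (x.2 j) 1
  let b : (Σ k : ℕ, (Fin k → σ)) → 𝕜 := fun x => p x.1 (fun j => Pi.single (x.2 j) 1)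
  have hsum : Summable fun x => ‖b x‖ * monoVal (fun _ => ρ) (ex x) := by
    rw [summable_sigma_of_nonneg (fun x => by positivity)]
    refine ⟨fun k => Summable.of_finite, ?_⟩
    have h1 : Summable fun k => ‖p k‖ * r' ^ k :=
      p.summable_norm_mul_pow (hr'.trans_le hp.r_le)
    refine Summable.of_nonneg_of_le (fun k => tsum_nonneg fun _ => by positivity) (fun k => ?_) h1
    rw [tsum_fintype]
    calc _ ≤ ∑ s : Fin k → σ, ‖p k‖ * (ρ : ℝ) ^ k := by
          refine Finset.sum_le_sum fun s _ => ?_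
          rw [monoVal_sum_single]
          simp only [Finset.prod_const, Finset.card_univ, Fintype.card_fin, NNReal.coe_pow]
          gcongr
          refine ((p k).le_opNorm _).trans (mul_le_of_le_one_right (norm_nonneg _) ?_)
          refine Finset.prod_le_one (fun _ _ => norm_nonneg _) fun j _ => ?_
          simp [Pi.norm_single]
      _ = ‖p k‖ * ((Fintype.card σ : ℝ) * ρ) ^ k := by
          simp [Finset.sum_const, mul_pow]; ring
      _ ≤ ‖p k‖ * r' ^ k := by
          gcongr
          have : (Fintype.card σ : ℝ≥0) * ρ ≤ r' := by
            calc (Fintype.card σ : ℝ≥0) * ρ ≤ d * ρ := by gcongr; simp [d]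
              _ = r' := by simp only [ρ]; field_simp
          exact_mod_cast this
  let e := Equiv.sigmaFiberEquiv ex
  have hsum' := (e.summable_iff.2 hsum)
  have hfib (γ : σ →₀ ℕ) : Summable fun x : {x // ex x = γ} => ‖b x‖ := by
    have h1 := hsum'.sigma_factor γ
    have h2 : Summable fun x : {x // ex x = γ} => ‖b x‖ * monoVal (fun _ => ρ) γ := by
      refine h1.congr fun x => ?_
      simp [e, Equiv.sigmaFiberEquiv, x.2]
    exact (summable_mul_right_iff (by exact_mod_cast (monoVal_pos (fun _ => hρ0) γ).ne')).1 h2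
  refine ⟨fun γ => ∑' x : {x // ex x = γ}, b x, ρ, hρ0, ?_, fun z hz => ?_⟩
  · refine Summable.of_nonneg_of_le (fun γ => by positivity) (fun γ => ?_) hsum'.sigma
    have : ∀ x : {x // ex x = γ}, ((fun x => ‖b x‖ * (monoVal (fun _ => ρ) (ex x) : ℝ≥0)) ∘ e) ⟨γ, x⟩
        = ‖b x‖ * monoVal (fun _ => ρ) γ := fun x => by simp [e, Equiv.sigmaFiberEquiv, x.2]
    simp_rw [this]
    rw [tsum_mul_right]
    gcongr
    exact norm_tsum_le_tsum_norm (hfib γ)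
  · have habs : Summable fun x => b x * monoVal z (ex x) := by
      refine Summable.of_norm_bounded hsum fun x => ?_
      rw [norm_mul]
      gcongr
      exact norm_monoVal_le hz _
    have hzb : z ∈ Metric.eball (0 : σ → 𝕜) r := by
      have : ‖z‖₊ ≤ r' := (pi_nnnorm_le_iff).2 fun i => (hz i).trans (by exact_mod_cast hρr)
      rw [Metric.mem_eball, edist_zero_right]
      exact lt_of_le_of_lt (by exact_mod_cast this) hr'
    have h1 := hp.hasSum hzb
    have h2 : HasSum (fun x => b x * monoVal z (ex x)) (f z) := by
      have h3 := habs.hasSum.sigma (fun k => hasSum_fintype _)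
      have h4 : ∀ k, ∑ s : Fin k → σ, b ⟨k, s⟩ * monoVal z (ex ⟨k, s⟩) = p k fun _ => z := by
        intro k
        have : z = ∑ i, z i • (Pi.single i (1 : 𝕜) : σ → 𝕜) := by
          ext j; simp [Finset.sum_apply, Pi.single_apply]
        conv_rhs => rw [this]
        rw [ContinuousMultilinearMap.map_sum]
        refine Finset.sum_congr rfl fun s _ => ?_
        rw [ContinuousMultilinearMap.map_smul_univ, smul_eq_mul, mul_comm]
        congr 1
        exact monoVal_sum_single z s
      simp_rw [h4] at h3
      rw [zero_add] at h1
      rw [h1.unique h3]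
      exact habs.hasSum
    refine (e.hasSum_iff.2 h2).sigma fun γ => ?_
    have h5 : (fun x : {x // ex x = γ} => ((fun x => b x * monoVal z (ex x)) ∘ e) ⟨γ, x⟩)
        = fun x : {x // ex x = γ} => b x * monoVal z γ := by
      funext x; simp [e, Equiv.sigmaFiberEquiv, x.2]
    rw [h5]
    exact (hfib γ).of_norm.hasSum.mul_right (monoVal z γ)

end

section

variable {σ : Type} [Fintype σ]

/-- The weighted `ℓ¹` norm of a formal power series with respect to a polyradius. -/
noncomputable def wnorm (ρ : σ → ℝ≥0) (f : MvPowerSeries σ ℂ) : ℝ≥0∞ :=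
  ∑' γ, ‖MvPowerSeries.coeff γ f‖ₑ * (monoVal ρ γ : ℝ≥0)

/-- The sum of a formal power series at a point. -/
noncomputable def ev (f : MvPowerSeries σ ℂ) (z : σ → ℂ) : ℂ :=
  ∑' γ, MvPowerSeries.coeff γ f * monoVal z γ

variable {ρ : σ → ℝ≥0} {f g : MvPowerSeries σ ℂ}

theorem wnorm_mono {ρ' : σ → ℝ≥0} (h : ρ ≤ ρ') (f : MvPowerSeries σ ℂ) :
    wnorm ρ f ≤ wnorm ρ' f := by
  refine ENNReal.tsum_le_tsum fun γ => ?_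
  gcongr
  exact monoVal_mono h γ

theorem wnorm_add_le : wnorm ρ (f + g) ≤ wnorm ρ f + wnorm ρ g := by
  rw [wnorm, wnorm, wnorm, ← ENNReal.tsum_add]
  refine ENNReal.tsum_le_tsum fun γ => ?_
  rw [← add_mul, map_add]
  gcongr
  exact enorm_add_le _ _

theorem wnorm_zero : wnorm ρ 0 = 0 := by simp [wnorm]

theorem wnorm_neg : wnorm ρ (-f) = wnorm ρ f := by simp [wnorm]

theorem wnorm_sum_le {ι : Type*} (s : Finset ι) (f : ι → MvPowerSeries σ ℂ) :
    wnorm ρ (∑ i ∈ s, f i) ≤ ∑ i ∈ s, wnorm ρ (f i) := by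
  classical
  induction s using Finset.induction_on with
  | empty => simp [wnorm_zero]
  | insert a s ha ih =>
    rw [Finset.sum_insert ha, Finset.sum_insert ha]
    exact wnorm_add_le.trans (by gcongr)

theorem wnorm_mul_le : wnorm ρ (f * g) ≤ wnorm ρ f * wnorm ρ g := by
  classical
  have h1 : wnorm ρ f * wnorm ρ g = ∑' p : (σ →₀ ℕ) × (σ →₀ ℕ),
      (‖MvPowerSeries.coeff p.1 f‖ₑ * (monoVal ρ p.1 : ℝ≥0)) *
        (‖MvPowerSeries.coeff p.2 g‖ₑ * (monoVal ρ p.2 : ℝ≥0)) := by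
    rw [ENNReal.tsum_prod']
    simp_rw [ENNReal.tsum_mul_left, ENNReal.tsum_mul_right]
    rfl
  rw [h1, ← Finset.HasAntidiagonal.sigmaAntidiagonalEquivProd.tsum_eq, ENNReal.tsum_sigma']
  refine ENNReal.tsum_le_tsum fun γ => ?_
  rw [tsum_fintype, MvPowerSeries.coeff_mul]
  calc _ ≤ (∑ p ∈ Finset.HasAntidiagonal.antidiagonal γ, ‖MvPowerSeries.coeff p.1 f * MvPowerSeries.coeff p.2 g‖ₑ) *
        (monoVal ρ γ : ℝ≥0) := by gcongr; exact enorm_sum_le _ _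
    _ = ∑ p : Finset.HasAntidiagonal.antidiagonal γ, (‖MvPowerSeries.coeff p.1.1 f‖ₑ * (monoVal ρ p.1.1 : ℝ≥0)) *
        (‖MvPowerSeries.coeff p.1.2 g‖ₑ * (monoVal ρ p.1.2 : ℝ≥0)) := by
        rw [Finset.sum_mul, ← Finset.sum_coe_sort]
        refine Finset.sum_congr rfl fun p _ => ?_
        have : monoVal ρ γ = monoVal ρ p.1.1 * monoVal ρ p.1.2 := by
          rw [← monoVal_add, Finset.HasAntidiagonal.mem_antidiagonal.1 p.2]
        rw [this, enorm_mul]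
        push_cast
        ring
    _ ≤ _ := le_rfl

theorem wnorm_monomial (γ : σ →₀ ℕ) (c : ℂ) :
    wnorm ρ (MvPowerSeries.monomial γ c) = ‖c‖ₑ * (monoVal ρ γ : ℝ≥0) := by
  classical
  rw [wnorm, tsum_eq_single γ]
  · simp
  · intro δ hδ
    simp [MvPowerSeries.coeff_monomial, hδ]

theorem coeff_le_wnorm (γ : σ →₀ ℕ) :
    ‖MvPowerSeries.coeff γ f‖ₑ * (monoVal ρ γ : ℝ≥0) ≤ wnorm ρ f :=
  ENNReal.le_tsum γ

theorem summable_of_wnorm (h : wnorm ρ f < ⊤) :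
    Summable fun γ => ‖MvPowerSeries.coeff γ f‖ * monoVal ρ γ := by
  have := ENNReal.summable_toReal h.ne
  refine this.congr fun γ => ?_
  simp

theorem summable_ev (h : wnorm ρ f < ⊤) {z : σ → ℂ} (hz : ∀ i, ‖z i‖ ≤ ρ i) :
    Summable fun γ => ‖MvPowerSeries.coeff γ f * monoVal z γ‖ := by
  refine Summable.of_nonneg_of_le (fun _ => norm_nonneg _) (fun γ => ?_) (summable_of_wnorm h)
  rw [norm_mul]
  gcongr
  exact norm_monoVal_le hz γ

theorem hasSum_ev (h : wnorm ρ f < ⊤) {z : σ → ℂ} (hz : ∀ i, ‖z i‖ ≤ ρ i) :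
    HasSum (fun γ => MvPowerSeries.coeff γ f * monoVal z γ) (ev f z) :=
  (summable_ev h hz).of_norm.hasSum

theorem enorm_ev_le {z : σ → ℂ} (hz : ∀ i, ‖z i‖ ≤ ρ i) : ‖ev f z‖ₑ ≤ wnorm ρ f := by
  rcases lt_or_ge (wnorm ρ f) ⊤ with h | h
  · refine enorm_tsum_le_tsum_enorm.trans (ENNReal.tsum_le_tsum fun γ => ?_)
    rw [enorm_mul]
    gcongr
    have := norm_monoVal_le hz γ
    rw [← ofReal_norm]
    exact ENNReal.ofReal_le_of_le_toReal (by simpa using this)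
  · exact le_top.trans h

theorem ev_add (hf : wnorm ρ f < ⊤) (hg : wnorm ρ g < ⊤) {z : σ → ℂ} (hz : ∀ i, ‖z i‖ ≤ ρ i) :
    ev (f + g) z = ev f z + ev g z := by
  rw [← ((hasSum_ev hf hz).add (hasSum_ev hg hz)).tsum_eq]
  simp [ev, add_mul]

theorem ev_zero (z : σ → ℂ) : ev 0 z = 0 := by simp [ev]

theorem ev_sum {ι : Type*} (s : Finset ι) (f : ι → MvPowerSeries σ ℂ)
    (hf : ∀ i ∈ s, wnorm ρ (f i) < ⊤) {z : σ → ℂ} (hz : ∀ i, ‖z i‖ ≤ ρ i) :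
    ev (∑ i ∈ s, f i) z = ∑ i ∈ s, ev (f i) z := by
  rw [← (hasSum_sum fun i hi => hasSum_ev (hf i hi) hz).tsum_eq]
  simp [ev, Finset.sum_mul]

theorem ev_mul (hf : wnorm ρ f < ⊤) (hg : wnorm ρ g < ⊤) {z : σ → ℂ} (hz : ∀ i, ‖z i‖ ≤ ρ i) :
    ev (f * g) z = ev f z * ev g z := by
  classical
  have h := summable_mul_of_summable_norm (summable_ev hf hz) (summable_ev hg hz)
  rw [ev, ev, ev, (summable_ev hf hz).of_norm.tsum_mul_tsum_eq_tsum_sum_antidiagonal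
    (summable_ev hg hz).of_norm h]
  refine tsum_congr fun γ => ?_
  rw [MvPowerSeries.coeff_mul, Finset.sum_mul]
  refine Finset.sum_congr rfl fun p hp => ?_
  rw [← Finset.HasAntidiagonal.mem_antidiagonal.1 hp, monoVal_add]
  ring

theorem exists_pos_le (ρ : σ → ℝ≥0) (hρ : ∀ i, 0 < ρ i) : ∃ r : ℝ≥0, 0 < r ∧ ∀ i, r ≤ ρ i := by
  rcases isEmpty_or_nonempty σ with h | h
  · exact ⟨1, one_pos, fun i => h.elim i⟩
  · obtain ⟨i, hi⟩ := Finite.exists_min ρ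
    exact ⟨ρ i, hρ i, hi⟩

theorem eventually_norm_le (ρ : σ → ℝ≥0) (hρ : ∀ i, 0 < ρ i) :
    ∀ᶠ z : σ → ℂ in 𝓝 0, ∀ i, ‖z i‖ ≤ ρ i := by
  rw [eventually_all]
  intro i
  have : Tendsto (fun z : σ → ℂ => ‖z i‖) (𝓝 0) (𝓝 0) := by
    have : Continuous fun z : σ → ℂ => ‖z i‖ := by fun_prop
    simpa using this.tendsto 0
  filter_upwards [this.eventually (gt_mem_nhds (show (0 : ℝ) < ρ i from hρ i))] with z hz
  exact hz.le

theorem analyticAt_ev (hρ : ∀ i, 0 < ρ i) (hf : wnorm ρ f < ⊤) : AnalyticAt ℂ (ev f) 0 := by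
  obtain ⟨r, hr, hr'⟩ := exists_pos_le ρ hρ
  have h1 : wnorm (fun _ => r) f < ⊤ := (wnorm_mono hr' f).trans_lt hf
  exact hasFPowerSeries_of_summable hr (summable_of_wnorm h1) fun z hz => hasSum_ev h1 hz

theorem exists_ev {φ : (σ → ℂ) → ℂ} (h : AnalyticAt ℂ φ 0) :
    ∃ (f : MvPowerSeries σ ℂ) (r : ℝ≥0), 0 < r ∧ wnorm (fun _ => r) f < ⊤ ∧
      ∀ z : σ → ℂ, (∀ i, ‖z i‖ ≤ r) → φ z = ev f z := by
  obtain ⟨c, r, hr, hs, hf⟩ := exists_coeff_of_analyticAt h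
  refine ⟨c, r, hr, ?_, fun z hz => (hf z hz).tsum_eq.symm⟩
  have h1 := hs.tsum_ofReal_lt_top
  refine lt_of_eq_of_lt (tsum_congr fun γ => ?_) h1
  rw [ENNReal.ofReal_mul (norm_nonneg _), ofReal_norm, ENNReal.ofReal_coe_nnreal]
  rfl

end

section

variable {σ : Type} [Fintype σ]

/-- Pairwise distinct primes indexed by `σ`. -/
noncomputable def primeOf (i : σ) : ℕ := Nat.nth Nat.Prime (Fintype.equivFin σ i)

theorem primeOf_prime (i : σ) : (primeOf i).Prime :=
  Nat.nth_mem_of_infinite Nat.infinite_setOfPred_prime _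

theorem primeOf_injective : Function.Injective (primeOf : σ → ℕ) := fun _ _ h =>
  (Fintype.equivFin σ).injective (Fin.ext (Nat.nth_injective Nat.infinite_setOfPred_prime h))

theorem monoVal_primeOf_factorization (γ : σ →₀ ℕ) (i : σ) :
    (monoVal primeOf γ).factorization (primeOf i) = γ i := by
  classical
  rw [monoVal, Nat.factorization_prod fun j _ => pow_ne_zero _ (primeOf_prime j).ne_zero]
  rw [Finset.sum_apply', Finset.sum_eq_single i]
  · rw [(primeOf_prime i).factorization_pow]; simp
  · intro j _ hj
    rw [(primeOf_prime j).factorization_pow, Finsupp.single_apply, if_neg]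
    exact fun h => hj (primeOf_injective h)
  · simp

theorem monoVal_primeOf_injective : Function.Injective (monoVal (primeOf : σ → ℕ)) :=
  fun γ δ h => by
    ext i; rw [← monoVal_primeOf_factorization γ i, h, monoVal_primeOf_factorization]

theorem monoVal_primeOf_pos (γ : σ →₀ ℕ) : 0 < monoVal (primeOf : σ → ℕ) γ :=
  Finset.prod_pos fun i _ => pow_pos (primeOf_prime i).pos _

/-- The polyradius whose coordinates are the `k`-th powers of reciprocals of distinct primes. -/
noncomputable def rad (k : ℕ) (i : σ) : ℝ≥0 := ((primeOf i : ℝ≥0)⁻¹) ^ k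

theorem rad_pos (k : ℕ) (i : σ) : 0 < rad k i :=
  pow_pos (inv_pos.2 (by exact_mod_cast (primeOf_prime i).pos)) _

theorem monoVal_rad (k : ℕ) (γ : σ →₀ ℕ) :
    monoVal (rad k) γ = (((monoVal (primeOf : σ → ℕ) γ : ℕ) : ℝ≥0)⁻¹) ^ k := by
  simp only [monoVal, rad]
  push_cast
  rw [← Finset.prod_inv_distrib, ← Finset.prod_pow]
  refine Finset.prod_congr rfl fun i _ => ?_
  rw [← inv_pow, ← pow_mul, ← pow_mul, mul_comm]

theorem rad_tendsto (i : σ) : Tendsto (fun k => rad k i) atTop (𝓝 0) := by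
  refine NNReal.tendsto_pow_atTop_nhds_zero_of_lt_one (inv_lt_one_of_one_lt₀ ?_)
  exact_mod_cast (primeOf_prime i).one_lt

theorem rad_le_of_pos {ρ : σ → ℝ≥0} (hρ : ∀ i, 0 < ρ i) : ∀ᶠ k in atTop, rad k ≤ ρ := by
  have : ∀ᶠ k in atTop, ∀ i, rad k i ≤ ρ i := by
    rw [eventually_all]
    exact fun i => ((rad_tendsto i).eventually (gt_mem_nhds (hρ i))).mono fun _ h => h.le
  exact this

/-- `γ` is the exponent of least weight occurring in `f`. -/
def IsLead (f : MvPowerSeries σ ℂ) (γ : σ →₀ ℕ) : Prop :=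
  MvPowerSeries.coeff γ f ≠ 0 ∧ ∀ δ, MvPowerSeries.coeff δ f ≠ 0 →
    monoVal (primeOf : σ → ℕ) γ ≤ monoVal primeOf δ

theorem exists_isLead {f : MvPowerSeries σ ℂ} (hf : f ≠ 0) : ∃ γ, IsLead f γ := by
  classical
  obtain ⟨γ, hγ⟩ : ∃ γ, MvPowerSeries.coeff γ f ≠ 0 := by
    by_contra! h
    exact hf (MvPowerSeries.ext fun γ => by simp [h γ])
  have hex : ∃ n, ∃ γ, MvPowerSeries.coeff γ f ≠ 0 ∧ monoVal (primeOf : σ → ℕ) γ = n :=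
    ⟨_, γ, hγ, rfl⟩
  obtain ⟨γ0, h0, h1⟩ := Nat.find_spec hex
  exact ⟨γ0, h0, fun δ hδ => h1 ▸ Nat.find_min' hex ⟨δ, hδ, rfl⟩⟩

theorem IsLead.eventually_wnorm_le {f : MvPowerSeries σ ℂ} {γ : σ →₀ ℕ} (h : IsLead f γ)
    {k₀ : ℕ} (hk : wnorm (rad k₀) f < ⊤) {ε : ℝ≥0} (hε : 0 < ε) :
    ∀ᶠ k in atTop,
      wnorm (rad k) (f - MvPowerSeries.monomial γ (MvPowerSeries.coeff γ f)) ≤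
        ε * (monoVal (rad k) γ : ℝ≥0) := by
  classical
  set W : ℝ≥0 := ((monoVal (primeOf : σ → ℕ) γ : ℕ) : ℝ≥0) with hW
  have hW0 : 0 < W := Nat.cast_pos.2 (monoVal_primeOf_pos γ)
  set M : ℝ≥0 := (wnorm (rad k₀) f).toNNReal
  have hM : (M : ℝ≥0∞) = wnorm (rad k₀) f := ENNReal.coe_toNNReal hk.ne
  have key (j : ℕ) : wnorm (rad (k₀ + j))
      (f - MvPowerSeries.monomial γ (MvPowerSeries.coeff γ f)) ≤ M * ((W + 1)⁻¹ ^ j : ℝ≥0) := by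
    rw [hM, wnorm, wnorm, ← ENNReal.tsum_mul_right]
    refine ENNReal.tsum_le_tsum fun δ => ?_
    rw [map_sub, MvPowerSeries.coeff_monomial]
    split_ifs with h1
    · subst h1; simp
    · rw [sub_zero, monoVal_rad, monoVal_rad, pow_add, mul_assoc, ← ENNReal.coe_mul]
      by_cases h2 : MvPowerSeries.coeff δ f = 0
      · simp [h2]
      · gcongr
        have := h.2 δ h2
        have h3 : monoVal (primeOf : σ → ℕ) γ ≠ monoVal primeOf δ :=
          fun h => h1 (monoVal_primeOf_injective h).symm
        have : monoVal (primeOf : σ → ℕ) γ + 1 ≤ monoVal primeOf δ := by omega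
        rw [hW]
        exact_mod_cast this
  have hlim : Tendsto (fun j : ℕ => M * W ^ k₀ * (W * (W + 1)⁻¹) ^ j) atTop (𝓝 0) := by
    have : W * (W + 1)⁻¹ < 1 := by
      rw [← div_eq_mul_inv, div_lt_one (by positivity)]; exact lt_add_of_pos_right _ one_pos
    simpa using (NNReal.tendsto_pow_atTop_nhds_zero_of_lt_one this).const_mul (M * W ^ k₀)
  have hev := hlim.eventually (gt_mem_nhds hε)
  rw [eventually_atTop] at hev
  obtain ⟨J, hJ⟩ := hev
  filter_upwards [eventually_ge_atTop (k₀ + J)] with k hk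
  obtain ⟨j, rfl⟩ := Nat.exists_eq_add_of_le (le_of_add_le_left hk)
  refine (key j).trans ?_
  rw [monoVal_rad, ← ENNReal.coe_mul, ← ENNReal.coe_mul, ENNReal.coe_le_coe, ← hW]
  have h1 := (hJ j (by omega)).le
  calc M * (W + 1)⁻¹ ^ j = (M * W ^ k₀ * (W * (W + 1)⁻¹) ^ j) * W⁻¹ ^ (k₀ + j) := by
        rw [mul_pow, pow_add, inv_pow W, inv_pow W]; field_simp
    _ ≤ _ := by gcongr

theorem rad_tendsto_zero : Tendsto (fun k => fun i : σ => ((rad k i : ℝ) : ℂ)) atTop (𝓝 0) := by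
  rw [tendsto_pi_nhds]
  intro i
  have h1 : Tendsto (fun k => ((rad k i : ℝ≥0) : ℝ)) atTop (𝓝 (0 : ℝ≥0)) :=
    (NNReal.tendsto_coe.2 (rad_tendsto i))
  have := (Complex.continuous_ofReal.tendsto _).comp h1
  simpa [Function.comp_def] using this

theorem eq_zero_of_ev_eventually_zero {f : MvPowerSeries σ ℂ} {ρ : σ → ℝ≥0} (hρ : ∀ i, 0 < ρ i)
    (hf : wnorm ρ f < ⊤) (h : ∀ᶠ z in 𝓝 0, ev f z = 0) : f = 0 := by
  by_contra h0
  obtain ⟨γ, hγ⟩ := exists_isLead h0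
  obtain ⟨k₀, hk₀⟩ := (rad_le_of_pos hρ).exists
  have hfin : wnorm (rad k₀) f < ⊤ := (wnorm_mono hk₀ f).trans_lt hf
  set a := MvPowerSeries.coeff γ f
  have ha : 0 < ‖a‖₊ := nnnorm_pos.2 hγ.1
  obtain ⟨k, h1, h2, h3⟩ := ((hγ.eventually_wnorm_le hfin (half_pos ha)).and
    ((rad_tendsto_zero.eventually h).and (rad_le_of_pos hρ))).exists
  have hz : ∀ i : σ, ‖((rad k i : ℝ) : ℂ)‖ ≤ rad k i := fun i => by simp
  set m := MvPowerSeries.monomial γ a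
  have hm : wnorm (rad k) m < ⊤ := by
    rw [wnorm_monomial]; exact ENNReal.mul_lt_top (by simp) (by simp)
  have hfm : wnorm (rad k) (f - m) < ⊤ := h1.trans_lt (ENNReal.mul_lt_top ENNReal.coe_lt_top ENNReal.coe_lt_top)
  have e1 : ev f (fun i => ((rad k i : ℝ) : ℂ)) = ev (f - m) (fun i => ((rad k i : ℝ) : ℂ))
      + ev m (fun i => ((rad k i : ℝ) : ℂ)) := by
    rw [← ev_add hfm hm hz, sub_add_cancel]
  have e2 : ev m (fun i => ((rad k i : ℝ) : ℂ)) = a * (monoVal (rad k) γ : ℝ≥0) := by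
    classical
    rw [ev, tsum_eq_single γ]
    · simp [m, monoVal]
    · intro δ hδ; simp [m, MvPowerSeries.coeff_monomial, hδ]
  rw [h2, e2] at e1
  have e3 := (enorm_ev_le (f := f - m) hz).trans h1
  rw [eq_neg_of_add_eq_zero_left e1.symm, enorm_neg, enorm_mul] at e3
  have hpos := monoVal_pos (rad_pos k) γ
  have e4 : ‖a‖₊ * monoVal (rad k) γ ≤ ‖a‖₊ / 2 * monoVal (rad k) γ := by
    have : ‖((monoVal (rad k) γ : ℝ≥0) : ℂ)‖ₑ = (monoVal (rad k) γ : ℝ≥0) := by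
      rw [enorm_eq_nnnorm]; simp
    rw [enorm_eq_nnnorm a] at e3
    have e5 : ‖((((monoVal (rad k) γ : ℝ≥0) : ℝ)) : ℂ)‖ₑ = (monoVal (rad k) γ : ℝ≥0) := this
    rw [e5] at e3
    exact_mod_cast e3
  have := (mul_le_mul_iff_left₀ hpos).1 e4
  exact absurd this (not_le.2 (half_lt_self ha))

end

section

variable {σ : Type} [Fintype σ]

open scoped MvPowerSeries.WithPiTopology in
theorem exists_hasSum_of_wnorm {ρ : σ → ℝ≥0} (hρ : ∀ i, 0 < ρ i) (g : ℕ → MvPowerSeries σ ℂ)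
    (hg : ∑' n, wnorm ρ (g n) < ⊤) :
    ∃ G, HasSum g G ∧ wnorm ρ G ≤ ∑' n, wnorm ρ (g n) := by
  have h0 : ∑' n, wnorm ρ (g n) =
      ∑' δ, ∑' n, ‖MvPowerSeries.coeff δ (g n)‖ₑ * (monoVal ρ δ : ℝ≥0) := ENNReal.tsum_comm
  have h1 (δ) : Summable fun n => MvPowerSeries.coeff δ (g n) := by
    have h2 : ∑' n, ‖MvPowerSeries.coeff δ (g n)‖ₑ * (monoVal ρ δ : ℝ≥0) < ⊤ := by
      refine lt_of_le_of_lt ?_ hg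
      exact ENNReal.tsum_le_tsum fun n => coeff_le_wnorm δ
    rw [ENNReal.tsum_mul_right] at h2
    have h3 : ∑' n, ‖MvPowerSeries.coeff δ (g n)‖ₑ ≠ ⊤ := by
      intro h
      rw [h, ENNReal.top_mul (by simpa using (monoVal_pos hρ δ).ne')] at h2
      exact lt_irrefl _ h2
    refine Summable.of_norm ((ENNReal.summable_toReal h3).congr fun n => by simp)
  refine ⟨fun δ => ∑' n, MvPowerSeries.coeff δ (g n), ?_, ?_⟩
  · exact MvPowerSeries.WithPiTopology.hasSum_iff_hasSum_coeff.2 fun δ => (h1 δ).hasSum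
  · rw [h0]
    refine ENNReal.tsum_le_tsum fun δ => ?_
    rw [ENNReal.tsum_mul_right]
    gcongr
    exact enorm_tsum_le_tsum_enorm

section Division

variable {ι : Type} [Fintype ι] (γ : ι → σ →₀ ℕ)

open Classical in
/-- A choice of a corner of the staircase below `δ`, if there is one. -/
noncomputable def corner (δ : σ →₀ ℕ) : Option ι :=
  if h : ∃ j, γ j ≤ δ then some h.choose else none

theorem corner_some {δ : σ →₀ ℕ} {j : ι} (h : corner γ δ = some j) : γ j ≤ δ := by
  unfold corner at h
  split_ifs at h with h1
  rw [← Option.some_injective _ h]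
  exact h1.choose_spec

open Classical in
/-- The part of `f` divisible by the `j`-th corner monomial, divided by that monomial. -/
noncomputable def cornerPart (j : ι) (f : MvPowerSeries σ ℂ) : MvPowerSeries σ ℂ :=
  fun δ => if corner γ (δ + γ j) = some j then MvPowerSeries.coeff (δ + γ j) f else 0

open Classical in
/-- The part of `f` below the staircase. -/
noncomputable def belowPart (f : MvPowerSeries σ ℂ) : MvPowerSeries σ ℂ :=
  fun δ => if corner γ δ = none then MvPowerSeries.coeff δ f else 0

theorem sum_cornerPart_add_belowPart (f : MvPowerSeries σ ℂ) :
    ∑ j, cornerPart γ j f * MvPowerSeries.monomial (γ j) 1 + belowPart γ f = f := by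
  classical
  ext δ
  rw [map_add, map_sum]
  have h1 (j : ι) : MvPowerSeries.coeff δ (cornerPart γ j f * MvPowerSeries.monomial (γ j) 1)
      = if corner γ δ = some j then MvPowerSeries.coeff δ f else 0 := by
    rw [MvPowerSeries.coeff_mul_monomial]
    split_ifs with h1 h2 h2
    · rw [mul_one]
      change (if _ then _ else _) = _
      rw [tsub_add_cancel_of_le h1, if_pos h2]
    · rw [mul_one]
      change (if _ then _ else _) = _
      rw [tsub_add_cancel_of_le h1, if_neg h2]
    · exact absurd (corner_some γ h2) h1
    · rfl
  have h2 : MvPowerSeries.coeff δ (belowPart γ f)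
      = if corner γ δ = none then MvPowerSeries.coeff δ f else 0 := rfl
  simp_rw [h1]
  rw [h2]
  cases corner γ δ <;> simp

theorem wnorm_cornerPart_add_le (ρ : σ → ℝ≥0) (f : MvPowerSeries σ ℂ) :
    ∑ j, wnorm ρ (cornerPart γ j f) * (monoVal ρ (γ j) : ℝ≥0) + wnorm ρ (belowPart γ f) ≤
      wnorm ρ f := by
  classical
  let G : Option ι → (σ →₀ ℕ) → ℝ≥0∞ := fun o δ =>
    if corner γ δ = o then ‖MvPowerSeries.coeff δ f‖ₑ * (monoVal ρ δ : ℝ≥0) else 0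
  have h1 (j : ι) : wnorm ρ (cornerPart γ j f) * (monoVal ρ (γ j) : ℝ≥0) ≤ ∑' δ, G (some j) δ := by
    have h2 := ENNReal.tsum_comp_le_tsum_of_injective (add_left_injective (γ j)) (G (some j))
    refine le_trans (le_of_eq ?_) h2
    rw [wnorm, ← ENNReal.tsum_mul_right]
    refine tsum_congr fun δ => ?_
    have : MvPowerSeries.coeff δ (cornerPart γ j f)
      = if corner γ (δ + γ j) = some j then MvPowerSeries.coeff (δ + γ j) f else 0 := rfl
    simp only [this, G]
    split_ifs with h
    · rw [monoVal_add, ENNReal.coe_mul, mul_assoc]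
    · simp
  have h3 : wnorm ρ (belowPart γ f) = ∑' δ, G none δ := by
    refine tsum_congr fun δ => ?_
    have : MvPowerSeries.coeff δ (belowPart γ f)
      = if corner γ δ = none then MvPowerSeries.coeff δ f else 0 := rfl
    simp only [this, G]
    split_ifs <;> simp
  refine (add_le_add (Finset.sum_le_sum fun j _ => h1 j) h3.le).trans ?_
  rw [← Summable.tsum_finsetSum fun _ _ => ENNReal.summable, ← ENNReal.tsum_add]
  refine ENNReal.tsum_le_tsum fun δ => le_of_eq ?_
  simp only [G]
  cases corner γ δ <;> simp

open scoped MvPowerSeries.WithPiTopology in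
theorem exists_division {ρ : σ → ℝ≥0} (hρ : ∀ i, 0 < ρ i) (F : ι → MvPowerSeries σ ℂ)
    (hF : ∀ j, wnorm ρ (F j - MvPowerSeries.monomial (γ j) 1) ≤
      (2⁻¹ : ℝ≥0) * (monoVal ρ (γ j) : ℝ≥0))
    (f : MvPowerSeries σ ℂ) (hf : wnorm ρ f < ⊤) :
    ∃ (q : ι → MvPowerSeries σ ℂ) (r : MvPowerSeries σ ℂ), f = ∑ j, q j * F j + r ∧
      (∀ j, wnorm ρ (q j) * (monoVal ρ (γ j) : ℝ≥0) ≤ 2 * wnorm ρ f) ∧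
      wnorm ρ r ≤ 2 * wnorm ρ f ∧ ∀ δ, (∃ j, γ j ≤ δ) → MvPowerSeries.coeff δ r = 0 := by
  classical
  let E : MvPowerSeries σ ℂ → MvPowerSeries σ ℂ := fun f =>
    -∑ j, cornerPart γ j f * (F j - MvPowerSeries.monomial (γ j) 1)
  have hE1 (f) : ∑ j, cornerPart γ j f * F j + belowPart γ f = f - E f := by
    have := sum_cornerPart_add_belowPart γ f
    simp only [E, mul_sub, Finset.sum_sub_distrib]
    linear_combination this
  have hE2 (f) : wnorm ρ (E f) ≤ 2⁻¹ * wnorm ρ f := by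
    simp only [E]
    rw [wnorm_neg]
    calc _ ≤ ∑ j, wnorm ρ (cornerPart γ j f) * ((2⁻¹ : ℝ≥0) * (monoVal ρ (γ j) : ℝ≥0)) := by
          refine (wnorm_sum_le _ _).trans (Finset.sum_le_sum fun j _ => wnorm_mul_le.trans ?_)
          gcongr
          exact hF j
      _ = 2⁻¹ * ∑ j, wnorm ρ (cornerPart γ j f) * (monoVal ρ (γ j) : ℝ≥0) := by
          rw [Finset.mul_sum]
          refine Finset.sum_congr rfl fun j _ => ?_
          rw [ENNReal.coe_inv two_ne_zero]
          push_cast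
          ring
      _ ≤ _ := by
          gcongr
          exact le_self_add.trans (wnorm_cornerPart_add_le γ ρ f)
  have hn (n : ℕ) : wnorm ρ (E^[n] f) ≤ 2⁻¹ ^ n * wnorm ρ f := by
    induction n with
    | zero => simp
    | succ n ih =>
      rw [Function.iterate_succ_apply', pow_succ', mul_assoc]
      exact (hE2 _).trans (by gcongr)
  have hsum : ∑' n, wnorm ρ (E^[n] f) ≤ 2 * wnorm ρ f := by
    refine (ENNReal.tsum_le_tsum hn).trans ?_
    rw [ENNReal.tsum_mul_right, ENNReal.tsum_geometric, ENNReal.one_sub_inv_two, inv_inv]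
  have hfin : 2 * wnorm ρ f < ⊤ := ENNReal.mul_lt_top (by simp) hf
  have hcn (j : ι) : ∑' n, wnorm ρ (cornerPart γ j (E^[n] f)) * (monoVal ρ (γ j) : ℝ≥0) ≤
      2 * wnorm ρ f := by
    refine (ENNReal.tsum_le_tsum fun n => ?_).trans hsum
    refine le_trans ?_ (wnorm_cornerPart_add_le γ ρ _)
    refine le_trans ?_ le_self_add
    exact Finset.single_le_sum (f := fun j => wnorm ρ (cornerPart γ j (E^[n] f)) *
      (monoVal ρ (γ j) : ℝ≥0)) (fun _ _ => zero_le) (Finset.mem_univ j)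
  have hbn : ∑' n, wnorm ρ (belowPart γ (E^[n] f)) ≤ 2 * wnorm ρ f := by
    refine (ENNReal.tsum_le_tsum fun n => ?_).trans hsum
    exact le_trans le_add_self (wnorm_cornerPart_add_le γ ρ _)
  have hcn' (j : ι) : ∑' n, wnorm ρ (cornerPart γ j (E^[n] f)) < ⊤ := by
    have := (hcn j).trans_lt hfin
    rw [ENNReal.tsum_mul_right] at this
    refine lt_top_iff_ne_top.2 fun h => ?_
    rw [h, ENNReal.top_mul (by simpa using (monoVal_pos hρ (γ j)).ne')] at this
    exact lt_irrefl _ this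
  choose q hq1 hq2 using fun j => exists_hasSum_of_wnorm hρ _ (hcn' j)
  obtain ⟨r, hr1, hr2⟩ := exists_hasSum_of_wnorm hρ _ (hbn.trans_lt hfin)
  obtain ⟨S, hS, -⟩ := exists_hasSum_of_wnorm hρ _ (hsum.trans_lt hfin)
  refine ⟨q, r, ?_, fun j => ?_, hr2.trans hbn, fun δ hδ => ?_⟩
  · have h1 : HasSum (fun n => ∑ j, cornerPart γ j (E^[n] f) * F j + belowPart γ (E^[n] f))
        (∑ j, q j * F j + r) :=
      (hasSum_sum fun j _ => (hq1 j).mul_right (F j)).add hr1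
    have h2 : HasSum (fun n => E^[n] f - E^[n + 1] f) (S - (S - f)) := by
      refine hS.sub ?_
      have := (hasSum_nat_add_iff' 1).2 hS
      simpa using this
    simp_rw [hE1] at h1
    simp_rw [Function.iterate_succ_apply'] at h2
    have := h2.unique h1
    rw [← this]
    ring
  · refine le_trans ?_ (hcn j)
    rw [ENNReal.tsum_mul_right]
    gcongr
    exact hq2 j
  · rw [MvPowerSeries.WithPiTopology.hasSum_iff_hasSum_coeff] at hr1
    refine (hr1 δ).unique ?_
    convert hasSum_zero with n
    change (if _ then _ else _) = _
    rw [if_neg]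
    simp [corner, hδ]

end Division

end

section

variable {τ : Type} [Fintype τ]

/-- The ring of formal power series that converge near the origin. -/
def convSubring (τ : Type) [Fintype τ] : Subring (MvPowerSeries τ ℂ) where
  carrier := {f | ∀ᶠ k in atTop, wnorm (rad k) f < ⊤}
  mul_mem' := fun {f g} hf hg => by
    filter_upwards [hf, hg] with k h1 h2
    exact wnorm_mul_le.trans_lt (ENNReal.mul_lt_top h1 h2)
  add_mem' := fun {f g} hf hg => by
    filter_upwards [hf, hg] with k h1 h2
    exact wnorm_add_le.trans_lt (ENNReal.add_lt_top.2 ⟨h1, h2⟩)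
  neg_mem' := fun {f} hf => by
    filter_upwards [hf] with k h1
    rwa [wnorm_neg]
  one_mem' := by
    refine Eventually.of_forall fun k => ?_
    rw [← MvPowerSeries.monomial_zero_one, wnorm_monomial]
    simp
  zero_mem' := by simp [wnorm_zero]

theorem mem_convSubring {f : MvPowerSeries τ ℂ} {ρ : τ → ℝ≥0} (hρ : ∀ i, 0 < ρ i)
    (hf : wnorm ρ f < ⊤) : f ∈ convSubring τ :=
  (rad_le_of_pos hρ).mono fun _ hk => (wnorm_mono hk f).trans_lt hf

/-- Every family of power series with a common polyradius of convergence is generated, with norm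
control, by a finite subfamily. -/
theorem exists_finite_generators {M : Type} {ρ : τ → ℝ≥0} (hρ : ∀ i, 0 < ρ i)
    (a : M → MvPowerSeries τ ℂ) (ha : ∀ μ, wnorm ρ (a μ) < ⊤) :
    ∃ (F : Finset M) (ρ' : τ → ℝ≥0) (C : ℝ≥0) (c : M → M → MvPowerSeries τ ℂ),
      (∀ i, 0 < ρ' i) ∧ ρ' ≤ ρ ∧ (∀ μ, a μ = ∑ ν ∈ F, c μ ν * a ν) ∧
      ∀ μ ν, wnorm ρ' (c μ ν) ≤ C * wnorm ρ (a μ) := by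
  classical
  let I : Submodule (convSubring τ) (MvPowerSeries τ ℂ) := Submodule.span _ (Set.range a)
  have haI (μ) : a μ ∈ I := Submodule.subset_span ⟨μ, rfl⟩
  have hIc (f) (hf : f ∈ I) : f ∈ convSubring τ := by
    refine Submodule.span_induction ?_ ?_ ?_ ?_ hf
    · rintro _ ⟨μ, rfl⟩; exact mem_convSubring hρ (ha μ)
    · exact zero_mem _
    · exact fun _ _ _ _ h1 h2 => add_mem h1 h2
    · exact fun c _ _ h => mul_mem c.2 h
  let Λ : Set (τ →₀ ℕ) := {γ | ∃ f ∈ I, IsLead f γ}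
  have hfin : {γ | Minimal (· ∈ Λ) γ}.Finite :=
    WellQuasiOrderedLE.finite_of_isAntichain (setOfPred_minimal_antichain _)
  let ι := hfin.toFinset
  have hι (j : ι) : j.1 ∈ Λ := (hfin.mem_toFinset.1 j.2).1
  choose g hgI hgL using hι
  let f : ι → MvPowerSeries τ ℂ := fun j => MvPowerSeries.C (MvPowerSeries.coeff j.1 (g j))⁻¹ * g j
  have hC (x : ℂ) : MvPowerSeries.C x ∈ convSubring τ := by
    refine Eventually.of_forall fun k => ?_
    rw [← MvPowerSeries.monomial_zero_eq_C_apply, wnorm_monomial, monoVal_zero]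
    simp
  have hfI (j) : f j ∈ I := I.smul_mem ⟨_, hC _⟩ (hgI j)
  have hf1 (j) : MvPowerSeries.coeff j.1 (f j) = 1 := by
    simp only [f, MvPowerSeries.coeff_C_mul]
    exact inv_mul_cancel₀ (hgL j).1
  have hfL (j) : IsLead (f j) j.1 := by
    refine ⟨by simp [hf1], fun δ hδ => (hgL j).2 δ fun h => hδ ?_⟩
    simp [f, MvPowerSeries.coeff_C_mul, h]
  have hb (j : ι) : ∃ b : M →₀ convSubring τ, (b.sum fun i x => x • a i) = f j :=
    Finsupp.mem_span_range_iff_exists_finsupp.1 (hfI j)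
  choose b hb using hb
  let F : Finset M := Finset.univ.biUnion fun j => (b j).support
  have hb' (j) : f j = ∑ ν ∈ F, (b j ν : MvPowerSeries τ ℂ) * a ν := by
    rw [← hb j, Finsupp.sum]
    refine Finset.sum_subset (f := fun ν => (b j ν : MvPowerSeries τ ℂ) * a ν)
      (Finset.subset_biUnion_of_mem (fun j => (b j).support) (Finset.mem_univ j)) fun ν _ hν => ?_
    simp [Finsupp.notMem_support_iff.1 hν]
  have hk1 : ∀ᶠ k in atTop, ∀ j, wnorm (rad k) (f j - MvPowerSeries.monomial j.1 1) ≤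
      (2⁻¹ : ℝ≥0) * (monoVal (rad k) j.1 : ℝ≥0) := by
    rw [eventually_all]
    intro j
    obtain ⟨k₀, hk₀⟩ := (hIc _ (hfI j)).exists
    have := (hfL j).eventually_wnorm_le hk₀ (ε := 2⁻¹) (by positivity)
    rwa [hf1] at this
  have hk2 : ∀ᶠ k in atTop, ∀ j, ∀ ν ∈ F, wnorm (rad k) (b j ν : MvPowerSeries τ ℂ) < ⊤ := by
    rw [eventually_all]
    intro j
    rw [Filter.eventually_all_finset]
    exact fun ν _ => (b j ν).2
  obtain ⟨k, hk1, hk2, hk3⟩ := (hk1.and (hk2.and (rad_le_of_pos hρ))).exists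
  have hak (μ) : wnorm (rad k) (a μ) ≤ wnorm ρ (a μ) := wnorm_mono hk3 _
  choose q r hq1 hq2 hq3 hq4 using fun μ =>
    exists_division (fun j : ι => j.1) (rad_pos k) f hk1 (a μ) ((hak μ).trans_lt (ha μ))
  have hq5 (μ) (j : ι) : wnorm (rad k) (q μ j) ≤
      ((monoVal (rad k) j.1)⁻¹ * 2 : ℝ≥0) * wnorm ρ (a μ) := by
    have h1 : wnorm (rad k) (q μ j) * (monoVal (rad k) j.1 : ℝ≥0) ≤ 2 * wnorm ρ (a μ) :=
      (hq2 μ j).trans (by gcongr; exact hak μ)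
    have h2 : (monoVal (rad k) j.1 : ℝ≥0) ≠ 0 := (monoVal_pos (rad_pos k) _).ne'
    calc wnorm (rad k) (q μ j) = ((monoVal (rad k) j.1)⁻¹ : ℝ≥0) *
          (wnorm (rad k) (q μ j) * (monoVal (rad k) j.1 : ℝ≥0)) := by
          rw [mul_left_comm, ← ENNReal.coe_mul, inv_mul_cancel₀ h2]; simp
      _ ≤ ((monoVal (rad k) j.1)⁻¹ : ℝ≥0) * (2 * wnorm ρ (a μ)) := by gcongr
      _ = _ := by rw [ENNReal.coe_mul, mul_assoc]; rfl
  have hr0 (μ) : r μ = 0 := by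
    by_contra h
    obtain ⟨γ, hγ⟩ := exists_isLead h
    have hrI : r μ ∈ I := by
      have : r μ = a μ - ∑ j, q μ j * f j := by rw [hq1 μ]; ring
      rw [this]
      refine sub_mem (haI μ) (sum_mem fun j _ => I.smul_mem ⟨q μ j, ?_⟩ (hfI j))
      exact mem_convSubring (rad_pos k) ((hq5 μ j).trans_lt
        (ENNReal.mul_lt_top ENNReal.coe_lt_top (ha μ)))
    obtain ⟨δ, hδ, hδm⟩ := exists_minimal_le_of_wellFoundedLT (· ∈ Λ) γ ⟨_, hrI, hγ⟩
    exact hγ.1 (hq4 μ γ ⟨⟨δ, hfin.mem_toFinset.2 hδm⟩, hδ⟩)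
  refine ⟨F, rad k, ∑ j : ι, ((monoVal (rad k) j.1)⁻¹ * 2) *
      ∑ ν ∈ F, (wnorm (rad k) (b j ν : MvPowerSeries τ ℂ)).toNNReal,
    fun μ ν => if ν ∈ F then ∑ j, q μ j * b j ν else 0, rad_pos k, hk3, fun μ => ?_, fun μ ν => ?_⟩
  · conv_lhs => rw [hq1 μ, hr0, add_zero]
    simp_rw [fun j => hb' j, Finset.mul_sum]
    rw [Finset.sum_comm]
    refine Finset.sum_congr rfl fun ν hν => ?_
    rw [if_pos hν, Finset.sum_mul]
    exact Finset.sum_congr rfl fun j _ => by ring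
  · by_cases hν : ν ∈ F
    · simp only [if_pos hν]
      refine (wnorm_sum_le _ _).trans ?_
      push_cast
      rw [Finset.sum_mul]
      refine Finset.sum_le_sum fun j _ => wnorm_mul_le.trans ?_
      have h1 : wnorm (rad k) (b j ν : MvPowerSeries τ ℂ) ≤
          ∑ ν ∈ F, ((wnorm (rad k) (b j ν : MvPowerSeries τ ℂ)).toNNReal : ℝ≥0∞) := by
        rw [← ENNReal.coe_toNNReal (hk2 j ν hν).ne]
        exact Finset.single_le_sum (f := fun ν =>
          ((wnorm (rad k) (b j ν : MvPowerSeries τ ℂ)).toNNReal : ℝ≥0∞)) (fun _ _ => zero_le) hν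
      refine (mul_le_mul' (hq5 μ j) h1).trans (le_of_eq ?_)
      push_cast
      ring
    · simp [hν, wnorm_zero]

end

section

variable {τ σ : Type} [Fintype τ] [Fintype σ]

/-- Splitting a joint exponent into its two blocks, second block first. -/
noncomputable def expSplit (τ σ : Type) : (τ ⊕ σ →₀ ℕ) ≃ (σ →₀ ℕ) × (τ →₀ ℕ) :=
  Finsupp.sumFinsuppEquivProdFinsupp.trans (Equiv.prodComm _ _)

theorem monoVal_expSplit {R : Type*} [CommMonoid R] (t : τ → R) (x : σ → R)
    (p : (σ →₀ ℕ) × (τ →₀ ℕ)) :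
    monoVal (Sum.elim t x) ((expSplit τ σ).symm p) = monoVal t p.2 * monoVal x p.1 := by
  simp [monoVal, expSplit, Fintype.prod_sum_type]

/-- The coefficient of `x ^ μ` in a power series in two blocks of variables. -/
noncomputable def slice (h : MvPowerSeries (τ ⊕ σ) ℂ) (μ : σ →₀ ℕ) : MvPowerSeries τ ℂ :=
  fun γ => MvPowerSeries.coeff ((expSplit τ σ).symm (μ, γ)) h

/-- The power series with given coefficients of `x ^ μ`. -/
noncomputable def unslice (a : (σ →₀ ℕ) → MvPowerSeries τ ℂ) : MvPowerSeries (τ ⊕ σ) ℂ :=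
  fun δ => MvPowerSeries.coeff ((expSplit τ σ) δ).2 (a ((expSplit τ σ) δ).1)

theorem slice_unslice (a : (σ →₀ ℕ) → MvPowerSeries τ ℂ) (μ : σ →₀ ℕ) :
    slice (unslice a) μ = a μ := by
  ext γ
  change MvPowerSeries.coeff ((expSplit τ σ) ((expSplit τ σ).symm (μ, γ))).2
    (a ((expSplit τ σ) ((expSplit τ σ).symm (μ, γ))).1) = _
  rw [Equiv.apply_symm_apply]

theorem wnorm_eq_tsum_slice (ρ : τ → ℝ≥0) (r : σ → ℝ≥0) (h : MvPowerSeries (τ ⊕ σ) ℂ) :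
    wnorm (Sum.elim ρ r) h = ∑' μ, wnorm ρ (slice h μ) * (monoVal r μ : ℝ≥0) := by
  rw [wnorm, ← (expSplit τ σ).symm.tsum_eq, ENNReal.tsum_prod']
  refine tsum_congr fun μ => ?_
  rw [wnorm, ← ENNReal.tsum_mul_right]
  refine tsum_congr fun γ => ?_
  rw [monoVal_expSplit, ENNReal.coe_mul, mul_assoc]
  rfl

theorem wnorm_slice_lt_top {ρ : τ → ℝ≥0} {r : σ → ℝ≥0} (hr : ∀ i, 0 < r i)
    {h : MvPowerSeries (τ ⊕ σ) ℂ} (hh : wnorm (Sum.elim ρ r) h < ⊤) (μ : σ →₀ ℕ) :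
    wnorm ρ (slice h μ) < ⊤ := by
  rw [wnorm_eq_tsum_slice] at hh
  have h1 := (ENNReal.le_tsum μ).trans_lt hh
  refine lt_top_iff_ne_top.2 fun h => ?_
  rw [h, ENNReal.top_mul (by simpa using (monoVal_pos hr μ).ne')] at h1
  exact lt_irrefl _ h1

theorem hasSum_slice {ρ : τ → ℝ≥0} {r : σ → ℝ≥0} (hr : ∀ i, 0 < r i)
    {h : MvPowerSeries (τ ⊕ σ) ℂ} (hh : wnorm (Sum.elim ρ r) h < ⊤) {t : τ → ℂ} {x : σ → ℂ}
    (ht : ∀ i, ‖t i‖ ≤ ρ i) (hx : ∀ i, ‖x i‖ ≤ r i) :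
    HasSum (fun μ => ev (slice h μ) t * monoVal x μ) (ev h (Sum.elim t x)) := by
  have h1 := hasSum_ev hh (z := Sum.elim t x) (by rintro (i | i) <;> simp [ht, hx])
  have h2 := (expSplit τ σ).symm.hasSum_iff.2 h1
  refine h2.prod_fiberwise fun μ => ?_
  have h3 := (hasSum_ev (wnorm_slice_lt_top hr hh μ) ht).mul_right (monoVal x μ)
  refine h3.congr_fun ?_ |> fun h => h
  intro γ
  simp only [Function.comp, monoVal_expSplit, ← mul_assoc]
  rfl

theorem ev_zero_right (f : MvPowerSeries σ ℂ) : ev f 0 = MvPowerSeries.coeff 0 f := by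
  classical
  rw [ev, tsum_eq_single 0]
  · simp [monoVal]
  · intro γ hγ
    obtain ⟨i, hi⟩ := Finsupp.ne_iff.1 hγ
    have : monoVal (0 : σ → ℂ) γ = 0 :=
      Finset.prod_eq_zero (Finset.mem_univ i) (by simpa using hi)
    simp [this]

theorem ev_C (c : ℂ) (z : σ → ℂ) : ev (MvPowerSeries.C c) z = c := by
  classical
  rw [ev, tsum_eq_single 0]
  · simp [monoVal_zero]
  · intro γ hγ
    simp [MvPowerSeries.coeff_C, hγ]

theorem wnorm_C (c : ℂ) (ρ : σ → ℝ≥0) : wnorm ρ (MvPowerSeries.C c) = ‖c‖ₑ := by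
  rw [← MvPowerSeries.monomial_zero_eq_C_apply, wnorm_monomial, monoVal_zero]; simp

theorem sumElim_const (r : ℝ≥0) : (fun _ : τ ⊕ σ => r) = Sum.elim (fun _ => r) (fun _ => r) := by
  ext (i | i) <;> rfl

theorem exists_bautin_pi {φ : (τ ⊕ σ → ℂ) → ℂ} (hφ : AnalyticAt ℂ φ 0) :
    ∃ (F : Finset (σ →₀ ℕ)) (a : (σ →₀ ℕ) → (τ → ℂ) → ℂ) (H : (σ →₀ ℕ) → (τ ⊕ σ → ℂ) → ℂ),
      (∀ ν, AnalyticAt ℂ (a ν) 0) ∧ (∀ ν, AnalyticAt ℂ (H ν) 0) ∧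
      (∀ᶠ q in 𝓝 0, φ q = ∑ ν ∈ F, a ν (q ∘ Sum.inl) * H ν q) ∧
      ∀ s : (σ →₀ ℕ) → ℂ, (∃ ν ∈ F, s ν ≠ 0) →
        ¬ ∀ᶠ x in 𝓝 (0 : σ → ℂ), ∑ ν ∈ F, s ν * H ν (Sum.elim 0 x) = 0 := by
  classical
  obtain ⟨h, r, hr, hh, hφh⟩ := exists_ev hφ
  rw [sumElim_const] at hh
  have hr' : ∀ i : σ, 0 < (fun _ => r : σ → ℝ≥0) i := fun _ => hr
  obtain ⟨F, ρ', C, c₀, hρ', hρr, hc₀, hcn⟩ := exists_finite_generators (M := σ →₀ ℕ)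
    (ρ := fun _ : τ => r) (fun _ => hr) (slice h) (wnorm_slice_lt_top hr' hh)
  let c : (σ →₀ ℕ) → (σ →₀ ℕ) → MvPowerSeries τ ℂ := fun μ ν =>
    if μ ∈ F then (if μ = ν then 1 else 0) else c₀ μ ν
  have hc (μ) : slice h μ = ∑ ν ∈ F, c μ ν * slice h ν := by
    by_cases hμ : μ ∈ F
    · simp [c, hμ]
    · simp only [c, hμ, if_false]; exact hc₀ μ
  have hHn (ν) : wnorm (Sum.elim ρ' fun _ => r) (unslice fun μ => c μ ν) < ⊤ := by
    rw [wnorm_eq_tsum_slice]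
    simp_rw [slice_unslice]
    have h1 : ∀ μ, wnorm ρ' (c μ ν) * (monoVal (fun _ : σ => r) μ : ℝ≥0) ≤
        C * (wnorm (fun _ => r) (slice h μ) * (monoVal (fun _ : σ => r) μ : ℝ≥0)) +
        if μ ∈ F then ((monoVal (fun _ : σ => r) μ : ℝ≥0) : ℝ≥0∞) else 0 := by
      intro μ
      by_cases hμ : μ ∈ F
      · refine le_trans ?_ le_add_self
        simp only [c, hμ, if_true]
        split_ifs
        · rw [← map_one MvPowerSeries.C, wnorm_C]; simp
        · simp [wnorm_zero]
      · refine le_trans ?_ le_self_add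
        simp only [c, hμ, if_false]
        rw [← mul_assoc]
        gcongr
        exact hcn μ ν
    refine (ENNReal.tsum_le_tsum h1).trans_lt ?_
    rw [ENNReal.tsum_add, ENNReal.tsum_mul_left, ← wnorm_eq_tsum_slice]
    refine ENNReal.add_lt_top.2 ⟨ENNReal.mul_lt_top ENNReal.coe_lt_top hh, ?_⟩
    rw [tsum_eq_sum (s := F) (fun μ hμ => by simp [hμ])]
    refine ENNReal.sum_lt_top.2 fun μ hμ => ?_
    simp [hμ]
  have hpos : ∀ i, 0 < (Sum.elim ρ' (fun _ : σ => r)) i := by rintro (i | i) <;> simp [hρ', hr]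
  refine ⟨F, fun ν => ev (slice h ν), fun ν => ev (unslice fun μ => c μ ν),
    fun ν => analyticAt_ev (fun _ => hr) (wnorm_slice_lt_top hr' hh ν),
    fun ν => analyticAt_ev hpos (hHn ν), ?_, fun s hs hev => ?_⟩
  · filter_upwards [eventually_norm_le _ hpos] with q hq
    have hq1 : ∀ i, ‖(q ∘ Sum.inl) i‖ ≤ ρ' i := fun i => hq (Sum.inl i)
    have hq2 : ∀ i, ‖(q ∘ Sum.inr) i‖ ≤ r := fun i => hq (Sum.inr i)
    have hq3 : ∀ i, ‖(q ∘ Sum.inl) i‖ ≤ r := fun i => (hq1 i).trans (by exact_mod_cast hρr i)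
    have hqe : Sum.elim (q ∘ Sum.inl) (q ∘ Sum.inr) = q := Sum.elim_comp_inl_inr q
    rw [hφh q (by rintro (i | i); exacts [hq3 i, hq2 i])]
    have h1 := hasSum_slice hr' hh hq3 hq2
    have h2 : HasSum (fun μ => ∑ ν ∈ F, ev (slice h ν) (q ∘ Sum.inl) *
        (ev (slice (unslice fun μ => c μ ν) μ) (q ∘ Sum.inl) * monoVal (q ∘ Sum.inr) μ))
        (∑ ν ∈ F, ev (slice h ν) (q ∘ Sum.inl) *
          ev (unslice fun μ => c μ ν) (Sum.elim (q ∘ Sum.inl) (q ∘ Sum.inr))) :=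
      hasSum_sum fun ν _ => (hasSum_slice hr' (hHn ν) hq1 hq2).mul_left _
    rw [hqe] at h1 h2
    refine h1.unique (h2.congr_fun ?_ |> fun h => h)
    intro μ
    have h3 (ν) : wnorm ρ' (c μ ν) < ⊤ := by
      have := wnorm_slice_lt_top hr' (hHn ν) μ
      rwa [slice_unslice] at this
    have h4 (ν) : wnorm ρ' (slice h ν) < ⊤ :=
      (wnorm_mono hρr _).trans_lt (wnorm_slice_lt_top hr' hh ν)
    simp_rw [slice_unslice]
    rw [hc μ, ev_sum _ _ (fun ν _ => wnorm_mul_le.trans_lt (ENNReal.mul_lt_top (h3 ν) (h4 ν))) hq1,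
      Finset.sum_mul]
    refine Finset.sum_congr rfl fun ν _ => ?_
    rw [ev_mul (h3 ν) (h4 ν) hq1]
    ring
  · obtain ⟨ν₀, hν₀, hs⟩ := hs
    let G : (σ →₀ ℕ) → MvPowerSeries σ ℂ := fun ν μ => MvPowerSeries.coeff 0 (c μ ν)
    have hGn (ν) : wnorm (fun _ => r) (G ν) < ⊤ := by
      refine lt_of_le_of_lt ?_ (hHn ν)
      rw [wnorm_eq_tsum_slice]
      refine ENNReal.tsum_le_tsum fun μ => ?_
      rw [slice_unslice]
      have := coeff_le_wnorm (ρ := ρ') (f := c μ ν) 0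
      rw [monoVal_zero, ENNReal.coe_one, mul_one] at this
      exact mul_le_mul_left this _
    have hHG (ν) (x : σ → ℂ) (hx : ∀ i, ‖x i‖ ≤ r) :
        ev (unslice fun μ => c μ ν) (Sum.elim 0 x) = ev (G ν) x := by
      have h1 := hasSum_slice hr' (hHn ν) (t := 0) (x := x) (by simp) hx
      refine h1.unique ?_
      simp_rw [slice_unslice, ev_zero_right]
      exact hasSum_ev (hGn ν) hx
    have hsGn (ν) : wnorm (fun _ => r) (MvPowerSeries.C (s ν) * G ν) < ⊤ :=
      wnorm_mul_le.trans_lt (ENNReal.mul_lt_top (by rw [wnorm_C]; simp) (hGn ν))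
    have h0 : ∑ ν ∈ F, MvPowerSeries.C (s ν) * G ν = 0 := by
      refine eq_zero_of_ev_eventually_zero hr' (f := ∑ ν ∈ F, MvPowerSeries.C (s ν) * G ν)
        ((wnorm_sum_le _ _).trans_lt (ENNReal.sum_lt_top.2 fun ν _ => hsGn ν)) ?_
      filter_upwards [hev, eventually_norm_le _ hr'] with x hx hx2
      rw [ev_sum _ _ (fun ν _ => hsGn ν) hx2, ← hx]
      refine Finset.sum_congr rfl fun ν _ => ?_
      rw [ev_mul (ρ := fun _ => r) (by rw [wnorm_C]; simp) (hGn ν) hx2, ev_C, hHG ν x hx2]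
    have h1 := congrArg (MvPowerSeries.coeff ν₀) h0
    rw [map_sum, map_zero] at h1
    have h2 (ν) : MvPowerSeries.coeff ν₀ (MvPowerSeries.C (s ν) * G ν) =
        if ν₀ = ν then s ν else 0 := by
      rw [MvPowerSeries.coeff_C_mul]
      change s ν * MvPowerSeries.coeff 0 (c ν₀ ν) = _
      simp only [c, hν₀, if_true]
      split_ifs <;> simp
    simp_rw [h2] at h1
    rw [Finset.sum_ite_eq, if_pos hν₀] at h1
    exact hs h1

end

section

section

variable {τ σ : Type} [Fintype τ] [Fintype σ]

theorem ev_monomial (γ : σ →₀ ℕ) (a : ℂ) (z : σ → ℂ) :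
    ev (MvPowerSeries.monomial γ a) z = a * monoVal z γ := by
  classical
  rw [ev, tsum_eq_single γ]
  · simp
  · intro δ hδ
    simp [MvPowerSeries.coeff_monomial, hδ]

theorem wnorm_monomial_lt_top (ρ : σ → ℝ≥0) (γ : σ →₀ ℕ) (a : ℂ) :
    wnorm ρ (MvPowerSeries.monomial γ a) < ⊤ := by
  rw [wnorm_monomial]
  exact ENNReal.mul_lt_top (by simp) (by simp)

theorem coeff_of_ev_eq_pow_mul {f : MvPowerSeries Unit ℂ} {ρ : ℝ≥0} (hρ : 0 < ρ)
    (hf : wnorm (fun _ => ρ) f < ⊤) {g : (Unit → ℂ) → ℂ} (hg : AnalyticAt ℂ g 0) {e : ℕ}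
    (h : ∀ᶠ z in 𝓝 0, ev f z = z () ^ e * g z) :
    (∀ i < e, MvPowerSeries.coeff (Finsupp.single () i) f = 0) ∧
      MvPowerSeries.coeff (Finsupp.single () e) f = g 0 := by
  classical
  obtain ⟨g', r, hr, hg', hgg'⟩ := exists_ev hg
  let ρ' : Unit → ℝ≥0 := fun _ => min ρ r
  have hρ' : ∀ i, 0 < ρ' i := fun _ => lt_min hρ hr
  have hf1 : wnorm ρ' f < ⊤ := (wnorm_mono (fun _ => min_le_left _ _) _).trans_lt hf
  have hg1 : wnorm ρ' g' < ⊤ := (wnorm_mono (fun _ => min_le_right _ _) _).trans_lt hg'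
  set m := MvPowerSeries.monomial (R := ℂ) (Finsupp.single () e) (-1)
  have hm : wnorm ρ' m < ⊤ := wnorm_monomial_lt_top _ _ _
  have hmg : wnorm ρ' (m * g') < ⊤ := wnorm_mul_le.trans_lt (ENNReal.mul_lt_top hm hg1)
  have h0 : f + m * g' = 0 := by
    refine eq_zero_of_ev_eventually_zero hρ'
      (wnorm_add_le.trans_lt (ENNReal.add_lt_top.2 ⟨hf1, hmg⟩)) ?_
    filter_upwards [h, eventually_norm_le _ hρ'] with z hz hz'
    rw [ev_add hf1 hmg hz', ev_mul hm hg1 hz', hz, ev_monomial,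
      hgg' z fun i => (hz' i).trans (by exact_mod_cast min_le_right _ _)]
    simp [monoVal]
  have hc (δ) : MvPowerSeries.coeff δ f =
      if Finsupp.single () e ≤ δ then MvPowerSeries.coeff (δ - Finsupp.single () e) g' else 0 := by
    have := congrArg (MvPowerSeries.coeff δ) h0
    rw [map_add, MvPowerSeries.coeff_monomial_mul, map_zero] at this
    split_ifs at this ⊢ <;> linear_combination this
  refine ⟨fun i hi => ?_, ?_⟩
  · rw [hc, if_neg]
    simpa using hi
  · rw [hc, if_pos le_rfl, tsub_self, hgg' 0 (by simp), ev_zero_right]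

/-- The restriction of a power series in two blocks of variables to the second block. -/
noncomputable def restrictRight (h : MvPowerSeries (τ ⊕ σ) ℂ) : MvPowerSeries σ ℂ :=
  fun μ => MvPowerSeries.coeff 0 (slice h μ)

theorem wnorm_restrictRight_le (ρ : τ → ℝ≥0) (r : σ → ℝ≥0) (h : MvPowerSeries (τ ⊕ σ) ℂ) :
    wnorm r (restrictRight h) ≤ wnorm (Sum.elim ρ r) h := by
  rw [wnorm_eq_tsum_slice]
  refine ENNReal.tsum_le_tsum fun μ => ?_
  have := coeff_le_wnorm (ρ := ρ) (f := slice h μ) 0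
  rw [monoVal_zero, ENNReal.coe_one, mul_one] at this
  exact mul_le_mul_left this _

theorem ev_restrictRight {ρ : τ → ℝ≥0} {r : σ → ℝ≥0} (hr : ∀ i, 0 < r i)
    {h : MvPowerSeries (τ ⊕ σ) ℂ} (hh : wnorm (Sum.elim ρ r) h < ⊤) {x : σ → ℂ}
    (hx : ∀ i, ‖x i‖ ≤ r i) : ev h (Sum.elim 0 x) = ev (restrictRight h) x := by
  have h1 := hasSum_slice hr hh (t := 0) (x := x) (by simp) hx
  refine h1.unique ?_
  simp_rw [ev_zero_right]
  exact hasSum_ev ((wnorm_restrictRight_le ρ r h).trans_lt hh) hx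

theorem monoVal_mul {R : Type*} [CommMonoid R] (a b : σ → R) (γ : σ →₀ ℕ) :
    monoVal (a * b) γ = monoVal a γ * monoVal b γ := by
  simp [monoVal, mul_pow, Finset.prod_mul_distrib]

theorem monoVal_const {R : Type*} [CommMonoid R] (a : R) (γ : σ →₀ ℕ) :
    monoVal (fun _ => a) γ = a ^ γ.degree := by
  simp [monoVal, Finset.prod_pow_eq_pow_sum, Finsupp.degree_eq_sum]

end

variable {τ : Type} [Fintype τ]

theorem wnorm_le_of_coeff_eq_zero {E : MvPowerSeries (τ ⊕ Unit) ℂ} {e : ℕ} {r x y : ℝ≥0}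
    (hx : x ≤ 1) (hy : y ≤ 1)
    (hE : ∀ i ≤ e, MvPowerSeries.coeff ((expSplit τ Unit).symm (Finsupp.single () i, 0)) E = 0) :
    wnorm (Sum.elim (fun _ => x * r) fun _ => y * r) E ≤
      ((x + y ^ (e + 1) : ℝ≥0) : ℝ≥0∞) * wnorm (fun _ => r) E := by
  rw [wnorm, wnorm, ← ENNReal.tsum_mul_left, ← (expSplit τ Unit).symm.tsum_eq,
    ← (expSplit τ Unit).symm.tsum_eq]
  refine ENNReal.tsum_le_tsum fun p => ?_
  obtain ⟨μ, γ⟩ := p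
  obtain ⟨i, rfl⟩ : ∃ i, μ = Finsupp.single () i := ⟨μ (), by ext; simp⟩
  by_cases h : γ = 0 ∧ i ≤ e
  · rw [h.1, hE i h.2]; simp
  rw [mul_left_comm]
  gcongr
  rw [← ENNReal.coe_mul, ENNReal.coe_le_coe, sumElim_const, monoVal_expSplit, monoVal_expSplit]
  have h1 : (fun _ : τ => x * r) = (fun _ => x) * fun _ => r := rfl
  have h2 : (fun _ : Unit => y * r) = (fun _ => y) * fun _ => r := rfl
  rw [h1, h2, monoVal_mul, monoVal_mul, mul_mul_mul_comm]
  gcongr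
  rw [monoVal_const, monoVal_const]
  by_cases hγ : γ = 0
  · have hi : e + 1 ≤ i := by
      by_contra hi
      exact h ⟨hγ, by omega⟩
    calc x ^ γ.degree * y ^ (Finsupp.single () i).degree ≤ 1 * y ^ (e + 1) := by
          refine mul_le_mul' (pow_le_one₀ zero_le hx) (pow_le_pow_of_le_one zero_le hy ?_)
          simpa using hi
      _ ≤ _ := by simp
  · have hi : 1 ≤ γ.degree := by
      rw [Nat.one_le_iff_ne_zero, Ne, Finsupp.degree_eq_zero_iff]; exact hγ
    calc x ^ γ.degree * y ^ (Finsupp.single () i).degree ≤ x * 1 := by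
          exact mul_le_mul' ((pow_le_pow_of_le_one zero_le hx hi).trans (by simp))
            (pow_le_one₀ zero_le hy)
      _ ≤ _ := by simp

theorem weierstrass_division_pi {G : (τ ⊕ Unit → ℂ) → ℂ} (hG : AnalyticAt ℂ G 0) {e : ℕ}
    {g : (Unit → ℂ) → ℂ} (hg : AnalyticAt ℂ g 0) (hg0 : g 0 ≠ 0)
    (hGg : ∀ᶠ z : Unit → ℂ in 𝓝 0, G (Sum.elim 0 z) = z () ^ e * g z)
    {f : (τ ⊕ Unit → ℂ) → ℂ} (hf : AnalyticAt ℂ f 0) :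
    ∃ (Q : (τ ⊕ Unit → ℂ) → ℂ) (R : Fin e → (τ → ℂ) → ℂ), AnalyticAt ℂ Q 0 ∧
      (∀ i, AnalyticAt ℂ (R i) 0) ∧
      ∀ᶠ q in 𝓝 0, f q = Q q * G q + ∑ i, R i (q ∘ Sum.inl) * q (Sum.inr ()) ^ (i : ℕ) := by
  classical
  obtain ⟨G', r₁, hr₁, hG', hGG'⟩ := exists_ev hG
  obtain ⟨f', r₂, hr₂, hf', hff'⟩ := exists_ev hf
  set r : ℝ≥0 := min r₁ r₂
  have hr : 0 < r := lt_min hr₁ hr₂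
  replace hG' : wnorm (fun _ => r) G' < ⊤ := (wnorm_mono (fun _ => min_le_left _ _) _).trans_lt hG'
  replace hf' : wnorm (fun _ => r) f' < ⊤ := (wnorm_mono (fun _ => min_le_right _ _) _).trans_lt hf'
  have hG's := hG'
  rw [sumElim_const] at hG's
  obtain ⟨hc0, hce⟩ := coeff_of_ev_eq_pow_mul hr
    ((wnorm_restrictRight_le (fun _ => r) (fun _ => r) G').trans_lt hG's) hg (e := e) (by
      filter_upwards [hGg, eventually_norm_le (fun _ => r) fun _ => hr] with z hz hz'
      rw [← hz, ← ev_restrictRight (fun _ => hr) hG's hz', hGG']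
      rintro (i | i)
      · simp
      · exact (hz' i).trans (by exact_mod_cast min_le_left _ _))
  set a := g 0
  set γ₀ := (expSplit τ Unit).symm (Finsupp.single () e, 0)
  set F := MvPowerSeries.C a⁻¹ * G'
  set E := F - MvPowerSeries.monomial γ₀ 1
  have hCn (ρ : τ ⊕ Unit → ℝ≥0) : wnorm ρ (MvPowerSeries.C a⁻¹) < ⊤ := by rw [wnorm_C]; simp
  have hFn : wnorm (fun _ => r) F < ⊤ :=
    wnorm_mul_le.trans_lt (ENNReal.mul_lt_top (hCn _) hG')
  have hEn : wnorm (fun _ => r) E < ⊤ := by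
    simp only [E, sub_eq_add_neg]
    refine wnorm_add_le.trans_lt (ENNReal.add_lt_top.2 ⟨hFn, ?_⟩)
    rw [wnorm_neg]
    exact wnorm_monomial_lt_top _ _ _
  have hE0 : ∀ i ≤ e,
      MvPowerSeries.coeff ((expSplit τ Unit).symm (Finsupp.single () i, 0)) E = 0 := by
    intro i hi
    simp only [E, F, γ₀, map_sub, MvPowerSeries.coeff_C_mul, MvPowerSeries.coeff_monomial]
    rcases hi.lt_or_eq with hi | rfl
    · have h1 : MvPowerSeries.coeff ((expSplit τ Unit).symm (Finsupp.single () i, 0)) G' = 0 :=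
        hc0 i hi
      rw [h1, if_neg]
      · simp
      · rw [(expSplit τ Unit).symm.injective.eq_iff]
        simp [hi.ne]
    · have h1 : MvPowerSeries.coeff ((expSplit τ Unit).symm (Finsupp.single () i, 0)) G' = a := hce
      rw [h1, if_pos rfl, inv_mul_cancel₀ hg0, sub_self]
  set M : ℝ≥0 := (wnorm (fun _ => r) E).toNNReal
  have hM : wnorm (fun _ => r) E = M := (ENNReal.coe_toNNReal hEn.ne).symm
  set y : ℝ≥0 := min 1 (r ^ e / (4 * (M + 1)))
  have hy : 0 < y := lt_min one_pos (by positivity)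
  set x : ℝ≥0 := min 1 ((y * r) ^ e / (4 * (M + 1)))
  have hx : 0 < x := lt_min one_pos (by positivity)
  set ρ : τ ⊕ Unit → ℝ≥0 := Sum.elim (fun _ => x * r) fun _ => y * r
  have hρ : ∀ i, 0 < ρ i := by
    rintro (i | i) <;> simp only [ρ, Sum.elim_inl, Sum.elim_inr] <;> positivity
  have hρr : ∀ i, ρ i ≤ r := by
    rintro (i | i)
    · exact mul_le_of_le_one_left zero_le (min_le_left _ _)
    · exact mul_le_of_le_one_left zero_le (min_le_left _ _)
  have hmono : monoVal ρ γ₀ = (y * r) ^ e := by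
    simp only [ρ, γ₀, monoVal_expSplit]
    rw [monoVal_const, monoVal_const]; simp
  have hFE : wnorm ρ E ≤ (2⁻¹ : ℝ≥0) * (monoVal ρ γ₀ : ℝ≥0) := by
    refine (wnorm_le_of_coeff_eq_zero (min_le_left _ _) (min_le_left _ _) hE0).trans ?_
    rw [hM, hmono, ← ENNReal.coe_mul, ← ENNReal.coe_mul, ENNReal.coe_le_coe]
    have h1 : x * (4 * (M + 1)) ≤ (y * r) ^ e :=
      (le_div_iff₀ (by positivity)).1 (min_le_right _ _)
    have h2 : y * (4 * (M + 1)) ≤ r ^ e := (le_div_iff₀ (by positivity)).1 (min_le_right _ _)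
    have h3 : y ^ (e + 1) * (4 * (M + 1)) ≤ (y * r) ^ e := by
      rw [pow_succ, mul_assoc, mul_pow]; gcongr
    have h4 : x * M ≤ 4⁻¹ * (y * r) ^ e := by
      calc x * M ≤ x * (M + 1) := by gcongr; simp
        _ = 4⁻¹ * (x * (4 * (M + 1))) := by field_simp
        _ ≤ _ := by gcongr
    have h5 : y ^ (e + 1) * M ≤ 4⁻¹ * (y * r) ^ e := by
      calc y ^ (e + 1) * M ≤ y ^ (e + 1) * (M + 1) := by gcongr; simp
        _ = 4⁻¹ * (y ^ (e + 1) * (4 * (M + 1))) := by field_simp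
        _ ≤ _ := by gcongr
    calc (x + y ^ (e + 1)) * M = x * M + y ^ (e + 1) * M := by ring
      _ ≤ 4⁻¹ * (y * r) ^ e + 4⁻¹ * (y * r) ^ e := by gcongr
      _ = 2⁻¹ * (y * r) ^ e := by
        rw [← add_mul]; congr 1
        rw [← NNReal.coe_inj]; push_cast; norm_num
  have hfρ : wnorm ρ f' < ⊤ := (wnorm_mono hρr _).trans_lt hf'
  obtain ⟨q, R, hfq, hq, hR, hR0⟩ := exists_division (ι := Unit) (γ := fun _ => γ₀) hρ (fun _ => F)
    (fun _ => hFE) f' hfρ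
  have htop : 2 * wnorm ρ f' < ⊤ := ENNReal.mul_lt_top (by simp) hfρ
  have hqn : wnorm ρ (q ()) < ⊤ := by
    refine lt_top_iff_ne_top.2 fun h => ?_
    have := (hq ()).trans_lt htop
    rw [h, ENNReal.top_mul (by simpa using (monoVal_pos hρ γ₀).ne')] at this
    exact lt_irrefl _ this
  have hRn : wnorm ρ R < ⊤ := hR.trans_lt htop
  have hFρ : wnorm ρ F < ⊤ := (wnorm_mono hρr _).trans_lt hFn
  have hGρ : wnorm ρ G' < ⊤ := (wnorm_mono hρr _).trans_lt hG'
  have hxr : ∀ i : τ, 0 < (fun _ => x * r : τ → ℝ≥0) i := fun _ => by positivity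
  have hyr : ∀ i : Unit, 0 < (fun _ => y * r : Unit → ℝ≥0) i := fun _ => by positivity
  refine ⟨fun z => ev (q ()) z * a⁻¹, fun i => ev (slice R (Finsupp.single () (i : ℕ))),
    (analyticAt_ev hρ hqn).mul analyticAt_const,
    fun i => analyticAt_ev hxr (wnorm_slice_lt_top hyr hRn _), ?_⟩
  filter_upwards [eventually_norm_le _ hρ] with z hz
  have hzr : ∀ i, ‖z i‖ ≤ r := fun i => (hz i).trans (by exact_mod_cast hρr i)
  rw [hff' z fun i => (hzr i).trans (by exact_mod_cast min_le_right _ _),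
    hGG' z fun i => (hzr i).trans (by exact_mod_cast min_le_left _ _), hfq]
  simp only [Finset.univ_unique, Finset.sum_singleton, PUnit.default_eq_unit]
  have hqF : wnorm ρ (q () * F) < ⊤ := wnorm_mul_le.trans_lt (ENNReal.mul_lt_top hqn hFρ)
  rw [ev_add hqF hRn hz, ev_mul hqn hFρ hz, ev_mul (hCn ρ) hGρ hz, ev_C]
  have hsum := hasSum_slice hyr hRn (t := z ∘ Sum.inl) (x := z ∘ Sum.inr)
    (fun i => hz (Sum.inl i)) (fun i => hz (Sum.inr i))
  rw [Sum.elim_comp_inl_inr] at hsum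
  have hsum2 := hasSum_sum_of_ne_finset_zero (L := .unconditional _) (f := fun μ => ev (slice R μ) (z ∘ Sum.inl) *
    monoVal (z ∘ Sum.inr) μ) (s := (Finset.univ : Finset (Fin e)).image
      fun i : Fin e => Finsupp.single () (i : ℕ)) (by
    intro μ hμ
    obtain ⟨i, rfl⟩ : ∃ i, μ = Finsupp.single () i := ⟨μ (), by ext; simp⟩
    have hi : e ≤ i := by
      by_contra hi
      exact hμ (Finset.mem_image.2 ⟨⟨i, by omega⟩, Finset.mem_univ _, rfl⟩)
    have h0 : slice R (Finsupp.single () i) = 0 := by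
      ext γ
      refine hR0 _ ⟨(), ?_⟩
      rintro (j | j)
      · simp [γ₀, expSplit]
      · simpa [γ₀, expSplit] using hi
    simp only [h0, ev_zero, zero_mul])
  rw [hsum.unique hsum2, Finset.sum_image]
  · rw [mul_assoc]
    congr 1
    refine Finset.sum_congr rfl fun i _ => ?_
    simp [monoVal]
  · intro i _ j _ hij
    exact Fin.ext (by simpa using hij)

end

section

variable {X T P : Type} [NormedAddCommGroup X] [NormedSpace ℂ X] [FiniteDimensional ℂ X]
  [NormedAddCommGroup T] [NormedSpace ℂ T] [FiniteDimensional ℂ T]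
  [NormedAddCommGroup P] [NormedSpace ℂ P] [FiniteDimensional ℂ P]

/-- Functions on a disjoint union of two finite types as pairs of functions. -/
noncomputable def sumPiEquiv (τ σ : Type) [Fintype τ] [Fintype σ] :
    (τ ⊕ σ → ℂ) ≃L[ℂ] (σ → ℂ) × (τ → ℂ) :=
  LinearEquiv.toContinuousLinearEquiv
    { toFun := fun q => (q ∘ Sum.inr, q ∘ Sum.inl)
      invFun := fun p => Sum.elim p.2 p.1
      left_inv := fun q => Sum.elim_comp_inl_inr q
      right_inv := fun p => by simp
      map_add' := fun _ _ => rfl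
      map_smul' := fun _ _ => rfl }

@[simp] theorem sumPiEquiv_apply (τ σ : Type) [Fintype τ] [Fintype σ] (q : τ ⊕ σ → ℂ) :
    sumPiEquiv τ σ q = (q ∘ Sum.inr, q ∘ Sum.inl) := rfl

@[simp] theorem sumPiEquiv_symm_apply (τ σ : Type) [Fintype τ] [Fintype σ]
    (p : (σ → ℂ) × (τ → ℂ)) : (sumPiEquiv τ σ).symm p = Sum.elim p.2 p.1 := rfl

/-- Coordinates on a finite-dimensional space. -/
noncomputable def coordEquiv (X : Type) [NormedAddCommGroup X] [NormedSpace ℂ X]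
    [FiniteDimensional ℂ X] : (Fin (Module.finrank ℂ X) → ℂ) ≃L[ℂ] X :=
  ContinuousLinearEquiv.ofFinrankEq (by simp)

theorem analyticAt_comp_equiv {E E' F : Type*} [NormedAddCommGroup E] [NormedSpace ℂ E]
    [NormedAddCommGroup E'] [NormedSpace ℂ E'] [NormedAddCommGroup F] [NormedSpace ℂ F]
    (A : E ≃L[ℂ] E') {f : E' → F} (hf : AnalyticAt ℂ f 0) : AnalyticAt ℂ (fun x => f (A x)) 0 := by
  refine AnalyticAt.fun_comp (g := f) ?_ (A.toContinuousLinearMap.analyticAt 0)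
  simpa using hf

theorem tendsto_equiv_zero {E E' : Type*} [NormedAddCommGroup E] [NormedSpace ℂ E]
    [NormedAddCommGroup E'] [NormedSpace ℂ E'] (A : E ≃L[ℂ] E') : Tendsto A (𝓝 0) (𝓝 0) := by
  have := A.continuous.tendsto 0
  rwa [map_zero] at this

theorem exists_bautin {h : X × T → ℂ} (hh : AnalyticAt ℂ h 0) :
    ∃ (ι : Type) (_ : Fintype ι) (a : ι → T → ℂ) (H : ι → X × T → ℂ),
      (∀ i, AnalyticAt ℂ (a i) 0) ∧ (∀ i, AnalyticAt ℂ (H i) 0) ∧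
      (∀ᶠ q in 𝓝 0, h q = ∑ i, a i q.2 * H i q) ∧
      ∀ s : ι → ℂ, s ≠ 0 → ¬ ∀ᶠ x in 𝓝 (0 : X), ∑ i, s i * H i (x, 0) = 0 := by
  classical
  set A := (sumPiEquiv (Fin (Module.finrank ℂ T)) (Fin (Module.finrank ℂ X))).trans
    ((coordEquiv X).prodCongr (coordEquiv T)) with hA
  obtain ⟨F, a, H, ha, hH, hφ, hs⟩ := exists_bautin_pi (analyticAt_comp_equiv A hh)
  refine ⟨F, inferInstance, fun i t => a i ((coordEquiv T).symm t), fun i q => H i (A.symm q),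
    fun i => analyticAt_comp_equiv _ (ha i), fun i => analyticAt_comp_equiv _ (hH i), ?_, ?_⟩
  · filter_upwards [(tendsto_equiv_zero A.symm).eventually hφ] with q hq
    rw [A.apply_symm_apply] at hq
    rw [hq, ← Finset.sum_coe_sort]
    refine Finset.sum_congr rfl fun i _ => ?_
    congr 2
  · intro s hs0 hev
    obtain ⟨i, hi⟩ := Function.ne_iff.1 hs0
    refine hs (fun ν => if hν : ν ∈ F then s ⟨ν, hν⟩ else 0) ⟨i, i.2, by simpa using hi⟩ ?_
    filter_upwards [(tendsto_equiv_zero (coordEquiv X)).eventually hev] with x hx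
    rw [← Finset.sum_coe_sort, ← hx]
    refine Finset.sum_congr rfl fun i _ => ?_
    simp only [i.2, dif_pos]
    congr 2
    rw [ContinuousLinearEquiv.eq_symm_apply]
    simp [hA]

/-- Coordinates on a product with a line. -/
noncomputable def lineEquiv (P : Type) [NormedAddCommGroup P] [NormedSpace ℂ P]
    [FiniteDimensional ℂ P] : (Fin (Module.finrank ℂ P) ⊕ Unit → ℂ) ≃L[ℂ] P × ℂ :=
  ((sumPiEquiv (Fin (Module.finrank ℂ P)) Unit).trans
    ((ContinuousLinearEquiv.funUnique Unit ℂ ℂ).prodCongr (coordEquiv P))).trans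
      (ContinuousLinearEquiv.prodComm ℂ ℂ P)

theorem lineEquiv_apply (q : Fin (Module.finrank ℂ P) ⊕ Unit → ℂ) :
    lineEquiv P q = (coordEquiv P (q ∘ Sum.inl), q (Sum.inr ())) := rfl

theorem lineEquiv_symm_apply (q : P × ℂ) :
    (lineEquiv P).symm q = Sum.elim ((coordEquiv P).symm q.1) fun _ => q.2 := by
  rw [ContinuousLinearEquiv.symm_apply_eq, lineEquiv_apply]
  simp

theorem weierstrass_division_of_eq {G : P × ℂ → ℂ} (hG : AnalyticAt ℂ G 0) {e : ℕ}
    {g : ℂ → ℂ} (hg : AnalyticAt ℂ g 0) (hg0 : g 0 ≠ 0)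
    (hGg : ∀ᶠ z in 𝓝 0, G (0, z) = z ^ e * g z)
    {f : P × ℂ → ℂ} (hf : AnalyticAt ℂ f 0) :
    ∃ (Q : P × ℂ → ℂ) (R : Fin e → P → ℂ), AnalyticAt ℂ Q 0 ∧
      (∀ i, AnalyticAt ℂ (R i) 0) ∧
      ∀ᶠ q in 𝓝 0, f q = Q q * G q + ∑ i, R i q.1 * q.2 ^ (i : ℕ) := by
  have hu : Tendsto (fun z : Unit → ℂ => z ()) (𝓝 0) (𝓝 0) :=
    (continuous_apply ()).tendsto (0 : Unit → ℂ)
  obtain ⟨Q, R, hQ, hR, h⟩ := weierstrass_division_pi (analyticAt_comp_equiv (lineEquiv P) hG)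
    (e := e) (g := fun z => g (z ()))
    (AnalyticAt.fun_comp (g := g) hg
      ((ContinuousLinearMap.proj (R := ℂ) (φ := fun _ : Unit => ℂ) ()).analyticAt 0))
    hg0 (by
      filter_upwards [hu.eventually hGg] with z hz
      rw [← hz, lineEquiv_apply]
      simp) (analyticAt_comp_equiv (lineEquiv P) hf)
  refine ⟨fun q => Q ((lineEquiv P).symm q), fun i p => R i ((coordEquiv P).symm p),
    analyticAt_comp_equiv _ hQ, fun i => analyticAt_comp_equiv _ (hR i), ?_⟩
  filter_upwards [(tendsto_equiv_zero (lineEquiv P).symm).eventually h] with q hq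
  rw [ContinuousLinearEquiv.apply_symm_apply] at hq
  rw [hq, lineEquiv_symm_apply]
  rfl

theorem eventually_zero_prodMk {p : P × ℂ → Prop} (h : ∀ᶠ q in 𝓝 0, p q) :
    ∀ᶠ z in 𝓝 (0 : ℂ), p (0, z) := by
  have : Tendsto (fun z : ℂ => ((0 : P), z)) (𝓝 0) (𝓝 0) := by
    have : Continuous fun z : ℂ => ((0 : P), z) := by fun_prop
    exact this.tendsto 0
  exact this.eventually h

theorem weierstrass_preparation {G : P × ℂ → ℂ} (hG : AnalyticAt ℂ G 0)
    (hG0 : ¬ ∀ᶠ z in 𝓝 0, G (0, z) = 0) :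
    ∃ (e : ℕ) (w : Fin e → P → ℂ) (u : P × ℂ → ℂ), (∀ i, AnalyticAt ℂ (w i) 0) ∧
      (∀ i, w i 0 = 0) ∧ AnalyticAt ℂ u 0 ∧ u 0 ≠ 0 ∧
      ∀ᶠ q in 𝓝 0, q.2 ^ e + ∑ i, w i q.1 * q.2 ^ (i : ℕ) = u q * G q := by
  classical
  have hG1 : AnalyticAt ℂ (fun z : ℂ => G (0, z)) 0 :=
    AnalyticAt.fun_comp (g := G) hG (by fun_prop)
  obtain ⟨e, g, hg, hg0, hGg⟩ := hG1.exists_eventuallyEq_pow_smul_nonzero_iff.2 hG0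
  simp only [sub_zero, smul_eq_mul] at hGg
  obtain ⟨Q, R, hQ, hR, h⟩ := weierstrass_division_of_eq hG hg hg0 hGg (f := fun q => q.2 ^ e)
    (analyticAt_snd.fun_pow e)
  have hQ1 : AnalyticAt ℂ (fun z : ℂ => Q (0, z)) 0 :=
    AnalyticAt.fun_comp (g := Q) hQ (by fun_prop)
  have h0 : ∀ᶠ z in 𝓝 (0 : ℂ), ∑ i, R i 0 * z ^ (i : ℕ) = z ^ e * (1 - Q (0, z) * g z) := by
    filter_upwards [eventually_zero_prodMk h, hGg] with z hz hz'
    rw [hz'] at hz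
    linear_combination -hz
  set m : MvPowerSeries Unit ℂ :=
    ∑ i : Fin e, MvPowerSeries.monomial (Finsupp.single () (i : ℕ)) (R i 0) with hm
  have hu : Tendsto (fun z : Unit → ℂ => z ()) (𝓝 0) (𝓝 0) :=
    (continuous_apply ()).tendsto (0 : Unit → ℂ)
  have hmn : wnorm (fun _ => 1) m < ⊤ := (wnorm_sum_le _ _).trans_lt
    (ENNReal.sum_lt_top.2 fun i _ => wnorm_monomial_lt_top _ _ _)
  obtain ⟨h1, h2⟩ := coeff_of_ev_eq_pow_mul one_pos hmn (e := e)
    (g := fun z => 1 - Q (0, z ()) * g (z ()))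
    (AnalyticAt.fun_comp (g := fun z => 1 - Q (0, z) * g z)
      (analyticAt_const.sub (hQ1.mul hg))
      ((ContinuousLinearMap.proj (R := ℂ) (φ := fun _ : Unit => ℂ) ()).analyticAt 0))
    (by
      filter_upwards [hu.eventually h0, eventually_norm_le (fun _ => 1) fun _ => one_pos]
        with z hz hz'
      rw [← hz, hm, ev_sum _ _ (fun i _ => wnorm_monomial_lt_top _ _ _) hz']
      refine Finset.sum_congr rfl fun i _ => ?_
      rw [ev_monomial]
      simp [monoVal])
  have hc (j : ℕ) : MvPowerSeries.coeff (Finsupp.single () j) m =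
      ∑ i : Fin e, if j = i then R i 0 else 0 := by
    rw [hm, map_sum]
    refine Finset.sum_congr rfl fun i _ => ?_
    rw [MvPowerSeries.coeff_monomial]
    simp
  refine ⟨e, fun i p => -R i p, Q, fun i => (hR i).neg, fun i => ?_, hQ, fun hQ0 => ?_, ?_⟩
  · have := h1 i i.2
    rw [hc, Finset.sum_eq_single i (fun j _ hj => if_neg fun h => hj (Fin.ext h.symm)) (by simp),
      if_pos rfl] at this
    simp [this]
  · rw [hc, Finset.sum_eq_zero fun j _ => if_neg j.2.ne'] at h2
    have : Q (0, (0 : Unit → ℂ) ()) = 0 := hQ0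
    rw [this] at h2
    simp at h2
  · filter_upwards [h] with q hq
    simp only [neg_mul, Finset.sum_neg_distrib]
    linear_combination hq

theorem weierstrass_division {e : ℕ} {w : Fin e → P → ℂ} (hw : ∀ i, AnalyticAt ℂ (w i) 0)
    (hw0 : ∀ i, w i 0 = 0) {f : P × ℂ → ℂ} (hf : AnalyticAt ℂ f 0) :
    ∃ (Q : P × ℂ → ℂ) (R : Fin e → P → ℂ), AnalyticAt ℂ Q 0 ∧
      (∀ i, AnalyticAt ℂ (R i) 0) ∧
      ∀ᶠ q in 𝓝 0, f q = Q q * (q.2 ^ e + ∑ i, w i q.1 * q.2 ^ (i : ℕ)) +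
        ∑ i, R i q.1 * q.2 ^ (i : ℕ) := by
  refine weierstrass_division_of_eq (g := fun _ => 1) ?_ analyticAt_const one_ne_zero ?_ hf
  · have h (i) : AnalyticAt ℂ (fun q : P × ℂ => w i q.1) 0 :=
      AnalyticAt.fun_comp (g := w i) (hw i) analyticAt_fst
    exact (analyticAt_snd.fun_pow e).fun_add
      (Finset.analyticAt_fun_sum _ fun i _ => (h i).fun_mul (analyticAt_snd.fun_pow _))
  · refine Eventually.of_forall fun z => ?_
    simp [hw0]

end

section

open Polynomial

/-- The polynomial of degree less than `e` with given coefficients. -/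
noncomputable def lowPoly {e : ℕ} (a : Fin e → ℂ) : ℂ[X] := ∑ i, C (a i) * X ^ (i : ℕ)

/-- The monic polynomial of degree `e` with given lower coefficients. -/
noncomputable def monicPoly {e : ℕ} (w : Fin e → ℂ) : ℂ[X] := X ^ e + lowPoly w

theorem degree_lowPoly_lt {e : ℕ} (a : Fin e → ℂ) : (lowPoly a).degree < e :=
  degree_sum_fin_lt a

theorem natDegree_lowPoly_le {e : ℕ} (a : Fin e → ℂ) : (lowPoly a).natDegree ≤ e :=
  natDegree_le_of_degree_le (degree_lowPoly_lt a).le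

theorem monic_monicPoly {e : ℕ} (w : Fin e → ℂ) : (monicPoly w).Monic :=
  monic_X_pow_add (degree_lowPoly_lt w)

theorem natDegree_monicPoly {e : ℕ} (w : Fin e → ℂ) : (monicPoly w).natDegree = e := by
  refine natDegree_eq_of_degree_eq_some ?_
  rw [monicPoly, degree_add_eq_left_of_degree_lt] <;> rw [degree_X_pow]
  exact degree_lowPoly_lt w

theorem eval_lowPoly {e : ℕ} (a : Fin e → ℂ) (z : ℂ) :
    (lowPoly a).eval z = ∑ i, a i * z ^ (i : ℕ) := by
  simp [lowPoly, eval_finsetSum]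

theorem eval_monicPoly {e : ℕ} (w : Fin e → ℂ) (z : ℂ) :
    (monicPoly w).eval z = z ^ e + ∑ i, w i * z ^ (i : ℕ) := by
  simp [monicPoly, eval_lowPoly]

theorem coeff_lowPoly {e : ℕ} (a : Fin e → ℂ) (j : ℕ) :
    (lowPoly a).coeff j = if h : j < e then a ⟨j, h⟩ else 0 := by
  simp only [lowPoly, finsetSum_coeff, coeff_C_mul_X_pow]
  split_ifs with h
  · rw [Finset.sum_eq_single ⟨j, h⟩] <;> simp +contextual [Fin.ext_iff, eq_comm]
  · exact Finset.sum_eq_zero fun i _ => if_neg (by omega)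

variable {E : Type*} [NormedAddCommGroup E] [NormedSpace ℂ E]

theorem analyticAt_coeff_lowPoly {e : ℕ} {a : E → Fin e → ℂ} {x : E}
    (ha : ∀ i, AnalyticAt ℂ (fun q => a q i) x) (j : ℕ) :
    AnalyticAt ℂ (fun q => (lowPoly (a q)).coeff j) x := by
  simp only [coeff_lowPoly]
  split_ifs with h
  · exact ha _
  · exact analyticAt_const

theorem analyticAt_coeff_monicPoly {e : ℕ} {a : E → Fin e → ℂ} {x : E}
    (ha : ∀ i, AnalyticAt ℂ (fun q => a q i) x) (j : ℕ) :
    AnalyticAt ℂ (fun q => (monicPoly (a q)).coeff j) x := by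
  simp only [monicPoly, coeff_add]
  exact analyticAt_const.fun_add (analyticAt_coeff_lowPoly ha j)

theorem analyticAt_resultant {F G : E → ℂ[X]} {x : E} {m n : ℕ}
    (hF : ∀ i, AnalyticAt ℂ (fun q => (F q).coeff i) x)
    (hG : ∀ i, AnalyticAt ℂ (fun q => (G q).coeff i) x) :
    AnalyticAt ℂ (fun q => resultant (F q) (G q) m n) x := by
  simp only [resultant, Matrix.det_apply']
  refine Finset.analyticAt_fun_sum _ fun s _ => analyticAt_const.fun_mul ?_
  refine Finset.analyticAt_fun_prod _ fun i _ => ?_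
  simp only [sylvester, Matrix.of_apply]
  induction i using Fin.addCases with
  | left j =>
    simp only [Fin.addCases_left]
    split_ifs
    · exact hG _
    · exact analyticAt_const
  | right j =>
    simp only [Fin.addCases_right]
    split_ifs
    · exact hF _
    · exact analyticAt_const

theorem analyticAt_coeff_divByMonic {e : ℕ} {F : E → ℂ[X]} {z : E → ℂ} {x : E}
    (hF : ∀ i, AnalyticAt ℂ (fun q => (F q).coeff i) x) (hz : AnalyticAt ℂ z x)
    (he : ∀ q, (F q).natDegree = e) (j : ℕ) :
    AnalyticAt ℂ (fun q => (F q /ₘ (X - C (z q))).coeff j) x := by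
  simp only [coeff_divByMonic_X_sub_C, he]
  exact Finset.analyticAt_fun_sum _ fun i _ => (hz.fun_pow _).fun_mul (hF i)

/-- The eliminant of a monic polynomial and a polynomial of lower degree. -/
noncomputable def eliminant {e : ℕ} (w a : Fin e → ℂ) : ℂ :=
  resultant (monicPoly w) (lowPoly a) e e

theorem eliminant_eq_zero {e : ℕ} {w a : Fin e → ℂ} {z : ℂ} (hw : (monicPoly w).eval z = 0)
    (ha : (lowPoly a).eval z = 0) : eliminant w a = 0 := by
  have h := resultant_eq_prod_eval (monicPoly w) (lowPoly a) e (natDegree_lowPoly_le a)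
    (IsAlgClosed.splits _)
  rw [natDegree_monicPoly] at h
  rw [eliminant, h, Multiset.prod_eq_zero, mul_zero]
  refine Multiset.mem_map.2 ⟨z, ?_, ha⟩
  exact (mem_roots (monic_monicPoly w).ne_zero).2 hw

theorem resultant_sub_eval {e : ℕ} (w a : Fin e → ℂ) (z : ℂ) (he : e ≠ 0) :
    resultant (monicPoly w - C ((monicPoly w).eval z)) (lowPoly a) e e =
      (lowPoly a).eval z *
        resultant (monicPoly w /ₘ (X - C z)) (lowPoly a) (e - 1) e := by
  have h1 : monicPoly w - C ((monicPoly w).eval z) = (X - C z) * (monicPoly w /ₘ (X - C z)) := by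
    rw [X_sub_C_mul_divByMonic_eq_sub_modByMonic, modByMonic_X_sub_C_eq_C_eval]
  have h2 : (monicPoly w /ₘ (X - C z)).natDegree = e - 1 := by
    rw [natDegree_divByMonic _ (monic_X_sub_C z), natDegree_monicPoly, natDegree_X_sub_C]
  have h3 := resultant_mul_left (X - C z) (monicPoly w /ₘ (X - C z)) (lowPoly a) e
    (natDegree_lowPoly_le a)
  rw [natDegree_X_sub_C, h2, resultant_X_sub_C_left _ _ _ (natDegree_lowPoly_le a),
    Nat.add_sub_cancel' (Nat.one_le_iff_ne_zero.2 he)] at h3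
  rw [h1, h3]

theorem resultant_divByMonic_ne_zero {e : ℕ} {w a : Fin e → ℂ} {z : ℂ}
    (hz : (monicPoly w).eval z = 0) (hz' : (monicPoly w).derivative.eval z ≠ 0)
    (ha : ∀ ξ, ξ ≠ z → (monicPoly w).eval ξ = 0 → (lowPoly a).eval ξ ≠ 0) :
    resultant (monicPoly w /ₘ (X - C z)) (lowPoly a) (e - 1) e ≠ 0 := by
  set q := monicPoly w /ₘ (X - C z)
  have h1 : monicPoly w = (X - C z) * q := by
    rw [X_sub_C_mul_divByMonic_eq_sub_modByMonic, modByMonic_X_sub_C_eq_C_eval, hz, C_0, sub_zero]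
  have h2 : q.natDegree = e - 1 := by
    rw [natDegree_divByMonic _ (monic_X_sub_C z), natDegree_monicPoly, natDegree_X_sub_C]
  have hq : q ≠ 0 := by
    rintro h
    exact (monic_monicPoly w).ne_zero (by rw [h1, h, mul_zero])
  rw [← h2, resultant_eq_prod_eval _ _ e (natDegree_lowPoly_le a) (IsAlgClosed.splits _)]
  refine mul_ne_zero (pow_ne_zero _ (leadingCoeff_ne_zero.2 hq)) (Multiset.prod_ne_zero ?_)
  intro h
  obtain ⟨ξ, hξ, h0⟩ := Multiset.mem_map.1 h
  have hξq : q.eval ξ = 0 := (mem_roots hq).1 hξ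
  refine ha ξ ?_ (by rw [h1, eval_mul, hξq, mul_zero]) h0
  rintro rfl
  refine hz' ?_
  rw [h1, derivative_mul]
  simp [hξq]

theorem hasDerivAt_zero_of_eliminant {e : ℕ} {w a : ℂ → Fin e → ℂ} {z : ℂ → ℂ}
    (hw : ∀ i, AnalyticAt ℂ (fun t => w t i) 0) (ha : ∀ i, AnalyticAt ℂ (fun t => a t i) 0)
    (hz : AnalyticAt ℂ z 0)
    (hw0 : (monicPoly (w 0)).eval (z 0) = 0) (ha0 : (lowPoly (a 0)).eval (z 0) = 0)
    (hw1 : (monicPoly (w 0)).derivative.eval (z 0) ≠ 0)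
    (hne : ∀ ξ, ξ ≠ z 0 → (monicPoly (w 0)).eval ξ = 0 → (lowPoly (a 0)).eval ξ ≠ 0)
    (hW : HasDerivAt (fun t => (monicPoly (w t)).eval (z t)) 0 0)
    (hE : HasDerivAt (fun t => eliminant (w t) (a t)) 0 0) :
    HasDerivAt (fun t => (lowPoly (a t)).eval (z t)) 0 0 := by
  have he : e ≠ 0 := by
    rintro rfl
    simp [eval_monicPoly] at hw0
  let φ : ℂ × ℂ → ℂ := fun p => resultant (monicPoly (w p.1) - C p.2) (lowPoly (a p.1)) e e
  have hfst : AnalyticAt ℂ (fun p : ℂ × ℂ => p.1) (0, 0) := analyticAt_fst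
  have hφ : AnalyticAt ℂ φ (0, 0) := by
    refine analyticAt_resultant (fun i => ?_) fun i => ?_
    · simp only [coeff_sub, coeff_C]
      refine AnalyticAt.fun_sub ?_ ?_
      · exact AnalyticAt.fun_comp (g := fun t => (monicPoly (w t)).coeff i)
          (analyticAt_coeff_monicPoly hw i) hfst
      · split_ifs
        · exact analyticAt_snd
        · exact analyticAt_const
    · exact AnalyticAt.fun_comp (g := fun t => (lowPoly (a t)).coeff i)
          (analyticAt_coeff_lowPoly ha i) hfst
  have hD := hφ.differentiableAt.hasFDerivAt
  have h1 : HasDerivAt (fun t => φ (t, 0)) (fderiv ℂ φ (0, 0) (1, 0)) 0 :=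
    HasFDerivAt.comp_hasDerivAt (l := φ) (f := fun t : ℂ => (t, (0 : ℂ))) 0 hD
      ((hasDerivAt_id 0).prodMk (hasDerivAt_const _ _))
  have h2 : HasDerivAt (fun t => φ (t, (monicPoly (w t)).eval (z t)))
      (fderiv ℂ φ (0, 0) (1, 0)) 0 := by
    refine HasFDerivAt.comp_hasDerivAt (l := φ)
      (f := fun t : ℂ => (t, (monicPoly (w t)).eval (z t))) 0 ?_ ((hasDerivAt_id 0).prodMk hW)
    rw [hw0]; exact hD
  have h3 : (fun t => φ (t, 0)) = fun t => eliminant (w t) (a t) := by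
    ext t
    have : monicPoly (w t) - C 0 = monicPoly (w t) := by rw [C_0, sub_zero]
    exact congrArg (fun p => resultant p (lowPoly (a t)) e e) this
  rw [h3] at h1
  rw [h1.unique hE] at h2
  set K : ℂ → ℂ := fun t =>
    resultant (monicPoly (w t) /ₘ (X - C (z t))) (lowPoly (a t)) (e - 1) e with hK
  have hKa : AnalyticAt ℂ K 0 := by
    refine analyticAt_resultant (fun i => ?_) (analyticAt_coeff_lowPoly ha)
    exact analyticAt_coeff_divByMonic (analyticAt_coeff_monicPoly hw) hz
      (fun t => natDegree_monicPoly (w t)) i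
  have hRa : AnalyticAt ℂ (fun t => (lowPoly (a t)).eval (z t)) 0 := by
    simp only [eval_lowPoly]
    exact Finset.analyticAt_fun_sum _ fun i _ => (ha i).fun_mul (hz.fun_pow _)
  have hR := hRa.differentiableAt.hasDerivAt
  have h4 := hR.mul hKa.differentiableAt.hasDerivAt
  have h5 : (fun t => φ (t, (monicPoly (w t)).eval (z t))) =
      (fun t => (lowPoly (a t)).eval (z t)) * K := by
    ext t; exact resultant_sub_eval (w t) (a t) (z t) he
  rw [h5] at h2
  have h6 := h4.unique h2
  rw [ha0, zero_mul, add_zero] at h6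
  have h7 := (mul_eq_zero.1 h6).resolve_right (resultant_divByMonic_ne_zero hw0 hw1 hne)
  rwa [h7] at hR

/-- Roots of a monic polynomial with small coefficients are small. -/
theorem norm_root_lt {e : ℕ} {w : Fin e → ℂ} {δ : ℝ} (hδ : 0 < δ)
    (hw : ∑ i, ‖w i‖ * δ⁻¹ ^ (e - i) < 1) {z : ℂ} (hz : (monicPoly w).eval z = 0) : ‖z‖ < δ := by
  by_contra! h
  have hz0 : 0 < ‖z‖ := hδ.trans_le h
  rw [eval_monicPoly] at hz
  have h1 : ‖z‖ ^ e ≤ ∑ i, ‖w i‖ * ‖z‖ ^ (i : ℕ) := by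
    rw [← norm_pow, eq_neg_of_add_eq_zero_left hz, norm_neg]
    refine (norm_sum_le _ _).trans_eq (Finset.sum_congr rfl fun i _ => ?_)
    rw [norm_mul, norm_pow]
  have h2 : ∑ i, ‖w i‖ * ‖z‖ ^ (i : ℕ) ≤ (∑ i, ‖w i‖ * δ⁻¹ ^ (e - i)) * ‖z‖ ^ e := by
    rw [Finset.sum_mul]
    refine Finset.sum_le_sum fun i _ => ?_
    rw [mul_assoc]
    gcongr
    have : ‖z‖ ^ e = ‖z‖ ^ (e - i) * ‖z‖ ^ (i : ℕ) := by
      rw [← pow_add, Nat.sub_add_cancel i.2.le]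
    rw [this, ← mul_assoc, ← mul_pow]
    refine le_mul_of_one_le_left (by positivity) (one_le_pow₀ ?_)
    rw [inv_mul_eq_div, one_le_div hδ]
    exact h
  have h3 : 0 < ‖z‖ ^ e := by positivity
  nlinarith

end

/-- At a zero of `(f, h)`, the eliminants of the components of `f` modulo `h` have an injective
derivative. -/
theorem injective_fderiv_eliminant {n e : ℕ} {X : Type*} [NormedAddCommGroup X] [NormedSpace ℂ X]
    {w : Fin e → X → ℂ} {R : Fin n → Fin e → X → ℂ} {u : X × ℂ → ℂ} {Q : Fin n → X × ℂ → ℂ}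
    {f : X × ℂ → Fin n → ℂ} {h : X × ℂ → ℂ} {x : X} {z : ℂ}
    (hw : ∀ i, AnalyticAt ℂ (w i) x) (hR : ∀ k i, AnalyticAt ℂ (R k i) x)
    (hu : DifferentiableAt ℂ u (x, z)) (hu0 : u (x, z) ≠ 0)
    (hQ : ∀ k, DifferentiableAt ℂ (Q k) (x, z))
    (hf : DifferentiableAt ℂ f (x, z)) (hh : DifferentiableAt ℂ h (x, z))
    (hprep : ∀ᶠ q in 𝓝 (x, z), (monicPoly fun i => w i q.1).eval q.2 = u q * h q)
    (hdiv : ∀ k, ∀ᶠ q in 𝓝 (x, z), f q k =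
      Q k q * (monicPoly fun i => w i q.1).eval q.2 + (lowPoly fun i => R k i q.1).eval q.2)
    (hf0 : f (x, z) = 0) (hh0 : h (x, z) = 0)
    (hinj : Function.Injective (fderiv ℂ (fun q => (f q, h q)) (x, z)))
    (hz : fderiv ℂ h (x, z) (0, 1) ≠ 0)
    (hne : ∀ k ξ, ξ ≠ z → (monicPoly fun i => w i x).eval ξ = 0 →
      (lowPoly fun i => R k i x).eval ξ ≠ 0) :
    Function.Injective
      (fderiv ℂ (fun q k => eliminant (fun i => w i q) fun i => R k i q) x) := by
  have hEa : ∀ k, AnalyticAt ℂ (fun q => eliminant (fun i => w i q) fun i => R k i q) x := by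
    intro k
    exact analyticAt_resultant (analyticAt_coeff_monicPoly hw) (analyticAt_coeff_lowPoly (hR k))
  have hED := hasFDerivAt_pi.2 fun k => (hEa k).differentiableAt.hasFDerivAt
  rw [hED.fderiv]
  rw [injective_iff_map_eq_zero]
  intro v hv
  have hv' : ∀ k, fderiv ℂ (fun q => eliminant (fun i => w i q) fun i => R k i q) x v = 0 :=
    fun k => congrFun hv k
  have hline : ∀ (a b : ℂ), HasDerivAt (fun t : ℂ => (x + t • (a • v), z + t * b)) (a • v, b) 0 := by
    intro a b
    have h1 : HasDerivAt (fun t : ℂ => x + t • (a • v)) (a • v) 0 := by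
      simpa using ((hasDerivAt_id (0 : ℂ)).smul_const (a • v)).const_add x
    have h2 : HasDerivAt (fun t : ℂ => z + t * b) b 0 := by
      simpa using ((hasDerivAt_id (0 : ℂ)).mul_const b).const_add z
    exact h1.prodMk h2
  have hline0 : ∀ (a b : ℂ), (x + (0 : ℂ) • (a • v), z + 0 * b) = (x, z) := by simp
  have hcurve : ∀ (a b : ℂ) {Y : Type} [NormedAddCommGroup Y] [NormedSpace ℂ Y] (g : X × ℂ → Y),
      DifferentiableAt ℂ g (x, z) → HasDerivAt (fun t : ℂ => g (x + t • (a • v), z + t * b))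
        (fderiv ℂ g (x, z) (a • v, b)) 0 := by
    intro a b Y _ _ g hg
    refine HasFDerivAt.comp_hasDerivAt (l := g) (f := fun t : ℂ => (x + t • (a • v), z + t * b))
      0 ?_ (hline a b)
    rw [hline0]; exact hg.hasFDerivAt
  have hev : ∀ (a b : ℂ) {p : X × ℂ → Prop}, (∀ᶠ q in 𝓝 (x, z), p q) →
      ∀ᶠ t in 𝓝 (0 : ℂ), p (x + t • (a • v), z + t * b) := by
    intro a b p hp
    refine (hline a b).continuousAt.eventually ?_
    beta_reduce
    rwa [hline0]
  -- the derivative of the Weierstrass polynomial along lines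
  have hWd : ∀ a b : ℂ, HasDerivAt (fun t : ℂ =>
      (monicPoly fun i => w i (x + t • (a • v))).eval (z + t * b))
      (u (x, z) * fderiv ℂ h (x, z) (a • v, b)) 0 := by
    intro a b
    have h1 := (hcurve a b u hu).fun_mul (hcurve a b h hh)
    rw [hline0, hh0, mul_zero, zero_add] at h1
    exact h1.congr_of_eventuallyEq (hev a b hprep)
  set ζ : ℂ := - fderiv ℂ h (x, z) (v, 0) / fderiv ℂ h (x, z) (0, 1) with hζ
  have hDh : fderiv ℂ h (x, z) (v, ζ) = 0 := by
    have : ((v, ζ) : X × ℂ) = (v, 0) + ζ • (0, 1) := by simp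
    rw [this, map_add, map_smul, hζ, smul_eq_mul]
    field_simp
    simp
  have hW0 : (monicPoly fun i => w i x).eval z = 0 := by
    have := hprep.self_of_nhds
    simpa [hh0] using this
  have hW1 : (monicPoly fun i => w i x).derivative.eval z ≠ 0 := by
    have h1 := hWd 0 1
    simp only [zero_smul, smul_zero, add_zero, mul_one] at h1
    have h2 : HasDerivAt (fun t : ℂ => (monicPoly fun i => w i x).eval (z + t))
        ((monicPoly fun i => w i x).derivative.eval z) 0 := by
      have := ((monicPoly fun i => w i x).hasDerivAt (z + 0)).comp_const_add z 0
      simpa using this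
    rw [h2.unique h1]
    exact mul_ne_zero hu0 hz
  have hxa : AnalyticAt ℂ (fun t : ℂ => x + t • v) 0 :=
    analyticAt_const.fun_add (analyticAt_id.smul analyticAt_const)
  have hx0 : x + (0 : ℂ) • v = x := by simp
  have key : ∀ k, fderiv ℂ f (x, z) (v, ζ) k = 0 := by
    intro k
    have hR0 : (lowPoly fun i => R k i x).eval z = 0 := by
      have := (hdiv k).self_of_nhds
      simpa [hf0, hW0] using this.symm
    have hWz := hWd 1 ζ
    simp only [one_smul, hDh, mul_zero] at hWz
    have hE : HasDerivAt (fun t : ℂ => eliminant (fun i => w i (x + t • v))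
        fun i => R k i (x + t • v)) 0 0 := by
      have h1 : HasDerivAt (fun t : ℂ => x + t • v) v 0 := by
        simpa using ((hasDerivAt_id (0 : ℂ)).smul_const v).const_add x
      have h2 : HasFDerivAt (fun q => eliminant (fun i => w i q) fun i => R k i q)
          (fderiv ℂ (fun q => eliminant (fun i => w i q) fun i => R k i q) x) (x + (0 : ℂ) • v) := by
        rw [hx0]; exact (hEa k).differentiableAt.hasFDerivAt
      have h3 := HasFDerivAt.comp_hasDerivAt (0 : ℂ) h2 h1
      rw [hv' k] at h3
      exact h3
    have hRd := hasDerivAt_zero_of_eliminant (w := fun t i => w i (x + t • v))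
      (a := fun t i => R k i (x + t • v)) (z := fun t => z + t * ζ)
      (fun i => AnalyticAt.fun_comp (g := w i) (by rw [hx0]; exact hw i) hxa)
      (fun i => AnalyticAt.fun_comp (g := R k i) (by rw [hx0]; exact hR k i) hxa)
      (analyticAt_const.fun_add (analyticAt_id.fun_mul analyticAt_const))
      (by simpa using hW0) (by simpa using hR0) (by simpa using hW1)
      (by simpa using hne k) hWz hE
    have hfk : HasDerivAt (fun t : ℂ => f (x + t • v, z + t * ζ) k)
        (fderiv ℂ f (x, z) (v, ζ) k) 0 := by
      have := hasDerivAt_pi.1 (hcurve 1 ζ f hf) k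
      simpa only [one_smul] using this
    have hQW := ((hcurve 1 ζ (Q k) (hQ k)).fun_mul (by simpa using hWz)).fun_add hRd
    have hfe := hev 1 ζ (hdiv k)
    simp only [one_smul] at hQW hfe
    have := hfk.unique (hQW.congr_of_eventuallyEq hfe)
    rw [this]
    simp [hW0]
  have hpair : fderiv ℂ (fun q => (f q, h q)) (x, z) (v, ζ) = 0 := by
    rw [(hf.hasFDerivAt.prodMk hh.hasFDerivAt).fderiv]
    refine Prod.ext ?_ hDh
    exact funext key
  have := hinj (hpair.trans (map_zero _).symm)
  exact congrArg Prod.fst this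

section

/-- Near the origin, the number of nondegenerate zeros of `g (·, t)` is bounded, uniformly in the
parameter `t`. -/
def HasBoundedZeros {X T Y : Type*} [NormedAddCommGroup X] [NormedSpace ℂ X]
    [NormedAddCommGroup T] [NormedAddCommGroup Y] [NormedSpace ℂ Y] (g : X × T → Y) : Prop :=
  ∃ r : ℝ, 0 < r ∧ ∃ N : ℕ, ∀ t, ‖t‖ < r → ∀ S : Finset X,
    (∀ x ∈ S, ‖x‖ < r ∧ g (x, t) = 0 ∧ Function.Injective (fderiv ℂ (fun y => g (y, t)) x)) →
      S.card ≤ N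

variable {X T Y : Type} [NormedAddCommGroup X] [NormedSpace ℂ X]
  [NormedAddCommGroup T] [NormedSpace ℂ T]

theorem exists_pos_forall_eventually {p : (X × T) × ℂ → Prop} (hp : ∀ᶠ q in 𝓝 0, p q) :
    ∃ ρ > 0, ∀ x t z, ‖x‖ < ρ → ‖t‖ < ρ → ‖z‖ < ρ → ∀ᶠ q in 𝓝 ((x, t), z), p q := by
  obtain ⟨ρ, hρ, h⟩ := Metric.eventually_nhds_iff.1 hp.eventually_nhds
  refine ⟨ρ, hρ, fun x t z hx ht hz => h ?_⟩
  rw [dist_zero_right, Prod.norm_def, Prod.norm_def]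
  exact max_lt (max_lt hx ht) hz

variable [FiniteDimensional ℂ X] [FiniteDimensional ℂ T]

theorem exists_bound_of_generic {n : ℕ}
    (hNZ : ∀ g : X × T → Fin n → ℂ, AnalyticAt ℂ g 0 → HasBoundedZeros g)
    {f : (X × ℂ) × T → Fin n → ℂ} {h : (X × ℂ) × T → ℂ}
    (hf : AnalyticAt ℂ f 0) (hh : AnalyticAt ℂ h 0)
    (h0 : ¬ ∀ᶠ z in 𝓝 (0 : ℂ), h ((0, z), 0) = 0) {r₀ : ℝ} (hr₀ : 0 < r₀) :
    ∃ δ, 0 < δ ∧ δ ≤ r₀ ∧ ∃ r, 0 < r ∧ r ≤ δ ∧ ∃ N : ℕ,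
      (∀ x t, ‖x‖ < r → ‖t‖ < r → {z : ℂ | ‖z‖ < δ ∧ h ((x, z), t) = 0}.Finite ∧
        {z : ℂ | ‖z‖ < δ ∧ h ((x, z), t) = 0}.ncard ≤ N) ∧
      ∀ t, ‖t‖ < r → ∀ S : Finset (X × ℂ), Set.InjOn Prod.fst (S : Set (X × ℂ)) →
        (∀ p ∈ S, ‖p‖ < r ∧ f (p, t) = 0 ∧ h (p, t) = 0 ∧
          Function.Injective (fderiv ℂ (fun q => (f (q, t), h (q, t))) p) ∧
          fderiv ℂ (fun q => h (q, t)) p (0, 1) ≠ 0 ∧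
          ∀ ζ, ‖ζ‖ < δ → ζ ≠ p.2 → h ((p.1, ζ), t) = 0 → ∀ k, f ((p.1, ζ), t) k ≠ 0) →
        S.card ≤ N := by
  classical
  let ψ : (X × T) × ℂ → (X × ℂ) × T := fun q => ((q.1.1, q.2), q.1.2)
  have hψa : ∀ q, AnalyticAt ℂ ψ q := fun q => by
    have h1 : AnalyticAt ℂ (fun q : (X × T) × ℂ => q.1) q := analyticAt_fst
    have h2 : AnalyticAt ℂ (fun q : (X × T) × ℂ => q.2) q := analyticAt_snd
    have h3 : AnalyticAt ℂ (fun q : (X × T) × ℂ => q.1.1) q :=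
      AnalyticAt.fun_comp (g := Prod.fst) analyticAt_fst h1
    have h4 : AnalyticAt ℂ (fun q : (X × T) × ℂ => q.1.2) q :=
      AnalyticAt.fun_comp (g := Prod.snd) analyticAt_snd h1
    exact (h3.prod h2).prod h4
  have hψ0 : ψ 0 = 0 := rfl
  have hψt : Tendsto ψ (𝓝 0) (𝓝 0) := by
    have := (hψa 0).continuousAt.tendsto
    rwa [hψ0] at this
  obtain ⟨e, w, u, hw, hw0, hu, hu0, hprep⟩ := weierstrass_preparation (P := X × T)
    (G := fun q => h (ψ q)) (AnalyticAt.fun_comp (g := h) (by rwa [hψ0]) (hψa 0)) h0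
  have hdiv := fun k => weierstrass_division (P := X × T) (f := fun q => f (ψ q) k) hw hw0
    (AnalyticAt.fun_comp (g := fun p => f p k) (by rw [hψ0]; exact (analyticAt_pi_iff.1 hf) k)
      (hψa 0))
  choose Q R hQ hR hdiv using hdiv
  have hall : ∀ᶠ q : (X × T) × ℂ in 𝓝 0,
      ((monicPoly fun i => w i q.1).eval q.2 = u q * h (ψ q) ∧
        (∀ k, f (ψ q) k = Q k q * (monicPoly fun i => w i q.1).eval q.2 +
          (lowPoly fun i => R k i q.1).eval q.2)) ∧
      (u q ≠ 0 ∧ AnalyticAt ℂ u q ∧ (∀ k, AnalyticAt ℂ (Q k) q)) ∧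
      ((∀ i, AnalyticAt ℂ (w i) q.1) ∧ (∀ k i, AnalyticAt ℂ (R k i) q.1)) ∧
      (AnalyticAt ℂ f (ψ q) ∧ AnalyticAt ℂ h (ψ q)) := by
    have hfst : Tendsto (Prod.fst : (X × T) × ℂ → X × T) (𝓝 0) (𝓝 0) :=
      continuous_fst.tendsto' _ _ rfl
    simp only [eval_monicPoly, eval_lowPoly]
    refine (hprep.and (eventually_all.2 hdiv)).and (((hu.continuousAt.eventually_ne hu0).and
      (hu.eventually_analyticAt.and (eventually_all.2 fun k => (hQ k).eventually_analyticAt))).and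
      (((eventually_all.2 fun i => hfst.eventually (hw i).eventually_analyticAt).and
        (eventually_all.2 fun k => eventually_all.2 fun i =>
          hfst.eventually (hR k i).eventually_analyticAt)).and
        ((hψt.eventually hf.eventually_analyticAt).and
          (hψt.eventually hh.eventually_analyticAt))))
  obtain ⟨ρ, hρ, hloc⟩ := exists_pos_forall_eventually hall
  have hpt := fun x t z hx ht hz => (hloc x t z hx ht hz).self_of_nhds
  set δ := min (ρ / 2) r₀ with hδ
  have hδ0 : 0 < δ := by positivity
  have hδρ : δ < ρ := (min_le_left _ _).trans_lt (by linarith)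
  -- the roots of the Weierstrass polynomial are small
  have hsmall : ∀ᶠ p : X × T in 𝓝 0, ∑ i : Fin e, ‖w i p‖ * δ⁻¹ ^ (e - i) < 1 := by
    have : ContinuousAt (fun p : X × T => ∑ i : Fin e, ‖w i p‖ * δ⁻¹ ^ (e - i : ℕ)) 0 :=
      tendsto_finsetSum _ fun i _ => ((hw i).continuousAt.norm.mul continuousAt_const)
    refine this.eventually_lt_const ?_
    simp [hw0]
  obtain ⟨r₁, hr₁, hsmall⟩ := Metric.eventually_nhds_iff.1 hsmall
  let M : X × T → Fin n → ℂ := fun p k => eliminant (fun i => w i p) fun i => R k i p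
  have hM : AnalyticAt ℂ M 0 := analyticAt_pi_iff.2 fun k =>
    analyticAt_resultant (analyticAt_coeff_monicPoly hw) (analyticAt_coeff_lowPoly (hR k))
  obtain ⟨r₂, hr₂, N, hN⟩ := hNZ M hM
  set r := min δ (min r₁ r₂) with hr
  have hr0 : 0 < r := by positivity
  have hrδ : r ≤ δ := min_le_left _ _
  have hrr₁ : r ≤ r₁ := (min_le_right _ _).trans (min_le_left _ _)
  have hrr₂ : r ≤ r₂ := (min_le_right _ _).trans (min_le_right _ _)
  have hroot : ∀ x t ξ, ‖x‖ < r → ‖t‖ < r → (monicPoly fun i => w i (x, t)).eval ξ = 0 →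
      ‖ξ‖ < δ := by
    intro x t ξ hx ht hξ
    refine norm_root_lt hδ0 (hsmall ?_) hξ
    rw [dist_zero_right, Prod.norm_def]
    exact max_lt (hx.trans_le hrr₁) (ht.trans_le hrr₁)
  have hiff : ∀ x t ξ, ‖x‖ < r → ‖t‖ < r → ‖ξ‖ < δ →
      ((monicPoly fun i => w i (x, t)).eval ξ = 0 ↔ h ((x, ξ), t) = 0) := by
    intro x t ξ hx ht hξ
    obtain ⟨⟨h1, -⟩, ⟨h2, -⟩, -⟩ := hpt x t ξ (hx.trans_le (hrδ.trans hδρ.le))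
      (ht.trans_le (hrδ.trans hδρ.le)) (hξ.trans hδρ)
    rw [h1, mul_eq_zero, or_iff_right h2]
  refine ⟨δ, hδ0, min_le_right _ _, r, hr0, hrδ, max e N, fun x t hx ht => ?_, fun t ht S hS hSp => ?_⟩
  · have hsub : {z : ℂ | ‖z‖ < δ ∧ h ((x, z), t) = 0} ⊆
        ((monicPoly fun i => w i (x, t)).roots.toFinset : Set ℂ) := by
      rintro z ⟨hz, hz0⟩
      simp only [Finset.mem_coe, Multiset.mem_toFinset]
      exact (Polynomial.mem_roots (monic_monicPoly _).ne_zero).2 ((hiff x t z hx ht hz).2 hz0)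
    refine ⟨(Finset.finite_toSet _).subset hsub, ?_⟩
    refine (Set.ncard_le_ncard hsub (Finset.finite_toSet _)).trans ?_
    rw [Set.ncard_coe_finset]
    refine (Multiset.toFinset_card_le _).trans ((Polynomial.card_roots' _).trans ?_)
    rw [natDegree_monicPoly]
    exact le_max_left _ _
  · rw [← Finset.card_image_of_injOn hS]
    refine (hN t (ht.trans_le hrr₂) _ fun x hx => ?_).trans (le_max_right _ _)
    obtain ⟨⟨x, z⟩, hp, rfl⟩ := Finset.mem_image.1 hx
    obtain ⟨hpr, hf0, hh0, hinj, hz0, hother⟩ := hSp _ hp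
    have hxr : ‖x‖ < r := (norm_fst_le (x, z)).trans_lt hpr
    have hzr : ‖z‖ < r := (norm_snd_le (x, z)).trans_lt hpr
    have hev := hloc x t z (hxr.trans_le (hrδ.trans hδρ.le)) (ht.trans_le (hrδ.trans hδρ.le))
      (hzr.trans_le (hrδ.trans hδρ.le))
    obtain ⟨⟨h1, h2⟩, ⟨h3, h4, h5⟩, ⟨h6, h7⟩, h8, h9⟩ := hev.self_of_nhds
    have hW0 : (monicPoly fun i => w i (x, t)).eval z = 0 :=
      (hiff x t z hxr ht (hzr.trans_le hrδ)).2 hh0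
    let j : X × ℂ → (X × T) × ℂ := fun q => ((q.1, t), q.2)
    have hjc : Continuous j := by fun_prop
    have hj : DifferentiableAt ℂ j (x, z) := by fun_prop
    have hj' : DifferentiableAt ℂ (fun q : X × ℂ => (q, t)) (x, z) := by fun_prop
    have hk' : AnalyticAt ℂ (fun y : X => (y, t)) x := analyticAt_id.prod analyticAt_const
    have hev' := (hjc.tendsto (x, z)).eventually hev
    refine ⟨hxr.trans_le hrr₂, funext fun k => ?_, ?_⟩
    · refine eliminant_eq_zero hW0 ?_
      have := h2 k
      rw [hW0, mul_zero, zero_add] at this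
      rw [← this]
      exact congrFun hf0 k
    · refine injective_fderiv_eliminant (w := fun i y => w i (y, t)) (R := fun k i y => R k i (y, t))
        (u := fun q => u (j q)) (Q := fun k q => Q k (j q)) (f := fun q => f (q, t))
        (h := fun q => h (q, t)) (z := z)
        (fun i => AnalyticAt.fun_comp (g := w i) (h6 i) hk')
        (fun k i => AnalyticAt.fun_comp (g := R k i) (h7 k i) hk')
        (DifferentiableAt.comp (g := u) (x, z) h4.differentiableAt hj) h3
        (fun k => DifferentiableAt.comp (g := Q k) (x, z) (h5 k).differentiableAt hj)
        (DifferentiableAt.comp (g := f) (x, z) h8.differentiableAt hj')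
        (DifferentiableAt.comp (g := h) (x, z) h9.differentiableAt hj')
        (hev'.mono fun q hq => hq.1.1) (fun k => hev'.mono fun q hq => hq.1.2 k)
        hf0 hh0 hinj hz0 ?_
      intro k ξ hξ hξ0
      have hξδ := hroot x t ξ hxr ht hξ0
      have := hother ξ hξδ hξ ((hiff x t ξ hxr ht hξδ).1 hξ0) k
      obtain ⟨⟨-, h2'⟩, -⟩ := hpt x t ξ (hxr.trans_le (hrδ.trans hδρ.le))
        (ht.trans_le (hrδ.trans hδρ.le)) (hξδ.trans hδρ)
      have h2' := h2' k
      rw [hξ0, mul_zero, zero_add] at h2'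
      rw [← h2']
      exact this

end

section

theorem exists_norm_lt_forall_mem {V : Type*} [NormedAddCommGroup V] [CompleteSpace V]
    {ι : Type*} [Finite ι] {O : ι → Set V} (ho : ∀ i, IsOpen (O i)) (hd : ∀ i, Dense (O i))
    {ε : ℝ} (hε : 0 < ε) : ∃ x, ‖x‖ < ε ∧ ∀ i, x ∈ O i := by
  have : Countable ι := Finite.to_countable
  obtain ⟨x, hx, hx'⟩ := (dense_iInter_of_isOpen ho hd).exists_mem_open Metric.isOpen_ball
    (Metric.nonempty_ball.2 hε : (Metric.ball (0 : V) ε).Nonempty)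
  exact ⟨x, by simpa using hx', Set.mem_iInter.1 hx⟩

theorem isOpen_affine_ne_zero {V : Type*} [NormedAddCommGroup V] [NormedSpace ℂ V]
    (a : ℂ) (φ : V →L[ℂ] ℂ) : IsOpen {x | a + φ x ≠ 0} :=
  isOpen_ne_fun (by fun_prop) (by fun_prop)

theorem dense_affine_ne_zero {V : Type*} [NormedAddCommGroup V] [NormedSpace ℂ V]
    {a : ℂ} {φ : V →L[ℂ] ℂ} (h : ¬(a = 0 ∧ φ = 0)) : Dense {x | a + φ x ≠ 0} := by
  by_cases hφ : φ = 0
  · have ha : a ≠ 0 := fun ha => h ⟨ha, hφ⟩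
    have : {x : V | a + φ x ≠ 0} = Set.univ := by
      ext x; simp [hφ, ha]
    rw [this]; exact dense_univ
  · obtain ⟨v, hv⟩ : ∃ v, φ v ≠ 0 := by
      by_contra! h'
      exact hφ (ContinuousLinearMap.ext h')
    intro x
    by_cases hx : a + φ x = 0
    · have hc : Tendsto (fun τ : ℂ => x + τ • v) (𝓝[≠] 0) (𝓝 x) := by
        have : Continuous fun τ : ℂ => x + τ • v := by fun_prop
        exact (this.tendsto' 0 x (by simp)).mono_left nhdsWithin_le_nhds
      refine mem_closure_of_tendsto hc ?_
      filter_upwards [self_mem_nhdsWithin] with τ hτ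
      simp only [map_add, map_smul, smul_eq_mul, ← add_assoc, hx, zero_add]
      exact mul_ne_zero hτ hv
    · exact subset_closure hx

variable {X : Type} [NormedAddCommGroup X] [NormedSpace ℂ X] [FiniteDimensional ℂ X]

theorem det_restrictScalars_eq_zero {D : X →L[ℂ] X} (hD : ¬Function.Injective D) :
    (D.restrictScalars ℝ).det = 0 := by
  by_contra h
  refine hD ?_
  have h1 : IsUnit (D.restrictScalars ℝ : X →ₗ[ℝ] X) := by
    rw [LinearMap.isUnit_iff_isUnit_det]
    exact isUnit_iff_ne_zero.2 h
  have h2 := LinearMap.ker_eq_bot.1 ((LinearMap.isUnit_iff_ker_eq_bot _).1 h1)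
  exact h2

/-- The theorem of Sard in equal dimensions. -/
theorem dense_regular_values {G : X → X} {s : Set X}
    (hG : ∀ x ∈ s, DifferentiableAt ℂ G x) :
    Dense {y | ∀ x ∈ s, G x = y → Function.Injective (fderiv ℂ G x)} := by
  let _ : MeasurableSpace X := borel X
  have : BorelSpace X := ⟨rfl⟩
  have : FiniteDimensional ℝ X := FiniteDimensional.complexToReal X
  let c := {x ∈ s | ¬Function.Injective (fderiv ℂ G x)}
  have h0 : (Measure.addHaar : Measure X) (G '' c) = 0 := by
    refine addHaar_image_eq_zero_of_det_fderivWithin_eq_zero _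
      (f' := fun x => (fderiv ℂ G x).restrictScalars ℝ) (fun x hx => ?_) fun x hx => ?_
    · exact ((hG x hx.1).hasFDerivAt.restrictScalars ℝ).hasFDerivWithinAt
    · exact det_restrictScalars_eq_zero hx.2
  have h1 : Dense (G '' c)ᶜ := by
    rw [← interior_eq_empty_iff_dense_compl]
    exact Measure.interior_eq_empty_of_null h0
  refine h1.mono fun y hy x hx hxy => ?_
  by_contra h
  exact hy ⟨x, ⟨hx, h⟩, hxy⟩

theorem finite_fiber_of_injective {G : X → X} {ρ : ℝ} {y : X}
    (hG : ∀ x ∈ Metric.closedBall (0 : X) ρ, DifferentiableAt ℂ G x)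
    (hy : ∀ x ∈ Metric.closedBall (0 : X) ρ, G x = y → Function.Injective (fderiv ℂ G x)) :
    {x ∈ Metric.closedBall (0 : X) ρ | G x = y}.Finite := by
  have : ProperSpace X := FiniteDimensional.proper ℂ X
  by_contra hinf
  obtain ⟨x, hx, hacc⟩ := Set.Infinite.exists_accPt_of_subset_isCompact hinf
    (isCompact_closedBall (0 : X) ρ) (fun x hx => hx.1)
  have hcont := (hG x hx).continuousAt
  have hfreq := accPt_iff_frequently_nhdsNE.1 hacc
  have hGx : G x = y := by
    have h1 : ∃ᶠ z in 𝓝 x, G z = y :=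
      (hfreq.filter_mono nhdsWithin_le_nhds).mono fun z hz => hz.2
    by_contra hne
    exact h1 ((hcont.eventually_ne hne).mono fun z hz => hz)
  obtain ⟨K, hK, hKl⟩ := (fderiv ℂ G x).exists_antilipschitzWith (LinearMap.ker_eq_bot.2 (hy x hx hGx))
  have h2 := HasFDerivAt.eventually_ne (c := y) (hG x hx).hasFDerivAt ⟨K, hKl⟩
  exact hfreq (h2.mono fun z hz h => hz h.2)

theorem eventually_exists_preimages {G : X → X} {S : Finset X} {r : ℝ}
    (hS : ∀ x ∈ S, AnalyticAt ℂ G x ∧ ‖x‖ < r ∧ G x = 0 ∧ Function.Injective (fderiv ℂ G x)) :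
    ∀ᶠ y in 𝓝 0, ∃ S' : Finset X, S'.card = S.card ∧ ∀ x ∈ S', ‖x‖ < r ∧ G x = y := by
  classical
  have : CompleteSpace X := FiniteDimensional.complete ℂ X
  obtain ⟨V, hV, hdisj⟩ := S.finite_toSet.t2_separation
  have h1 : ∀ x : S, ∀ᶠ y in 𝓝 (0 : X), ∃ z, z ∈ V x ∧ ‖z‖ < r ∧ G z = y := by
    rintro ⟨x, hx⟩
    obtain ⟨ha, hr, h0, hi⟩ := hS x hx
    have hsurj : (fderiv ℂ G x).range = ⊤ := by
      have := (LinearMap.injective_iff_surjective (f := (fderiv ℂ G x : X →ₗ[ℂ] X))).1 hi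
      exact LinearMap.range_eq_top.2 this
    have hmap := ha.hasStrictFDerivAt.map_nhds_eq_of_surj hsurj
    rw [h0] at hmap
    have h2 : V x ∩ {z | ‖z‖ < r} ∈ 𝓝 x :=
      inter_mem ((hV x).2.mem_nhds (hV x).1) ((isOpen_lt continuous_norm continuous_const).mem_nhds hr)
    have h3 := image_mem_map (m := G) h2
    rw [hmap] at h3
    filter_upwards [h3] with y hy
    obtain ⟨z, ⟨hz1, hz2⟩, rfl⟩ := hy
    exact ⟨z, hz1, hz2, rfl⟩
  filter_upwards [eventually_all.2 h1] with y hy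
  choose z hz1 hz2 hz3 using hy
  refine ⟨Finset.univ.image z, ?_, ?_⟩
  · rw [Finset.card_image_of_injective _ fun x x' h => ?_, Finset.card_univ, Fintype.card_coe]
    by_contra hne
    have := hdisj x.2 x'.2 (fun h' => hne (Subtype.ext h'))
    exact Set.disjoint_left.1 this (hz1 x) (h ▸ hz1 x')
  · intro x hx
    obtain ⟨x, -, rfl⟩ := Finset.mem_image.1 hx
    exact ⟨hz2 x, hz3 x⟩

theorem exists_regular_perturbation {G : X → X} {S : Finset X} {r ρ ε : ℝ} (hε : 0 < ε)
    (hrρ : r ≤ ρ) (hG : ∀ x ∈ Metric.closedBall (0 : X) ρ, AnalyticAt ℂ G x)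
    (hS : ∀ x ∈ S, ‖x‖ < r ∧ G x = 0 ∧ Function.Injective (fderiv ℂ G x)) :
    ∃ y, ‖y‖ < ε ∧
      (∀ x ∈ Metric.closedBall (0 : X) ρ, G x = y → Function.Injective (fderiv ℂ G x)) ∧
      {x ∈ Metric.closedBall (0 : X) ρ | G x = y}.Finite ∧
      ∃ S' : Finset X, S'.card = S.card ∧ ∀ x ∈ S', ‖x‖ < r ∧ G x = y := by
  have h1 : ∀ᶠ y in 𝓝 (0 : X), ∃ S' : Finset X, S'.card = S.card ∧ ∀ x ∈ S', ‖x‖ < r ∧ G x = y :=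
    eventually_exists_preimages fun x hx => ⟨hG x (by simpa using (hS x hx).1.le.trans hrρ), hS x hx⟩
  have h2 : ∀ᶠ y in 𝓝 (0 : X), ‖y‖ < ε :=
    (isOpen_lt continuous_norm continuous_const).mem_nhds (by simpa using hε)
  obtain ⟨y, hy, hy1, hy2⟩ := (dense_regular_values fun x hx =>
    (hG x hx).differentiableAt).inter_nhds_nonempty (h1.and h2)
  exact ⟨y, hy2, hy, finite_fiber_of_injective (fun x hx => (hG x hx).differentiableAt) hy, hy1⟩

end

section

variable {n : ℕ}

/-- The shear `(x, z) ↦ (x + z c, z)`. -/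
noncomputable def shear (c : Fin n → ℂ) : ((Fin n → ℂ) × ℂ) →L[ℂ] ((Fin n → ℂ) × ℂ) :=
  (ContinuousLinearMap.fst ℂ _ _ + (ContinuousLinearMap.snd ℂ _ _).smulRight c).prod
    (ContinuousLinearMap.snd ℂ _ _)

theorem shear_apply (c : Fin n → ℂ) (p : (Fin n → ℂ) × ℂ) : shear c p = (p.1 + p.2 • c, p.2) := rfl

theorem shear_shear_neg (c : Fin n → ℂ) (p : (Fin n → ℂ) × ℂ) : shear c (shear (-c) p) = p := by
  simp [shear_apply]

theorem shear_injective (c : Fin n → ℂ) : Function.Injective (shear c) := by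
  intro p q h
  rw [shear_apply, shear_apply, Prod.mk.injEq] at h
  refine Prod.ext ?_ h.2
  have := h.1
  rw [h.2] at this
  exact add_right_cancel this

/-- The linear map `(v, ζ) ↦ (v + A v, ζ + ⟨b, v⟩)`. -/
noncomputable def mixing (b : Fin n → ℂ) (A : Fin n → Fin n → ℂ) :
    ((Fin n → ℂ) × ℂ) →L[ℂ] ((Fin n → ℂ) × ℂ) :=
  (ContinuousLinearMap.pi fun k => (ContinuousLinearMap.proj k).comp (ContinuousLinearMap.fst ℂ _ _) +
    ∑ l, A k l • (ContinuousLinearMap.proj l).comp (ContinuousLinearMap.fst ℂ _ _)).prod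
  (ContinuousLinearMap.snd ℂ _ _ +
    ∑ l, b l • (ContinuousLinearMap.proj l).comp (ContinuousLinearMap.fst ℂ _ _))

theorem mixing_fst (b : Fin n → ℂ) (A : Fin n → Fin n → ℂ) (p : (Fin n → ℂ) × ℂ) (k : Fin n) :
    (mixing b A p).1 k = p.1 k + ∑ l, A k l * p.1 l := by
  simp [mixing]

theorem mixing_snd (b : Fin n → ℂ) (A : Fin n → Fin n → ℂ) (p : (Fin n → ℂ) × ℂ) :
    (mixing b A p).2 = p.2 + ∑ l, b l * p.1 l := by
  simp [mixing]

theorem mixing_injective (b : Fin n → ℂ) {A : Fin n → Fin n → ℂ} (hA : ‖A‖ < ((n : ℝ) + 1)⁻¹) :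
    Function.Injective (mixing b A) := by
  rw [injective_iff_map_eq_zero]
  intro p hp
  have h1 : ∀ k, p.1 k + ∑ l, A k l * p.1 l = 0 := fun k => by
    rw [← mixing_fst b A, hp]; rfl
  have h2 : ‖p.1‖ ≤ n * ‖A‖ * ‖p.1‖ := by
    refine (pi_norm_le_iff_of_nonneg (by positivity)).2 fun k => ?_
    rw [eq_neg_of_add_eq_zero_left (h1 k), norm_neg]
    refine (norm_sum_le _ _).trans ?_
    have : ∀ l ∈ (Finset.univ : Finset (Fin n)), ‖A k l * p.1 l‖ ≤ ‖A‖ * ‖p.1‖ := fun l _ => by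
      rw [norm_mul]
      exact mul_le_mul ((norm_le_pi_norm (A k) l).trans (norm_le_pi_norm A k))
        (norm_le_pi_norm p.1 l) (norm_nonneg _) (norm_nonneg _)
    refine (Finset.sum_le_card_nsmul _ _ _ this).trans_eq ?_
    simp [mul_assoc]
  have h3 : (n : ℝ) * ‖A‖ < 1 := by
    have h4 : ((n : ℝ) + 1) * ‖A‖ < 1 := by
      have : (0 : ℝ) < n + 1 := by positivity
      calc ((n : ℝ) + 1) * ‖A‖ < (n + 1) * ((n : ℝ) + 1)⁻¹ := by gcongr
        _ = 1 := mul_inv_cancel₀ this.ne'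
    nlinarith [norm_nonneg A]
  have h5 : p.1 = 0 := by
    by_contra h
    have := norm_pos_iff.2 h
    nlinarith
  have h6 := mixing_snd b A p
  rw [hp] at h6
  refine Prod.ext h5 ?_
  simpa [h5] using h6.symm

theorem exists_shear_separating [NeZero n] {Z : Set ((Fin n → ℂ) × ℂ)} (hZ : Z.Finite) {ε : ℝ}
    (hε : 0 < ε) : ∃ c : Fin n → ℂ, ‖c‖ < ε ∧
      ∀ p ∈ Z, ∀ q ∈ Z, p ≠ q → p.1 - q.1 ≠ (p.2 - q.2) • c := by
  have : Finite Z := hZ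
  let O : {pq : Z × Z // pq.1 ≠ pq.2} → Set (Fin n → ℂ) := fun pq =>
    {c | (pq.1.1 : (Fin n → ℂ) × ℂ).1 - (pq.1.2 : (Fin n → ℂ) × ℂ).1 ≠
      ((pq.1.1 : (Fin n → ℂ) × ℂ).2 - (pq.1.2 : (Fin n → ℂ) × ℂ).2) • c}
  have hO : ∀ pq, Dense (O pq) := by
    rintro ⟨⟨⟨p, hp⟩, ⟨q, hq⟩⟩, hne⟩
    have hne' : p ≠ q := fun h => hne (Subtype.ext h)
    by_cases h : p.2 - q.2 = 0
    · have h1 : p.1 - q.1 ≠ 0 := fun h1 => hne' (Prod.ext (sub_eq_zero.1 h1) (sub_eq_zero.1 h))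
      refine dense_univ.mono fun c _ => ?_
      change p.1 - q.1 ≠ (p.2 - q.2) • c
      rwa [h, zero_smul]
    · refine (dense_compl_singleton ((p.2 - q.2)⁻¹ • (p.1 - q.1))).mono fun c hc => ?_
      change p.1 - q.1 ≠ (p.2 - q.2) • c
      rintro h1
      refine hc ?_
      rw [h1, smul_smul, inv_mul_cancel₀ h, one_smul]
      rfl
  obtain ⟨c, hc, hc'⟩ := exists_norm_lt_forall_mem
    (fun pq => isOpen_ne_fun (by fun_prop) (by fun_prop)) hO hε
  exact ⟨c, hc, fun p hp q hq hne => hc' ⟨(⟨p, hp⟩, ⟨q, hq⟩), fun h => hne (congrArg Subtype.val h)⟩⟩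

theorem exists_mixing_row {Ω : Set ((Fin n → ℂ) × ℂ)} (hΩ : Ω.Finite) (h0 : ∀ ω ∈ Ω, ω ≠ 0) {ε : ℝ}
    (hε : 0 < ε) : ∃ b : Fin n → ℂ, ‖b‖ < ε ∧ ∀ ω ∈ Ω, ω.2 + ∑ l, b l * ω.1 l ≠ 0 := by
  have : Finite Ω := hΩ
  let φ : ((Fin n → ℂ) × ℂ) → (Fin n → ℂ) →L[ℂ] ℂ := fun ω =>
    ∑ l, ω.1 l • ContinuousLinearMap.proj l
  have hφ : ∀ ω b, φ ω b = ∑ l, b l * ω.1 l := fun ω b => by simp [φ, mul_comm]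
  have hd : ∀ ω : Ω, Dense {b | (ω : (Fin n → ℂ) × ℂ).2 + φ ω b ≠ 0} := by
    refine fun ω => dense_affine_ne_zero ?_
    rintro ⟨h1, h2⟩
    refine h0 ω ω.2 (Prod.ext (funext fun k => ?_) h1)
    have := congrArg (fun ψ : (Fin n → ℂ) →L[ℂ] ℂ => ψ (Pi.single k 1)) h2
    simpa [hφ, Pi.single_apply] using this
  obtain ⟨b, hb, hb'⟩ := exists_norm_lt_forall_mem (fun ω => isOpen_affine_ne_zero _ _) hd hε
  exact ⟨b, hb, fun ω hω => by rw [← hφ]; exact hb' ⟨ω, hω⟩⟩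

theorem exists_mixing_matrix {Q : Set (Fin n → ℂ)} (hQ : Q.Finite) (h0 : ∀ v ∈ Q, v ≠ 0) {ε : ℝ}
    (hε : 0 < ε) : ∃ A : Fin n → Fin n → ℂ, ‖A‖ < ε ∧ ∀ v ∈ Q, ∀ k, v k + ∑ l, A k l * v l ≠ 0 := by
  have hQ' : (Set.range fun p : Q × Fin n => ((p.1 : Fin n → ℂ), (p.1 : Fin n → ℂ) p.2)).Finite := by
    have : Finite Q := hQ
    exact Set.finite_range _
  obtain ⟨b, hb, hb'⟩ := exists_mixing_row hQ' (by
    rintro _ ⟨p, rfl⟩ h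
    exact h0 _ p.1.2 (congrArg Prod.fst h)) hε
  exact ⟨fun _ => b, (pi_norm_const_le b).trans_lt hb, fun v hv k => hb' _ ⟨(⟨v, hv⟩, k), rfl⟩⟩

end

section

variable {n : ℕ} {T : Type} [NormedAddCommGroup T] [NormedSpace ℂ T] [FiniteDimensional ℂ T]

theorem analyticAt_of_contDiff {E F : Type*} [NormedAddCommGroup E] [NormedSpace ℂ E]
    [NormedAddCommGroup F] [NormedSpace ℂ F] [CompleteSpace F] {m : E → F} (hm : ContDiff ℂ ⊤ m) (x : E) :
    AnalyticAt ℂ m x :=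
  contDiff_omega_iff_analyticOnNhd.1 hm x (Set.mem_univ x)

/-- The parameter space of the deformations used to bring a map into generic position. -/
abbrev Deform (n : ℕ) (T : Type) : Type :=
  T × (((Fin n → ℂ) × ℂ) × ((Fin n → ℂ) × ((Fin n → ℂ) × (Fin n → Fin n → ℂ))))

theorem norm_deform_lt {t : T} {y : (Fin n → ℂ) × ℂ} {c b : Fin n → ℂ} {A : Fin n → Fin n → ℂ}
    {r : ℝ} (ht : ‖t‖ < r) (hy : ‖y‖ < r) (hc : ‖c‖ < r) (hb : ‖b‖ < r) (hA : ‖A‖ < r) :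
    ‖((t, (y, (c, (b, A)))) : Deform n T)‖ < r := by
  simp only [Prod.norm_mk]
  exact max_lt ht (max_lt hy (max_lt hc (max_lt hb hA)))

/-- The deformation of a family of maps by a translation, a shear and a linear map. -/
noncomputable def deform (g : ((Fin n → ℂ) × ℂ) × T → (Fin n → ℂ) × ℂ)
    (q : ((Fin n → ℂ) × ℂ) × Deform n T) : (Fin n → ℂ) × ℂ :=
  mixing q.2.2.2.2.1 q.2.2.2.2.2 (g (shear q.2.2.2.1 q.1, q.2.1) - q.2.2.1)

theorem analyticAt_deform {g : ((Fin n → ℂ) × ℂ) × T → (Fin n → ℂ) × ℂ} (hg : AnalyticAt ℂ g 0) :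
    AnalyticAt ℂ (deform g) 0 := by
  have h1 : AnalyticAt ℂ (fun q : ((Fin n → ℂ) × ℂ) × Deform n T =>
      g (shear q.2.2.2.1 q.1, q.2.1)) 0 := by
    refine AnalyticAt.fun_comp (g := g) ?_ (analyticAt_of_contDiff ?_ _)
    · have : ((shear (0 : Fin n → ℂ) 0, 0) : ((Fin n → ℂ) × ℂ) × T) = 0 := by simp
      exact this ▸ hg
    · simp only [shear_apply]; fun_prop
  have hv : ∀ l, AnalyticAt ℂ (fun q : ((Fin n → ℂ) × ℂ) × Deform n T =>
      (g (shear q.2.2.2.1 q.1, q.2.1)).1 l - q.2.2.1.1 l) 0 := fun l => by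
    refine AnalyticAt.fun_sub ?_ (analyticAt_of_contDiff (by fun_prop) _)
    exact analyticAt_pi_iff.1 (AnalyticAt.fun_comp (g := Prod.fst) analyticAt_fst h1) l
  have hs : AnalyticAt ℂ (fun q : ((Fin n → ℂ) × ℂ) × Deform n T =>
      (g (shear q.2.2.2.1 q.1, q.2.1)).2 - q.2.2.1.2) 0 := by
    refine AnalyticAt.fun_sub ?_ (analyticAt_of_contDiff (by fun_prop) _)
    exact AnalyticAt.fun_comp (g := Prod.snd) analyticAt_snd h1
  have h3 : AnalyticAt ℂ (fun q => (deform g q).1) 0 := by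
    refine analyticAt_pi_iff.2 fun k => ?_
    simp only [deform, mixing_fst]
    exact (hv k).fun_add (Finset.analyticAt_fun_sum _ fun l _ =>
      (analyticAt_of_contDiff (by fun_prop) _).fun_mul (hv l))
  have h4 : AnalyticAt ℂ (fun q => (deform g q).2) 0 := by
    simp only [deform, mixing_snd]
    exact hs.fun_add (Finset.analyticAt_fun_sum _ fun l _ =>
      (analyticAt_of_contDiff (by fun_prop) _).fun_mul (hv l))
  exact h3.prod h4

theorem hasBoundedZeros_of_ne_zero
    (hNZ : ∀ (T : Type) [NormedAddCommGroup T] [NormedSpace ℂ T] [FiniteDimensional ℂ T]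
      (g : (Fin n → ℂ) × T → Fin n → ℂ), AnalyticAt ℂ g 0 → HasBoundedZeros g)
    {g : ((Fin n → ℂ) × ℂ) × T → (Fin n → ℂ) × ℂ} (hg : AnalyticAt ℂ g 0)
    (h0 : ¬ ∀ᶠ z in 𝓝 (0 : ℂ), (g ((0, z), 0)).2 = 0) : HasBoundedZeros g := by
  classical
  rcases Nat.eq_zero_or_pos n with rfl | hn
  · obtain ⟨δ, hδ, -, r, hr, hrδ, N, hN, -⟩ := exists_bound_of_generic (hNZ T)
      (f := fun q => (g q).1) (h := fun q => (g q).2)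
      (AnalyticAt.fun_comp (g := Prod.fst) analyticAt_fst hg)
      (AnalyticAt.fun_comp (g := Prod.snd) analyticAt_snd hg) h0 one_pos
    refine ⟨r, hr, N, fun t ht S hS => ?_⟩
    obtain ⟨hfin, hcard⟩ := hN 0 t (by simpa) ht
    rw [← Finset.card_image_of_injective S (f := Prod.snd)
      (fun p q h => Prod.ext (Subsingleton.elim _ _) h), ← Set.ncard_coe_finset]
    refine (Set.ncard_le_ncard ?_ hfin).trans hcard
    intro z hz
    obtain ⟨⟨x, z⟩, hp, rfl⟩ := Finset.mem_image.1 hz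
    obtain ⟨h1, h2, -⟩ := hS _ hp
    refine ⟨(norm_snd_le (x, z)).trans_lt (h1.trans_le hrδ), ?_⟩
    rw [Subsingleton.elim (0 : Fin 0 → ℂ) x]
    exact congrArg Prod.snd h2
  have : NeZero n := ⟨hn.ne'⟩
  obtain ⟨ρ₁, hρ₁, hloc⟩ := Metric.eventually_nhds_iff.1 hg.eventually_analyticAt
  set ρ := ρ₁ / 2 with hρ
  have hρ0 : 0 < ρ := by positivity
  have hloc' : ∀ x t, ‖x‖ ≤ ρ → ‖t‖ < ρ → AnalyticAt ℂ g (x, t) := fun x t hx ht => hloc (by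
    rw [dist_zero_right, Prod.norm_def]
    exact max_lt (by linarith) (by linarith))
  obtain ⟨δ, hδ, hδρ, r, hr, hrδ, N, hN, hmain⟩ := exists_bound_of_generic (hNZ (Deform n T))
      (f := fun q => (deform g q).1) (h := fun q => (deform g q).2)
      (AnalyticAt.fun_comp (g := Prod.fst) analyticAt_fst (analyticAt_deform hg))
      (AnalyticAt.fun_comp (g := Prod.snd) analyticAt_snd (analyticAt_deform hg))
      (by simpa [deform, mixing_snd, shear_apply] using h0) (half_pos hρ0)
  refine ⟨r / 2, half_pos hr, N, fun t ht S hS => ?_⟩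
  have htr : ‖t‖ < r := by linarith
  set G : (Fin n → ℂ) × ℂ → (Fin n → ℂ) × ℂ := fun x => g (x, t) with hG
  have hGa : ∀ x ∈ Metric.closedBall (0 : (Fin n → ℂ) × ℂ) ρ, AnalyticAt ℂ G x := fun x hx =>
    AnalyticAt.fun_comp (g := g) (hloc' x t (by simpa using hx) (by linarith))
      (analyticAt_id.prod analyticAt_const)
  obtain ⟨y, hy, hreg, hZ, S', hcard, hS'⟩ := exists_regular_perturbation hr
    (by linarith : r / 2 ≤ ρ) hGa hS
  rw [← hcard]
  set Z := {x ∈ Metric.closedBall (0 : (Fin n → ℂ) × ℂ) ρ | G x = y} with hZdef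
  have hS'Z : ∀ p ∈ S', p ∈ Z := fun p hp => ⟨by
    have := (hS' p hp).1
    simp only [Metric.mem_closedBall, dist_zero_right]; linarith, (hS' p hp).2⟩
  obtain ⟨c, hc, hsep⟩ := exists_shear_separating hZ (lt_min hr one_pos)
  have hcr : ‖c‖ < r := hc.trans_le (min_le_left _ _)
  have hc1 : ‖c‖ ≤ 1 := hc.le.trans (min_le_right _ _)
  obtain ⟨b, hb, hbS⟩ := exists_mixing_row (Ω := (fun p => fderiv ℂ G p (c, 1)) '' S')
    (S'.finite_toSet.image _) (by
      rintro _ ⟨p, hp, rfl⟩ h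
      have := hreg p (hS'Z p hp).1 (hS'Z p hp).2 (h.trans (map_zero _).symm)
      simpa using congrArg Prod.snd this) hr
  set S'' := S'.image (shear (-c)) with hS''
  have hcard' : S''.card = S'.card := Finset.card_image_of_injective _ (shear_injective _)
  have hmem : ∀ p'' ∈ S'', ‖p''‖ < r ∧ shear c p'' ∈ S' := by
    intro p'' hp''
    obtain ⟨p, hp, rfl⟩ := Finset.mem_image.1 hp''
    rw [shear_shear_neg]
    refine ⟨?_, hp⟩
    have h1 := (hS' p hp).1
    have h2 := (norm_fst_le p).trans_lt h1
    have h3 := (norm_snd_le p).trans_lt h1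
    rw [shear_apply, Prod.norm_def]
    refine max_lt ?_ (by simpa using by linarith)
    refine (norm_add_le _ _).trans_lt ?_
    rw [norm_smul, norm_neg]
    have : ‖p.2‖ * ‖c‖ ≤ ‖p.2‖ := mul_le_of_le_one_right (norm_nonneg _) hc1
    linarith
  let θ : (Fin n → Fin n → ℂ) → Deform n T := fun A => (t, (y, (c, (b, A))))
  have hθ : ∀ A, ‖A‖ < r → ‖θ A‖ < r := fun A hA => norm_deform_lt htr hy hcr hb hA
  have hsnd : ∀ A x, (deform g (x, θ A)).2 = (deform g (x, θ 0)).2 := fun A x => by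
    simp only [deform, θ, mixing_snd]
  let Q : Set ((Fin n → ℂ) × ℂ) := ⋃ p ∈ S'', (fun z => (p.1, z)) ''
    {z | (‖z‖ < δ ∧ (deform g ((p.1, z), θ 0)).2 = 0) ∧ z ≠ p.2}
  have hQ : Q.Finite := by
    refine S''.finite_toSet.biUnion fun p hp => Set.Finite.image _ ?_
    refine ((hN p.1 (θ 0) ((norm_fst_le p).trans_lt (hmem p hp).1) (hθ 0 (by simpa))).1).subset ?_
    exact fun z hz => hz.1
  obtain ⟨A, hA, hAQ⟩ := exists_mixing_matrix (Q := (fun q => (G (shear c q) - y).1) '' Q)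
    (hQ.image _) (by
      rintro _ ⟨q, hq, rfl⟩ h
      simp only [Q, Set.mem_iUnion] at hq
      obtain ⟨p, hp, ζ, ⟨⟨hζδ, hζ0⟩, hζp⟩, rfl⟩ := hq
      have h' : ∀ l, (G (shear c (p.1, ζ)) - y).1 l = 0 := fun l => congrFun h l
      have hval : deform g ((p.1, ζ), θ 0) = mixing b 0 (G (shear c (p.1, ζ)) - y) := rfl
      rw [hval, mixing_snd] at hζ0
      simp only [h', mul_zero, Finset.sum_const_zero, add_zero] at hζ0
      have hGy : G (shear c (p.1, ζ)) = y := sub_eq_zero.1 (Prod.ext h hζ0)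
      have hqZ : shear c (p.1, ζ) ∈ Z := by
        refine ⟨?_, hGy⟩
        have h1 := (norm_fst_le p).trans_lt (hmem p hp).1
        simp only [Metric.mem_closedBall, dist_zero_right, shear_apply, Prod.norm_def]
        refine max_le ((norm_add_le _ _).trans ?_) (by linarith)
        rw [norm_smul]
        have : ‖ζ‖ * ‖c‖ ≤ ‖ζ‖ := mul_le_of_le_one_right (norm_nonneg _) hc1
        linarith
      refine hsep _ (hS'Z _ (hmem p hp).2) _ hqZ ?_ ?_
      · intro h
        exact hζp (congrArg Prod.snd h).symm
      · simp only [shear_apply]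
        rw [add_sub_add_left_eq_sub, sub_smul])
    (lt_min hr (by positivity : (0 : ℝ) < ((n : ℝ) + 1)⁻¹))
  have hAr : ‖A‖ < r := hA.trans_le (min_le_left _ _)
  rw [← hcard']
  refine hmain (θ A) (hθ A hAr) S'' ?_ ?_
  · intro p hp q hq hpq
    by_contra hne
    refine hsep _ (hS'Z _ (hmem p hp).2) _ (hS'Z _ (hmem q hq).2)
      (fun h => hne (shear_injective c h)) ?_
    simp only [shear_apply]
    rw [hpq, add_sub_add_left_eq_sub, sub_smul]
  · intro p hp
    obtain ⟨hpr, hpS⟩ := hmem p hp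
    have hpZ := hS'Z _ hpS
    have hval : deform g (p, θ A) = 0 := by
      change mixing b A (G (shear c p) - y) = 0
      rw [hpZ.2, sub_self, map_zero]
    have hD : HasFDerivAt (fun q => deform g (q, θ A))
        ((mixing b A).comp ((fderiv ℂ G (shear c p)).comp (shear c))) p := by
      have h1 : HasFDerivAt (fun q => G (shear c q) - y)
          ((fderiv ℂ G (shear c p)).comp (shear c)) p :=
        (HasFDerivAt.comp p (hGa _ hpZ.1).differentiableAt.hasFDerivAt
          (shear c).hasFDerivAt).sub_const y
      exact (mixing b A).hasFDerivAt.comp p h1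
    refine ⟨hpr, congrArg Prod.fst hval, congrArg Prod.snd hval, ?_, ?_, ?_⟩
    · have : (fun q => ((deform g (q, θ A)).1, (deform g (q, θ A)).2)) =
          fun q => deform g (q, θ A) := rfl
      rw [this, hD.fderiv]
      exact (mixing_injective b (hA.trans_le (min_le_right _ _))).comp
        ((hreg _ hpZ.1 hpZ.2).comp (shear_injective c))
    · have h1 : HasFDerivAt (fun q => (deform g (q, θ A)).2) _ p := hD.snd
      rw [h1.fderiv]
      change (mixing b A (fderiv ℂ G (shear c p) (shear c (0, 1)))).2 ≠ 0
      rw [mixing_snd]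
      have : shear c (0, 1) = (c, 1) := by simp [shear_apply]
      rw [this]
      exact hbS _ ⟨_, hpS, rfl⟩
    · intro ζ hζ hne hζ0 k
      change (mixing b A (G (shear c (p.1, ζ)) - y)).1 k ≠ 0
      rw [mixing_fst]
      refine hAQ _ ⟨(p.1, ζ), ?_, rfl⟩ k
      simp only [Q, Set.mem_iUnion]
      refine ⟨p, hp, ζ, ⟨⟨hζ, ?_⟩, hne⟩, rfl⟩
      rwa [hsnd A] at hζ0

end

section

theorem HasBoundedZeros.of_equiv {X X' T Y Y' : Type} [NormedAddCommGroup X] [NormedSpace ℂ X]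
    [NormedAddCommGroup X'] [NormedSpace ℂ X'] [NormedAddCommGroup T]
    [NormedAddCommGroup Y] [NormedSpace ℂ Y] [NormedAddCommGroup Y'] [NormedSpace ℂ Y']
    {g : X × T → Y} (A : X' ≃L[ℂ] X) (B : Y ≃L[ℂ] Y')
    (h : HasBoundedZeros fun q : X' × T => B (g (A q.1, q.2))) : HasBoundedZeros g := by
  classical
  obtain ⟨r, hr, N, hN⟩ := h
  have hA : ∀ᶠ x in 𝓝 (0 : X), ‖A.symm x‖ < r := by
    have : Tendsto (fun x => ‖A.symm x‖) (𝓝 0) (𝓝 0) :=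
      (A.symm.continuous.norm).tendsto' _ _ (by simp)
    exact this.eventually_lt_const hr
  obtain ⟨r', hr', hA⟩ := Metric.eventually_nhds_iff.1 hA
  refine ⟨min r r', lt_min hr hr', N, fun t ht S hS => ?_⟩
  rw [← Finset.card_image_of_injective S A.symm.injective]
  refine hN t (ht.trans_le (min_le_left _ _)) _ fun x' hx' => ?_
  obtain ⟨x, hx, rfl⟩ := Finset.mem_image.1 hx'
  obtain ⟨h1, h2, h3⟩ := hS x hx
  refine ⟨hA (by simpa using h1.trans_le (min_le_right _ _)), by simp [h2], ?_⟩
  have : (fun y => B (g (A y, t))) = B ∘ (fun y => g (y, t)) ∘ A := rfl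
  simp only [this]
  rw [B.comp_fderiv, A.comp_right_fderiv, A.apply_symm_apply]
  exact B.injective.comp (h3.comp A.injective)

variable {n : ℕ}

theorem hasBoundedZeros_of_not_eventually_zero
    (hNZ : ∀ (T : Type) [NormedAddCommGroup T] [NormedSpace ℂ T] [FiniteDimensional ℂ T]
      (g : (Fin n → ℂ) × T → Fin n → ℂ), AnalyticAt ℂ g 0 → HasBoundedZeros g)
    {T : Type} [NormedAddCommGroup T] [NormedSpace ℂ T] [FiniteDimensional ℂ T]
    {g : ((Fin n → ℂ) × ℂ) × T → (Fin n → ℂ) × ℂ} (hg : AnalyticAt ℂ g 0)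
    (h0 : ¬ ∀ᶠ x in 𝓝 0, (g (x, 0)).2 = 0) : HasBoundedZeros g := by
  by_cases h1 : (g 0).2 = 0
  swap
  · have h2 : ∀ᶠ q in 𝓝 0, (g q).2 ≠ 0 := (hg.continuousAt.snd).eventually_ne h1
    obtain ⟨r, hr, h2⟩ := Metric.eventually_nhds_iff.1 h2
    refine ⟨r, hr, 0, fun t ht S hS => ?_⟩
    rw [Nat.le_zero, Finset.card_eq_zero, Finset.eq_empty_iff_forall_notMem]
    intro x hx
    obtain ⟨hx1, hx2, -⟩ := hS x hx
    refine h2 (y := (x, t)) ?_ (congrArg Prod.snd hx2)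
    rw [dist_zero_right, Prod.norm_def]
    exact max_lt hx1 ht
  obtain ⟨ρ, hρ, hloc⟩ := Metric.eventually_nhds_iff.1 hg.eventually_analyticAt
  have hfreq : ∃ᶠ x in 𝓝 (0 : (Fin n → ℂ) × ℂ), (g (x, 0)).2 ≠ 0 :=
    Filter.not_eventually.1 h0
  obtain ⟨x₀, hx₀, hx₀ρ⟩ := (hfreq.and_eventually
    (Metric.eventually_nhds_iff.2 ⟨ρ / 2, half_pos hρ, fun y hy => hy⟩)).exists
  rw [dist_zero_right] at hx₀ρ
  have hx₀0 : x₀ ≠ 0 := by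
    rintro rfl
    exact hx₀ h1
  obtain ⟨A, hA⟩ := SeparatingDual.exists_continuousLinearEquiv_apply_eq (R := ℂ)
    (x := ((0, 1) : (Fin n → ℂ) × ℂ)) (y := x₀) (by simp) hx₀0
  refine HasBoundedZeros.of_equiv A (ContinuousLinearEquiv.refl ℂ _) ?_
  have hgA : AnalyticAt ℂ (fun q : ((Fin n → ℂ) × ℂ) × T => g (A q.1, q.2)) 0 := by
    refine AnalyticAt.fun_comp (g := g) (f := fun q : ((Fin n → ℂ) × ℂ) × T => (A q.1, q.2)) ?_
      (analyticAt_of_contDiff (by fun_prop) _)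
    have : ((A (0 : ((Fin n → ℂ) × ℂ) × T).1, (0 : ((Fin n → ℂ) × ℂ) × T).2)) =
      (0 : ((Fin n → ℂ) × ℂ) × T) := by simp
    rw [this]
    exact hg
  refine hasBoundedZeros_of_ne_zero hNZ (g := fun q => g (A q.1, q.2)) hgA ?_
  · intro hev
    have hAz : ∀ z : ℂ, A (0, z) = z • x₀ := fun z => by
      rw [← hA, ← map_smul]; simp
    have hk : AnalyticOnNhd ℂ (fun z : ℂ => (g (z • x₀, 0)).2) (Metric.ball 0 2) := by
      intro z hz
      have hgz : AnalyticAt ℂ g (z • x₀, 0) := hloc (by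
        rw [dist_zero_right, Prod.norm_def, norm_zero, norm_smul]
        have : ‖z‖ < 2 := by simpa using hz
        refine max_lt ?_ hρ
        nlinarith [norm_nonneg z, norm_nonneg x₀])
      exact AnalyticAt.fun_comp (g := Prod.snd) analyticAt_snd
        (AnalyticAt.fun_comp (g := g) (f := fun z : ℂ => (z • x₀, 0)) hgz
          (analyticAt_of_contDiff (by fun_prop) _))
    have := hk.eqOn_zero_of_preconnected_of_eventuallyEq_zero
      (convex_ball (0 : ℂ) 2).isPreconnected (z₀ := 0) (by simp) (by
        filter_upwards [hev] with z hz
        rw [← hAz]; exact hz)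
    refine hx₀ ?_
    simpa using this (x := 1) (by simp)

theorem hasBoundedZeros_prod
    (hNZ : ∀ (T : Type) [NormedAddCommGroup T] [NormedSpace ℂ T] [FiniteDimensional ℂ T]
      (g : (Fin n → ℂ) × T → Fin n → ℂ), AnalyticAt ℂ g 0 → HasBoundedZeros g)
    {T : Type} [NormedAddCommGroup T] [NormedSpace ℂ T] [FiniteDimensional ℂ T]
    {g : ((Fin n → ℂ) × ℂ) × T → (Fin n → ℂ) × ℂ} (hg : AnalyticAt ℂ g 0) :
    HasBoundedZeros g := by
  obtain ⟨ι, _, a, H, ha, hH, hrep, hindep⟩ := exists_bautin (h := fun q => (g q).2)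
    (AnalyticAt.fun_comp (g := Prod.snd) analyticAt_snd hg)
  let K : (ι → ℂ) → ((Fin n → ℂ) × ℂ) × T → (Fin n → ℂ) × ℂ := fun s q =>
    ((g q).1, ∑ i, s i * H i q)
  have hcover : ∃ r : ℝ, 0 < r ∧ ∃ N : ℕ, ∀ s ∈ Metric.sphere (0 : ι → ℂ) 1, ∀ t, ‖t‖ < r →
      ∀ S : Finset ((Fin n → ℂ) × ℂ), (∀ x ∈ S, ‖x‖ < r ∧ K s (x, t) = 0 ∧
        Function.Injective (fderiv ℂ (fun y => K s (y, t)) x)) → S.card ≤ N := by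
    refine (isCompact_sphere (0 : ι → ℂ) 1).induction_on (p := fun V => ∃ r : ℝ, 0 < r ∧ ∃ N : ℕ,
      ∀ s ∈ V, ∀ t, ‖t‖ < r → ∀ S : Finset ((Fin n → ℂ) × ℂ), (∀ x ∈ S, ‖x‖ < r ∧
        K s (x, t) = 0 ∧ Function.Injective (fderiv ℂ (fun y => K s (y, t)) x)) → S.card ≤ N)
      ⟨1, one_pos, 0, by simp⟩ ?_ ?_ ?_
    · rintro V W hVW ⟨r, hr, N, h⟩
      exact ⟨r, hr, N, fun s hs => h s (hVW hs)⟩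
    · rintro V W ⟨r, hr, N, h⟩ ⟨r', hr', N', h'⟩
      refine ⟨min r r', lt_min hr hr', max N N', fun s hs t ht S hS => ?_⟩
      rcases hs with hs | hs
      · exact (h s hs t (ht.trans_le (min_le_left _ _)) S fun x hx =>
          ⟨(hS x hx).1.trans_le (min_le_left _ _), (hS x hx).2⟩).trans (le_max_left _ _)
      · exact (h' s hs t (ht.trans_le (min_le_right _ _)) S fun x hx =>
          ⟨(hS x hx).1.trans_le (min_le_right _ _), (hS x hx).2⟩).trans (le_max_right _ _)
    · intro s hs
      have hs0 : s ≠ 0 := by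
        rintro rfl
        simp at hs
      have hm : AnalyticAt ℂ (fun q : ((Fin n → ℂ) × ℂ) × (T × (ι → ℂ)) => (q.1, q.2.1)) 0 :=
        analyticAt_of_contDiff (by fun_prop) _
      obtain ⟨r, hr, N, h⟩ := hasBoundedZeros_of_not_eventually_zero hNZ (T := T × (ι → ℂ))
        (g := fun q => K (s + q.2.2) (q.1, q.2.1)) (by
          refine AnalyticAt.prod ?_ (Finset.analyticAt_fun_sum _ fun i _ => ?_)
          · exact AnalyticAt.fun_comp (g := Prod.fst) analyticAt_fst
              (AnalyticAt.fun_comp (g := g) hg hm)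
          · exact (analyticAt_of_contDiff (by fun_prop) _).fun_mul
              (AnalyticAt.fun_comp (g := H i) (hH i) hm))
        (by simpa [K] using hindep s hs0)
      refine ⟨Metric.ball s r, mem_nhdsWithin_of_mem_nhds (Metric.ball_mem_nhds s hr), r, hr, N,
        fun s' hs' t ht S hS => h (t, s' - s) ?_ S ?_⟩
      · rw [Prod.norm_def]
        exact max_lt ht (by simpa [dist_eq_norm] using hs')
      · simpa using hS
  obtain ⟨r, hr, N, hN⟩ := hcover
  obtain ⟨ρ, hρ, hloc⟩ := Metric.eventually_nhds_iff.1
    (hrep.eventually_nhds.and hg.eventually_analyticAt)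
  refine ⟨min r ρ, lt_min hr hρ, N, fun t ht S hS => ?_⟩
  have hloc' : ∀ x ∈ S, (∀ᶠ y in 𝓝 x, (g (y, t)).2 = ∑ i, a i t * H i (y, t)) ∧
      DifferentiableAt ℂ (fun y => g (y, t)) x := by
    intro x hx
    obtain ⟨h1, h2⟩ := hloc (y := (x, t)) (by
      rw [dist_zero_right, Prod.norm_def]
      exact max_lt ((hS x hx).1.trans_le (min_le_right _ _)) (ht.trans_le (min_le_right _ _)))
    have hc : Continuous fun y : (Fin n → ℂ) × ℂ => (y, t) := by fun_prop
    exact ⟨(hc.tendsto x).eventually h1,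
      DifferentiableAt.comp (g := g) x h2.differentiableAt (by fun_prop)⟩
  by_cases ha0 : (fun i => a i t) = 0
  · suffices S = ∅ by simp [this]
    rw [Finset.eq_empty_iff_forall_notMem]
    intro x hx
    obtain ⟨h1, h2⟩ := hloc' x hx
    have ha0' : ∀ i, a i t = 0 := fun i => congrFun ha0 i
    have h3 : HasFDerivAt (fun y => (g (y, t)).2) (0 : _ →L[ℂ] ℂ) x := by
      refine (hasFDerivAt_const (0 : ℂ) x).congr_of_eventuallyEq ?_
      filter_upwards [h1] with y hy
      simp [hy, ha0']
    have h4 := h2.hasFDerivAt.snd.unique h3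
    obtain ⟨v, hv⟩ := LinearMap.injective_iff_surjective
      (f := (fderiv ℂ (fun y => g (y, t)) x : (Fin n → ℂ) × ℂ →ₗ[ℂ] (Fin n → ℂ) × ℂ)) |>.1
      (hS x hx).2.2 (0, 1)
    have h5 := congrArg (fun φ : (Fin n → ℂ) × ℂ →L[ℂ] ℂ => φ v) h4
    have h6 : (1 : ℂ) = 0 := (congrArg Prod.snd hv).symm.trans h5
    exact one_ne_zero h6
  · have hna : ‖fun i => a i t‖ ≠ 0 := norm_ne_zero_iff.2 ha0
    refine hN ((‖fun i => a i t‖ : ℂ)⁻¹ • fun i => a i t) ?_ t (ht.trans_le (min_le_left _ _)) S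
      fun x hx => ?_
    · simp [norm_smul, hna]
    · obtain ⟨h1, h2⟩ := hloc' x hx
      obtain ⟨h3, h4, h5⟩ := hS x hx
      have hKg : ∀ y, (g (y, t)).2 = ∑ i, a i t * H i (y, t) →
          K ((‖fun i => a i t‖ : ℂ)⁻¹ • fun i => a i t) (y, t) =
            ((g (y, t)).1, (‖fun i => a i t‖ : ℂ)⁻¹ * (g (y, t)).2) := by
        intro y hy
        simp [K, hy, Finset.mul_sum, mul_assoc]
      refine ⟨h3.trans_le (min_le_left _ _), ?_, ?_⟩
      · rw [hKg x h1.self_of_nhds, h4]; simp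
      · have h6 := (h2.hasFDerivAt.fst.prodMk
          (h2.hasFDerivAt.snd.const_mul ((‖fun i => a i t‖ : ℂ)⁻¹))).congr_of_eventuallyEq
            (h1.mono hKg)
        rw [h6.fderiv]
        rw [injective_iff_map_eq_zero]
        intro v hv
        have h7 : (fderiv ℂ (fun y => g (y, t)) x v).1 = 0 := congrArg Prod.fst hv
        have h8 : (‖fun i => a i t‖ : ℂ)⁻¹ * (fderiv ℂ (fun y => g (y, t)) x v).2 = 0 :=
          congrArg Prod.snd hv
        have h9 : (fderiv ℂ (fun y => g (y, t)) x v).2 = 0 := by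
          refine (mul_eq_zero.1 h8).resolve_left (inv_ne_zero ?_)
          exact_mod_cast hna
        exact h5 ((Prod.ext h7 h9 : fderiv ℂ (fun y => g (y, t)) x v = 0).trans (map_zero _).symm)

/-- Analytic families of equidimensional maps have boundedly many nondegenerate zeros locally. -/
theorem hasBoundedZeros (n : ℕ) : ∀ (T : Type) [NormedAddCommGroup T] [NormedSpace ℂ T]
    [FiniteDimensional ℂ T] (g : (Fin n → ℂ) × T → Fin n → ℂ), AnalyticAt ℂ g 0 →
      HasBoundedZeros g := by
  induction n with
  | zero =>
    intro T _ _ _ g _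
    exact ⟨1, one_pos, 1, fun t _ S _ => Finset.card_le_one_of_subsingleton S⟩
  | succ n ih =>
    intro T _ _ _ g hg
    have e : ((Fin n → ℂ) × ℂ) ≃L[ℂ] (Fin (n + 1) → ℂ) :=
      ContinuousLinearEquiv.ofFinrankEq (by simp)
    refine HasBoundedZeros.of_equiv e e.symm (hasBoundedZeros_prod ih ?_)
    have h1 : AnalyticAt ℂ (fun q : ((Fin n → ℂ) × ℂ) × T => g (e q.1, q.2)) 0 := by
      refine AnalyticAt.fun_comp (g := g) (f := fun q : ((Fin n → ℂ) × ℂ) × T => (e q.1, q.2)) ?_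
        (analyticAt_of_contDiff (by fun_prop) _)
      have : ((e (0 : ((Fin n → ℂ) × ℂ) × T).1, (0 : ((Fin n → ℂ) × ℂ) × T).2)) =
        (0 : (Fin (n + 1) → ℂ) × T) := by simp
      exact this ▸ hg
    exact AnalyticAt.fun_comp (g := e.symm) (e.symm.toContinuousLinearMap.analyticAt _) h1

end

section

variable {d : ℕ}

/-- Area inequality for maps with fibres of bounded cardinality. -/
theorem lintegral_abs_det_fderiv_le_mul {s B : Set (Fin d → ℝ)} {f : (Fin d → ℝ) → Fin d → ℝ}
    {f' : (Fin d → ℝ) → (Fin d → ℝ) →L[ℝ] Fin d → ℝ} (hs : MeasurableSet s)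
    (hf' : ∀ x ∈ s, HasFDerivWithinAt f (f' x) s x) (hdet : ∀ x ∈ s, (f' x).det ≠ 0) {N : ℕ}
    (hN : ∀ y, ∀ S : Finset (Fin d → ℝ), (∀ x ∈ S, x ∈ s ∧ f x = y) → S.card ≤ N)
    (hB : MeasurableSet B) (hfB : Set.MapsTo f s B) :
    ∫⁻ x in s, ENNReal.ofReal |(f' x).det| ≤ N * volume B := by
  classical
  rcases s.eq_empty_or_nonempty with rfl | hsne
  · simp
  have hr : ∀ A : (Fin d → ℝ) →L[ℝ] Fin d → ℝ, ∃ r : ℝ≥0, r ≠ 0 ∧ (A.det ≠ 0 →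
      ∀ t, ApproximatesLinearOn f A t r → Set.InjOn f t) := by
    intro A
    by_cases hA : A.det = 0
    · exact ⟨1, one_ne_zero, fun h => absurd hA h⟩
    let e := A.toContinuousLinearEquivOfDetNeZero hA
    have he : (e : (Fin d → ℝ) →L[ℝ] Fin d → ℝ) = A :=
      A.coe_toContinuousLinearEquivOfDetNeZero hA
    rcases e.subsingleton_or_nnnorm_symm_pos with h | h
    · exact ⟨1, one_ne_zero, fun _ t _ => fun x _ y _ _ => Subsingleton.elim _ _⟩
    · have h' : 0 < ‖(e.symm : (Fin d → ℝ) →L[ℝ] Fin d → ℝ)‖₊⁻¹ := inv_pos.2 h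
      refine ⟨‖(e.symm : (Fin d → ℝ) →L[ℝ] Fin d → ℝ)‖₊⁻¹ / 2, (half_pos h').ne', fun _ t ht => ?_⟩
      rw [← he] at ht
      exact ht.injOn (Or.inr (half_lt_self h'))
  choose r hr0 hr using hr
  obtain ⟨t, A, htd, htm, hst, hta, hA⟩ :=
    exists_partition_approximatesLinearOn_of_hasFDerivWithinAt f s f' hf' r hr0
  have hinj : ∀ n, Set.InjOn f (s ∩ t n) := by
    intro n
    obtain ⟨y, hy, hAy⟩ := hA hsne n
    exact hr (A n) (hAy ▸ hdet y hy) _ (hta n)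
  have hm : ∀ n, MeasurableSet (s ∩ t n) := fun n => hs.inter (htm n)
  have hd' : ∀ n, ∀ x ∈ s ∩ t n, HasFDerivWithinAt f (f' x) (s ∩ t n) x := fun n x hx =>
    (hf' x hx.1).mono Set.inter_subset_left
  have hmi : ∀ n, MeasurableSet (f '' (s ∩ t n)) := fun n =>
    measurable_image_of_fderivWithin (hm n) (hd' n) (hinj n)
  have hunion : s = ⋃ n, s ∩ t n := by
    rw [← Set.inter_iUnion, Set.inter_eq_left.2 hst]
  calc ∫⁻ x in s, ENNReal.ofReal |(f' x).det|
      = ∫⁻ x in ⋃ n, s ∩ t n, ENNReal.ofReal |(f' x).det| := by rw [← hunion]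
    _ = ∑' n, ∫⁻ x in s ∩ t n, ENNReal.ofReal |(f' x).det| :=
        lintegral_iUnion hm (fun i j hij => (htd hij).mono Set.inter_subset_right
          Set.inter_subset_right) _
    _ = ∑' n, volume (f '' (s ∩ t n)) := by
        congr with n
        exact lintegral_abs_det_fderiv_eq_addHaar_image volume (hm n) (hd' n) (hinj n)
    _ = ∑' n, ∫⁻ y, (f '' (s ∩ t n)).indicator 1 y := by
        congr with n
        rw [lintegral_indicator_one (hmi n)]
    _ = ∫⁻ y, ∑' n, (f '' (s ∩ t n)).indicator 1 y :=
        (lintegral_tsum fun n => (measurable_one.indicator (hmi n)).aemeasurable).symm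
    _ ≤ ∫⁻ y, N * B.indicator 1 y := by
        refine lintegral_mono fun y => ?_
        rw [ENNReal.tsum_eq_iSup_sum]
        refine iSup_le fun J => ?_
        by_cases hy : y ∈ B
        · rw [Set.indicator_of_mem hy, Pi.one_apply, mul_one]
          have h1 : ∑ n ∈ J, (f '' (s ∩ t n)).indicator (1 : (Fin d → ℝ) → ℝ≥0∞) y =
              ((J.filter fun n => y ∈ f '' (s ∩ t n)).card : ℝ≥0∞) := by
            simp [Set.indicator_apply]
          rw [h1, Nat.cast_le]
          have h2 : ∀ n, ∃ x, y ∈ f '' (s ∩ t n) → x ∈ s ∩ t n ∧ f x = y := by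
            intro n
            by_cases hn : y ∈ f '' (s ∩ t n)
            · obtain ⟨x, hx, hxy⟩ := hn
              exact ⟨x, fun _ => ⟨hx, hxy⟩⟩
            · exact ⟨0, fun h => absurd h hn⟩
          choose x hx using h2
          rw [← Finset.card_image_of_injOn (f := x)]
          · refine hN y _ fun z hz => ?_
            obtain ⟨n, hn, rfl⟩ := Finset.mem_image.1 hz
            have := hx n (Finset.mem_filter.1 hn).2
            exact ⟨this.1.1, this.2⟩
          · intro m hm' n hn' hmn
            by_contra hne
            have h3 := (hx m (Finset.mem_filter.1 hm').2).1.2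
            have h4 := (hx n (Finset.mem_filter.1 hn').2).1.2
            exact Set.disjoint_left.1 (htd hne) h3 (hmn ▸ h4)
        · rw [Finset.sum_eq_zero]
          · exact zero_le
          · intro n _
            refine Set.indicator_of_notMem ?_ _
            rintro ⟨x, hx, rfl⟩
            exact hy (hfB hx.1)
    _ = N * volume B := by
        rw [lintegral_const_mul _ (measurable_one.indicator hB), lintegral_indicator_one hB]

end

section

variable {d : ℕ}

/-- The inclusion of `ℝ^d` into `ℂ^d`. -/
noncomputable def ofRealPi (d : ℕ) : (Fin d → ℝ) →L[ℝ] Fin d → ℂ :=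
  ContinuousLinearMap.pi fun i => Complex.ofRealCLM.comp (ContinuousLinearMap.proj i)

theorem ofRealPi_apply (x : Fin d → ℝ) (i : Fin d) : ofRealPi d x i = x i := rfl

theorem ofRealPi_injective : Function.Injective (ofRealPi d) := by
  intro x y h
  ext i
  exact Complex.ofReal_injective (congrFun h i)

theorem norm_ofRealPi (x : Fin d → ℝ) : ‖ofRealPi d x‖ = ‖x‖ := by
  simp [Pi.norm_def, ofRealPi_apply]

theorem injective_of_comp_ofRealPi {T : (Fin d → ℂ) →L[ℂ] Fin d → ℂ}
    {A : (Fin d → ℝ) →L[ℝ] Fin d → ℝ} (hA : Function.Injective A)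
    (h : ∀ x, T (ofRealPi d x) = ofRealPi d (A x)) : Function.Injective T := by
  rw [injective_iff_map_eq_zero]
  intro w hw
  have hdec : w = ofRealPi d (fun i => (w i).re) + Complex.I • ofRealPi d (fun i => (w i).im) := by
    ext i
    simp [ofRealPi_apply, mul_comm Complex.I]
  rw [hdec, map_add, map_smul, h, h] at hw
  have h1 : A (fun i => (w i).re) = 0 := by
    ext i
    simpa [ofRealPi_apply] using congrArg Complex.re (congrFun hw i)
  have h2 : A (fun i => (w i).im) = 0 := by
    ext i
    simpa [ofRealPi_apply] using congrArg Complex.im (congrFun hw i)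
  have h3 := (injective_iff_map_eq_zero A).1 hA _ h1
  have h4 := (injective_iff_map_eq_zero A).1 hA _ h2
  rw [hdec, h3, h4]
  simp

/-- A real-analytic map extends to a complex-analytic one near a point. -/
theorem exists_complexification {φ : (Fin d → ℝ) → Fin d → ℝ} (hφ : AnalyticAt ℝ φ 0) :
    ∃ ψ : (Fin d → ℂ) → Fin d → ℂ, AnalyticAt ℂ ψ 0 ∧
      ∀ᶠ x in 𝓝 (0 : Fin d → ℝ), ψ (ofRealPi d x) = ofRealPi d (φ x) := by
  choose c ρ hρ hs hsum using fun i => exists_coeff_of_analyticAt (analyticAt_pi_iff.1 hφ i)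
  have hmono : ∀ (x : Fin d → ℝ) γ, monoVal (ofRealPi d x) γ = ((monoVal x γ : ℝ) : ℂ) := by
    intro x γ
    simp [monoVal, ofRealPi_apply]
  refine ⟨fun z i => ∑' γ, (c i γ : ℂ) * monoVal z γ, ?_, ?_⟩
  · refine analyticAt_pi_iff.2 fun i => ?_
    have hs' : Summable fun γ => ‖(c i γ : ℂ)‖ * monoVal (fun _ => ρ i) γ := by
      simpa using hs i
    refine hasFPowerSeries_of_summable (hρ i) hs' fun z hz => ?_
    refine (Summable.of_norm_bounded hs' fun γ => ?_).hasSum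
    rw [norm_mul]
    exact mul_le_mul_of_nonneg_left (norm_monoVal_le hz γ) (norm_nonneg _)
  · have : ∀ i, ∀ᶠ x in 𝓝 (0 : Fin d → ℝ), ‖x‖ < ρ i := fun i =>
      (continuous_norm.tendsto' (0 : Fin d → ℝ) 0 norm_zero).eventually_lt_const
        (by exact_mod_cast hρ i)
    filter_upwards [eventually_all.2 this] with x hx
    ext i
    have h1 := hsum i x fun j => (norm_le_pi_norm x j).trans (hx i).le
    have h2 := Complex.hasSum_ofReal.2 h1
    rw [ofRealPi_apply, ← h2.tsum_eq]
    simp [hmono]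

/-- Local fibres of a real-analytic map have boundedly many nondegenerate points. -/
theorem exists_card_fibre_le {Φ : (Fin d → ℝ) → Fin d → ℝ} {p : Fin d → ℝ}
    (hΦ : AnalyticAt ℝ Φ p) :
    ∃ V ∈ 𝓝 p, ∃ N : ℕ, ∀ y, ∀ S : Finset (Fin d → ℝ),
      (∀ x ∈ S, x ∈ V ∧ Φ x = y ∧ (fderiv ℝ Φ x).det ≠ 0) → S.card ≤ N := by
  classical
  have hφ : AnalyticAt ℝ (fun z => Φ (p + z) - Φ p) 0 := by
    refine AnalyticAt.fun_sub ?_ analyticAt_const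
    refine AnalyticAt.fun_comp (g := Φ) (f := fun z => p + z) (by simpa using hΦ)
      (analyticAt_const.fun_add analyticAt_id)
  obtain ⟨ψ, hψ, hψφ⟩ := exists_complexification hφ
  have hg : AnalyticAt ℂ (fun q : (Fin d → ℂ) × (Fin d → ℂ) => ψ q.1 - q.2) 0 :=
    (AnalyticAt.fun_comp (g := ψ) (f := Prod.fst) hψ analyticAt_fst).fun_sub analyticAt_snd
  obtain ⟨r, hr, N, hN⟩ := hasBoundedZeros d (Fin d → ℂ) _ hg
  have hsub : Tendsto (fun x => x - p) (𝓝 p) (𝓝 0) :=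
    (continuous_id.sub continuous_const).tendsto' _ _ (sub_self p)
  have h1 : ∀ᶠ x in 𝓝 p, ‖x - p‖ < r :=
    (tendsto_zero_iff_norm_tendsto_zero.1 hsub).eventually_lt_const hr
  have h2 : ∀ᶠ x in 𝓝 p, ‖Φ x - Φ p‖ < r :=
    by
    have h := (hΦ.continuousAt.tendsto.sub_const (Φ p)).norm
    rw [sub_self, norm_zero] at h
    exact h.eventually_lt_const hr
  have h3 := hsub.eventually hψφ.eventually_nhds
  have h4 : ∀ᶠ x in 𝓝 p, AnalyticAt ℂ ψ (ofRealPi d (x - p)) := by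
    have : Tendsto (fun x => ofRealPi d (x - p)) (𝓝 p) (𝓝 0) :=
      ((ofRealPi d).continuous.tendsto' 0 0 (map_zero _)).comp hsub
    exact this.eventually hψ.eventually_analyticAt
  refine ⟨_, (h1.and (h2.and (h3.and (h4.and hΦ.eventually_analyticAt)))), N, fun y S hS => ?_⟩
  rcases S.eq_empty_or_nonempty with rfl | ⟨x₀, hx₀⟩
  · simp
  have hinj : Function.Injective fun x => ofRealPi d (x - p) := fun x x' h =>
    sub_left_injective (ofRealPi_injective h)
  rw [← Finset.card_image_of_injective S hinj]
  refine hN (ofRealPi d (y - Φ p)) ?_ _ fun z hz => ?_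
  · rw [norm_ofRealPi, ← (hS x₀ hx₀).2.1]
    exact (hS x₀ hx₀).1.2.1
  obtain ⟨x, hx, rfl⟩ := Finset.mem_image.1 hz
  obtain ⟨⟨hx1, hx2, hx3, hx4, hx5⟩, hxy, hdet⟩ := hS x hx
  refine ⟨by rwa [norm_ofRealPi], ?_, ?_⟩
  · have := hx3.self_of_nhds
    simp only [add_sub_cancel, hxy] at this
    exact sub_eq_zero.2 this
  · simp only [fderiv_sub_const]
    refine injective_of_comp_ofRealPi (A := fderiv ℝ Φ x) ?_ ?_
    · exact ((fderiv ℝ Φ x).toContinuousLinearEquivOfDetNeZero hdet).injective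
    · have h5 : HasFDerivAt (fun z => Φ (p + z) - Φ p) (fderiv ℝ Φ x) (x - p) := by
        have h6 : HasFDerivAt Φ (fderiv ℝ Φ x) (p + (x - p)) := by
          rw [add_sub_cancel]
          exact hx5.differentiableAt.hasFDerivAt
        have h7 := h6.comp (x - p) ((hasFDerivAt_id (x - p)).const_add p)
        exact h7.sub_const _
      have h6 := (ofRealPi d).hasFDerivAt.comp (x - p) h5
      have h7 := (hx4.differentiableAt.hasFDerivAt.restrictScalars ℝ).comp (x - p)
        (ofRealPi d).hasFDerivAt
      have h8 := h7.unique (h6.congr_of_eventuallyEq hx3)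
      intro v
      exact congrArg (fun B : (Fin d → ℝ) →L[ℝ] Fin d → ℂ => B v) h8

end

section

variable {d n : ℕ}

/-- Replacing the coordinates indexed by `i` with the functions `G k`. -/
noncomputable def replaceCoords (i : Fin n → Fin d) (G : Fin n → (Fin d → ℝ) → ℝ)
    (x : Fin d → ℝ) : Fin d → ℝ :=
  Function.extend i (fun k => G k x) x

variable {i : Fin n → Fin d} {G : Fin n → (Fin d → ℝ) → ℝ} {p x : Fin d → ℝ}

theorem replaceCoords_apply (hi : Function.Injective i) (k : Fin n) :
    replaceCoords i G x (i k) = G k x :=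
  hi.extend_apply _ _ k

theorem replaceCoords_apply_of_notMem {j : Fin d} (hj : j ∉ Set.range i) :
    replaceCoords i G x j = x j :=
  Function.extend_apply' _ _ _ hj

theorem analyticAt_replaceCoords (hi : Function.Injective i) (hG : ∀ k, AnalyticAt ℝ (G k) p) :
    AnalyticAt ℝ (replaceCoords i G) p := by
  refine analyticAt_pi_iff.2 fun j => ?_
  by_cases hj : j ∈ Set.range i
  · obtain ⟨k, rfl⟩ := hj
    simpa only [replaceCoords_apply hi] using hG k
  · simp only [replaceCoords_apply_of_notMem hj]
    exact (ContinuousLinearMap.proj (R := ℝ) (φ := fun _ : Fin d => ℝ) j).analyticAt p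

theorem det_fderiv_replaceCoords (hi : Function.Injective i) (hG : ∀ k, AnalyticAt ℝ (G k) x) :
    (fderiv ℝ (replaceCoords i G) x).det =
      (Matrix.of fun r k : Fin n => pderiv' (i r) (G k) x).det := by
  classical
  have hd := (analyticAt_replaceCoords hi hG).differentiableAt
  have happ : ∀ (v : Fin d → ℝ) j, fderiv ℝ (replaceCoords i G) x v j =
      fderiv ℝ (fun y => replaceCoords i G y j) x v := fun v j => by
    exact congrArg (fun B : (Fin d → ℝ) →L[ℝ] ℝ => B v)
      (hasFDerivAt_pi'.1 hd.hasFDerivAt j).fderiv.symm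
  have hin : ∀ (v : Fin d → ℝ) k, fderiv ℝ (replaceCoords i G) x v (i k) =
      fderiv ℝ (G k) x v := fun v k => by
    rw [happ]
    simp only [replaceCoords_apply hi]
  have hout : ∀ (v : Fin d → ℝ) j, j ∉ Set.range i →
      fderiv ℝ (replaceCoords i G) x v j = v j := fun v j hj => by
    rw [happ]
    simp only [replaceCoords_apply_of_notMem hj]
    exact congrArg (fun B : (Fin d → ℝ) →L[ℝ] ℝ => B v)
      (ContinuousLinearMap.proj (R := ℝ) (φ := fun _ : Fin d => ℝ) j).fderiv
  rw [ContinuousLinearMap.det, ← LinearMap.det_toMatrix',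
    Matrix.twoBlockTriangular_det _ (fun j => ∃ k, i k = j)]
  · have h1 : (Matrix.toSquareBlockProp (LinearMap.toMatrix'
        (fderiv ℝ (replaceCoords i G) x : (Fin d → ℝ) →ₗ[ℝ] Fin d → ℝ))
          (fun j => ¬∃ k, i k = j)) = 1 := by
      ext a b
      rw [Matrix.toSquareBlockProp_def, Matrix.of_apply, LinearMap.toMatrix'_apply]
      refine (hout _ _ a.2).trans ?_
      simp [Matrix.one_apply, Pi.single_apply, Subtype.ext_iff]
    let e : Fin n ≃ {j // ∃ k, i k = j} := Equiv.ofInjective i hi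
    rw [h1, Matrix.det_one, mul_one, ← Matrix.det_transpose, ← Matrix.det_submatrix_equiv_self e]
    congr 1
    ext r k
    rw [Matrix.submatrix_apply, Matrix.transpose_apply, Matrix.toSquareBlockProp_def,
      Matrix.of_apply, LinearMap.toMatrix'_apply]
    exact hin _ k
  · intro a ha b hb
    rw [LinearMap.toMatrix'_apply]
    refine (hout _ _ ha).trans ?_
    rw [Pi.single_apply, if_neg]
    rintro rfl
    exact ha hb

/-- Local sublevel estimate for the Jacobian determinant of analytic functions. -/
theorem volume_setOf_le_det (hi : Function.Injective i) (hG : ∀ k, AnalyticAt ℝ (G k) p) :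
    ∃ V ∈ 𝓝 p, ∃ C : ℝ, 0 ≤ C ∧ ∀ δ : Fin n → ℝ, (∀ k, 0 < δ k) → ∀ c : ℝ, 0 < c →
      volume {x ∈ V | (∀ k, |G k x| ≤ δ k) ∧
        c ≤ |(Matrix.of fun r k : Fin n => pderiv' (i r) (G k) x).det|} ≤
          ENNReal.ofReal (C * ((∏ k, δ k) / c)) := by
  obtain ⟨V, hV, N, hN⟩ := exists_card_fibre_le (analyticAt_replaceCoords hi hG)
  have hGe : ∀ᶠ x in 𝓝 p, ∀ k, AnalyticAt ℝ (G k) x :=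
    eventually_all.2 fun k => (hG k).eventually_analyticAt
  obtain ⟨ρ, hρ, hW⟩ := Metric.nhds_basis_closedBall.mem_iff.1
    (inter_mem (inter_mem hV hGe) (Metric.closedBall_mem_nhds p one_pos))
  refine ⟨Metric.closedBall p ρ, Metric.closedBall_mem_nhds p hρ, N * 2 ^ d, by positivity,
    fun δ hδ c hc => ?_⟩
  have hWG : ∀ x ∈ Metric.closedBall p ρ, ∀ k, AnalyticAt ℝ (G k) x := fun x hx => (hW hx).1.2
  set J : (Fin d → ℝ) → ℝ := fun x => (Matrix.of fun r k : Fin n => pderiv' (i r) (G k) x).det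
    with hJ
  set S := {x ∈ Metric.closedBall p ρ | (∀ k, |G k x| ≤ δ k) ∧ c ≤ |J x|} with hS
  have hJc : ContinuousOn J (Metric.closedBall p ρ) := by
    intro x hx
    refine ContinuousAt.continuousWithinAt ?_
    have hev : (fun x => (fderiv ℝ (replaceCoords i G) x).det) =ᶠ[𝓝 x] J := by
      filter_upwards [eventually_all.2 fun k => (hWG x hx k).eventually_analyticAt] with y hy
      exact det_fderiv_replaceCoords hi hy
    refine ContinuousAt.congr ?_ hev
    exact ContinuousLinearMap.continuous_det.continuousAt.comp
      (analyticAt_replaceCoords hi (hWG x hx)).fderiv.continuousAt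
  have hSm : MeasurableSet S := by
    have h1 : IsClosed (Metric.closedBall p ρ ∩ (fun x => |J x|) ⁻¹' Set.Ici c) :=
      hJc.abs.preimage_isClosed_of_isClosed Metric.isClosed_closedBall isClosed_Ici
    have h2 : ∀ k, IsClosed (Metric.closedBall p ρ ∩ (fun x => |G k x|) ⁻¹' Set.Iic (δ k)) :=
      fun k => ContinuousOn.preimage_isClosed_of_isClosed
        (ContinuousOn.abs fun x hx => (hWG x hx k).continuousAt.continuousWithinAt)
        Metric.isClosed_closedBall isClosed_Iic
    have h3 : S = (Metric.closedBall p ρ ∩ (fun x => |J x|) ⁻¹' Set.Ici c) ∩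
        ⋂ k, {x | x ∈ Metric.closedBall p ρ → x ∈ Metric.closedBall p ρ ∩
          (fun x => |G k x|) ⁻¹' Set.Iic (δ k)} := by
      ext x
      simp only [hS, Set.mem_ofPred_eq, Set.mem_inter_iff, Set.mem_preimage, Set.mem_Ici,
        Set.mem_iInter, Set.mem_Iic]
      exact ⟨fun h => ⟨⟨h.1, h.2.2⟩, fun k _ => ⟨h.1, h.2.1 k⟩⟩,
        fun h => ⟨h.1.1, fun k => (h.2 k h.1.1).2, h.1.2⟩⟩
    rw [h3]
    refine h1.measurableSet.inter (MeasurableSet.iInter fun k => ?_)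
    exact (Metric.isClosed_closedBall.measurableSet.imp (h2 k).measurableSet)
  have hdet : ∀ x ∈ S, (fderiv ℝ (replaceCoords i G) x).det = J x := fun x hx =>
    det_fderiv_replaceCoords hi (hWG x hx.1)
  have hmain := lintegral_abs_det_fderiv_le_mul (s := S) (f := replaceCoords i G)
    (f' := fderiv ℝ (replaceCoords i G)) (N := N)
    (B := Set.Icc (Function.extend i (fun k => -δ k) (fun j => p j - 1))
      (Function.extend i δ (fun j => p j + 1))) hSm
    (fun x hx => (analyticAt_replaceCoords hi
      (hWG x hx.1)).differentiableAt.hasFDerivAt.hasFDerivWithinAt)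
    (fun x hx h0 => by
      have := hx.2.2
      rw [← hdet x hx, h0, abs_zero] at this
      exact this.not_gt hc)
    (fun y T hT => hN y T fun x hx => ⟨(hW (hT x hx).1.1).1.1, (hT x hx).2, fun h0 => by
      have := (hT x hx).1.2.2
      rw [← hdet x (hT x hx).1, h0, abs_zero] at this
      exact this.not_gt hc⟩)
    measurableSet_Icc
    (fun x hx => by
      have h1 : ∀ j, |x j - p j| ≤ 1 := fun j => by
        have h2 : dist x p ≤ 1 := (hW hx.1).2
        exact (dist_le_pi_dist x p j).trans h2
      refine Set.mem_Icc.2 ⟨fun j => ?_, fun j => ?_⟩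
      all_goals
        by_cases hj : j ∈ Set.range i
        · obtain ⟨k, rfl⟩ := hj
          rw [replaceCoords_apply hi, hi.extend_apply]
          have := abs_le.1 (hx.2.1 k)
          first | exact this.1 | exact this.2
        · rw [replaceCoords_apply_of_notMem hj, Function.extend_apply' _ _ _ hj]
          have := abs_le.1 (h1 j)
          linarith [this.1, this.2])
  have hvol : volume (Set.Icc (Function.extend i (fun k => -δ k) (fun j => p j - 1))
      (Function.extend i δ (fun j => p j + 1))) = ENNReal.ofReal (2 ^ d * ∏ k, δ k) := by
    rw [Real.volume_Icc_pi, ← ENNReal.ofReal_prod_of_nonneg]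
    · congr 1
      have h1 : ∀ j, Function.extend i δ (fun j => p j + 1) j -
          Function.extend i (fun k => -δ k) (fun j => p j - 1) j =
            2 * Function.extend i δ 1 j := by
        intro j
        by_cases hj : j ∈ Set.range i
        · obtain ⟨k, rfl⟩ := hj
          simp only [hi.extend_apply]
          ring
        · simp only [Function.extend_apply' _ _ _ hj, Pi.one_apply]
          ring
      simp only [h1, Finset.prod_mul_distrib, Finset.prod_const, Finset.card_univ,
        Fintype.card_fin]
      congr 1
      exact (Fintype.prod_of_injective i hi δ (Function.extend i δ 1)
        (fun j hj => Function.extend_apply' _ _ _ hj) fun k => (hi.extend_apply _ _ k).symm).symm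
    · intro j _
      by_cases hj : j ∈ Set.range i
      · obtain ⟨k, rfl⟩ := hj
        simp only [hi.extend_apply]
        linarith [hδ k]
      · simp only [Function.extend_apply' _ _ _ hj]
        linarith
  have hlow : ENNReal.ofReal c * volume S ≤
      ∫⁻ x in S, ENNReal.ofReal |(fderiv ℝ (replaceCoords i G) x).det| := by
    rw [← setLIntegral_const]
    refine setLIntegral_mono' hSm fun x hx => ENNReal.ofReal_le_ofReal ?_
    rw [hdet x hx]
    exact hx.2.2
  have h5 : ENNReal.ofReal (N * 2 ^ d * ((∏ k, δ k) / c)) =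
      N * ENNReal.ofReal (2 ^ d * ∏ k, δ k) / ENNReal.ofReal c := by
    rw [← ENNReal.ofReal_natCast, ← ENNReal.ofReal_mul (by positivity),
      ← ENNReal.ofReal_div_of_pos hc]
    congr 1
    ring
  rw [h5, ENNReal.le_div_iff_mul_le (Or.inl (ENNReal.ofReal_pos.2 hc).ne')
    (Or.inl ENNReal.ofReal_ne_top), mul_comm, ← hvol]
  exact hlow.trans hmain

end

section

variable {d n : ℕ}

theorem analyticAt_pderiv' {f : (Fin d → ℝ) → ℝ} {p : Fin d → ℝ} (hf : AnalyticAt ℝ f p)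
    (i : Fin d) : AnalyticAt ℝ (pderiv' i f) p :=
  ((ContinuousLinearMap.apply ℝ ℝ (Pi.single i 1 : Fin d → ℝ)).analyticAt _).comp hf.fderiv

theorem analyticAt_det_pderiv' {G : Fin n → (Fin d → ℝ) → ℝ} {p : Fin d → ℝ} (i : Fin n → Fin d)
    (hG : ∀ k, AnalyticAt ℝ (G k) p) :
    AnalyticAt ℝ (fun x => (Matrix.of fun r k : Fin n => pderiv' (i r) (G k) x).det) p := by
  simp only [Matrix.det_apply', Matrix.of_apply]
  exact Finset.analyticAt_fun_sum _ fun σ _ => analyticAt_const.fun_mul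
    (Finset.analyticAt_fun_prod _ fun k _ => analyticAt_pderiv' (hG k) _)

theorem _root_.IsAdmissible.analyticAt {α : ℕ} {β : Fin d → ℕ}
    {L : ((Fin d → ℝ) → ℝ) → (Fin d → ℝ) → ℝ} (hL : IsAdmissible d α β L)
    {F : (Fin d → ℝ) → ℝ} {p : Fin d → ℝ} (hF : AnalyticAt ℝ F p) : AnalyticAt ℝ (L F) p := by
  induction hL with
  | id => exact hF
  | det n hn hnd i hi αs βs Ls hLs L hL ih =>
    refine (analyticAt_det_pderiv' i ih).congr ?_
    filter_upwards [hF.eventually_analyticAt] with x hx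
    exact (hL F x hx.contDiffAt).symm

theorem _root_.IsAdmissible.exists_local_bound {α : ℕ} {β : Fin d → ℕ}
    {L : ((Fin d → ℝ) → ℝ) → (Fin d → ℝ) → ℝ} (hL : IsAdmissible d α β L) :
    ∃ s : ℕ, ∑ j, β j + 1 = s + α ∧ (¬(α = 1 ∧ β = 0) → 1 ≤ s) ∧
      ∀ (F : (Fin d → ℝ) → ℝ) (p : Fin d → ℝ), AnalyticAt ℝ F p → ∃ V ∈ 𝓝 p, ∃ C : ℝ, 0 ≤ C ∧
        ∀ μ : ℝ, 0 < μ → ∀ ε : ℝ, 0 < ε →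
          volume {x ∈ V | |F x| ≤ ε ∧ ε ^ α / μ ^ s < |L F x|} ≤ ENNReal.ofReal (C * μ) := by
  induction hL with
  | id =>
    refine ⟨0, by simp, fun h => absurd ⟨rfl, rfl⟩ h, fun F p _ => ⟨Set.univ, univ_mem, 0, le_rfl,
      fun μ _ ε _ => ?_⟩⟩
    have : {x : Fin d → ℝ | x ∈ Set.univ ∧ |F x| ≤ ε ∧ ε ^ 1 / μ ^ 0 < |F x|} = ∅ := by
      refine Set.eq_empty_of_forall_notMem fun x hx => ?_
      have := hx.2.2
      rw [pow_one, pow_zero, div_one] at this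
      exact this.not_ge hx.2.1
    rw [this]
    simp
  | det n hn hnd i hi αs βs Ls hLs L hL ih =>
    choose s hs1 _ hs using ih
    refine ⟨1 + ∑ k, s k, ?_, fun _ => by omega, fun F p hF => ?_⟩
    · have h1 : ∑ j, ((∑ k, βs k) + ∑ k, Pi.single (i k) 1 : Fin d → ℕ) j = (∑ k, ∑ j, βs k j) + n := by
        simp only [Pi.add_apply, Finset.sum_apply, Finset.sum_add_distrib]
        congr 1
        · exact Finset.sum_comm
        · rw [Finset.sum_comm]
          simp
      have h2 : ∑ k, (∑ j, βs k j + 1) = ∑ k, (s k + αs k) :=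
        Finset.sum_congr rfl fun k _ => hs1 k
      simp only [Finset.sum_add_distrib, Finset.sum_const, Finset.card_univ, Fintype.card_fin,
        smul_eq_mul, mul_one] at h2
      rw [h1]
      omega
    choose V hV C hC hVC using fun k => hs k F p hF
    obtain ⟨V₀, hV₀, C₀, hC₀, hVC₀⟩ := volume_setOf_le_det hi fun k => (hLs k).analyticAt hF
    refine ⟨(V₀ ∩ ⋂ k, V k) ∩ {x | AnalyticAt ℝ F x}, inter_mem (inter_mem hV₀
      (iInter_mem.2 hV)) hF.eventually_analyticAt, C₀ + ∑ k, C k,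
      add_nonneg hC₀ (Finset.sum_nonneg fun k _ => hC k), fun μ hμ ε hε => ?_⟩
    have hδ : ∀ k, 0 < ε ^ αs k / μ ^ s k := fun k => by positivity
    have hμ' : (∏ k, ε ^ αs k / μ ^ s k) / (ε ^ (∑ k, αs k) / μ ^ (1 + ∑ k, s k)) = μ := by
      rw [Finset.prod_div_distrib, Finset.prod_pow_eq_pow_sum, Finset.prod_pow_eq_pow_sum, pow_add]
      field_simp
    have hsub : {x ∈ (V₀ ∩ ⋂ k, V k) ∩ {x | AnalyticAt ℝ F x} | |F x| ≤ ε ∧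
        ε ^ (∑ k, αs k) / μ ^ (1 + ∑ k, s k) < |L F x|} ⊆
        {x ∈ V₀ | (∀ k, |Ls k F x| ≤ ε ^ αs k / μ ^ s k) ∧
          ε ^ (∑ k, αs k) / μ ^ (1 + ∑ k, s k) ≤
            |(Matrix.of fun r k : Fin n => pderiv' (i r) (Ls k F) x).det|} ∪
        ⋃ k, {x ∈ V k | |F x| ≤ ε ∧ ε ^ αs k / μ ^ s k < |Ls k F x|} := by
      rintro x ⟨⟨⟨hx0, hxk⟩, hxF⟩, hxε, hxL⟩
      by_cases h : ∀ k, |Ls k F x| ≤ ε ^ αs k / μ ^ s k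
      · left
        rw [hL F x (AnalyticAt.contDiffAt hxF)] at hxL
        exact ⟨hx0, h, hxL.le⟩
      · right
        push Not at h
        obtain ⟨k, hk⟩ := h
        exact Set.mem_iUnion.2 ⟨k, Set.mem_iInter.1 hxk k, hxε, hk⟩
    refine (measure_mono hsub).trans ((measure_union_le _ _).trans ?_)
    rw [add_mul, ENNReal.ofReal_add (by positivity)
      (mul_nonneg (Finset.sum_nonneg fun k _ => hC k) hμ.le)]
    refine add_le_add ?_ ?_
    · have := hVC₀ _ hδ (ε ^ (∑ k, αs k) / μ ^ (1 + ∑ k, s k)) (by positivity)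
      rwa [hμ'] at this
    · refine (measure_iUnion_fintype_le _ _).trans ?_
      rw [Finset.sum_mul, ENNReal.ofReal_sum_of_nonneg fun k _ => mul_nonneg (hC k) hμ.le]
      exact Finset.sum_le_sum fun k _ => hVC k μ hμ ε hε

/-- Sublevel estimate for admissible operators on a compact set. -/
theorem exists_bound_of_isCompact {α s : ℕ} {F G : (Fin d → ℝ) → ℝ} {K : Set (Fin d → ℝ)}
    (hK : IsCompact K) (h : ∀ p ∈ K, ∃ V ∈ 𝓝 p, ∃ C : ℝ, 0 ≤ C ∧
        ∀ μ : ℝ, 0 < μ → ∀ ε : ℝ, 0 < ε →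
          volume {x ∈ V | |F x| ≤ ε ∧ ε ^ α / μ ^ s < |G x|} ≤ ENNReal.ofReal (C * μ)) :
    ∃ C : ℝ, 0 ≤ C ∧ ∀ μ : ℝ, 0 < μ → ∀ ε : ℝ, 0 < ε →
      volume {x ∈ K | |F x| ≤ ε ∧ ε ^ α / μ ^ s < |G x|} ≤ ENNReal.ofReal (C * μ) := by
  refine hK.induction_on (p := fun W => ∃ C : ℝ, 0 ≤ C ∧ ∀ μ : ℝ, 0 < μ → ∀ ε : ℝ, 0 < ε →
      volume {x ∈ W | |F x| ≤ ε ∧ ε ^ α / μ ^ s < |G x|} ≤ ENNReal.ofReal (C * μ)) ?_ ?_ ?_ ?_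
  · exact ⟨0, le_rfl, by simp⟩
  · rintro W W' hW ⟨C, hC, h⟩
    exact ⟨C, hC, fun μ hμ ε hε => (measure_mono (Set.inter_subset_inter_left _ hW)).trans
      (h μ hμ ε hε)⟩
  · rintro W W' ⟨C, hC, h⟩ ⟨C', hC', h'⟩
    refine ⟨C + C', add_nonneg hC hC', fun μ hμ ε hε => ?_⟩
    rw [add_mul, ENNReal.ofReal_add (by positivity) (by positivity)]
    refine (measure_mono ?_).trans ((measure_union_le _ _).trans
      (add_le_add (h μ hμ ε hε) (h' μ hμ ε hε)))
    rintro x ⟨hx | hx, h2⟩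
    · exact Or.inl ⟨hx, h2⟩
    · exact Or.inr ⟨hx, h2⟩
  · intro p hp
    obtain ⟨V, hV, hC⟩ := h p hp
    exact ⟨V, mem_nhdsWithin_of_mem_nhds hV, hC⟩

end

end Sublevel

/-- Improved Carbery–Christ–Wright sublevel set estimate (Theorem 1 of the paper),
real-analytic case. -/
theorem sublevel_estimate_admissible
    (d : ℕ) (U : Set (Fin d → ℝ)) (hUopen : IsOpen U) (hUconn : IsConnected U)
    (hcube : Set.Icc (0 : Fin d → ℝ) 1 ⊆ U)
    (F : (Fin d → ℝ) → ℝ) (hF : AnalyticOnNhd ℝ F U)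
    (D : Set (Fin d → ℝ)) (hDclosed : IsClosed D)
    (hD : D ⊆ Set.Icc (0 : Fin d → ℝ) 1)
    (α : ℕ) (β : Fin d → ℕ) (L : ((Fin d → ℝ) → ℝ) → (Fin d → ℝ) → ℝ)
    (hL : IsAdmissible d α β L) (hne : ¬(α = 1 ∧ β = 0)) :
    ∃ C : ℝ, ∀ c : ℝ, 0 < c → (∀ x ∈ D, c ≤ |L F x|) → ∀ ε : ℝ, 0 < ε →
      volume {x ∈ D | |F x| ≤ ε} ≤
        ENNReal.ofReal
          (C * ε ^ ((α : ℝ) / (((∑ i, β i : ℕ) : ℝ) + 1 - (α : ℝ))) *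
            c ^ (-(1 : ℝ) / (((∑ i, β i : ℕ) : ℝ) + 1 - (α : ℝ)))) := by
  obtain ⟨s, hs, hs1, hest⟩ := hL.exists_local_bound
  have hs0 : (s : ℝ) ≠ 0 := by
    have := hs1 hne
    positivity
  have hsα : ((∑ i, β i : ℕ) : ℝ) + 1 - (α : ℝ) = s := by
    have : ((∑ i, β i + 1 : ℕ) : ℝ) = ((s + α : ℕ) : ℝ) := congrArg _ hs
    push_cast at this ⊢
    linarith
  obtain ⟨C, hC, hbound⟩ := Sublevel.exists_bound_of_isCompact
    (isCompact_Icc : IsCompact (Set.Icc (0 : Fin d → ℝ) 1))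
    fun p hp => hest F p (hF p (hcube hp))
  refine ⟨C * 2⁻¹ ^ (-(1 : ℝ) / s), fun c hc hcD ε hε => ?_⟩
  rw [hsα]
  set μ : ℝ := ε ^ ((α : ℝ) / s) * (2⁻¹ * c) ^ (-(1 : ℝ) / s) with hμ
  have hμ0 : 0 < μ := by positivity
  have hpow : ε ^ α / μ ^ s = 2⁻¹ * c := by
    have h1 : (ε ^ ((α : ℝ) / s)) ^ s = ε ^ α := by
      rw [← Real.rpow_natCast, ← Real.rpow_mul hε.le, div_mul_cancel₀ _ hs0, Real.rpow_natCast]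
    have h2 : ((2⁻¹ * c) ^ (-(1 : ℝ) / s)) ^ s = (2⁻¹ * c)⁻¹ := by
      rw [← Real.rpow_natCast, ← Real.rpow_mul (by positivity), div_mul_cancel₀ _ hs0,
        Real.rpow_neg_one]
    rw [hμ, mul_pow, h1, h2]
    field_simp
  have hsub : {x ∈ D | |F x| ≤ ε} ⊆
      {x ∈ Set.Icc (0 : Fin d → ℝ) 1 | |F x| ≤ ε ∧ ε ^ α / μ ^ s < |L F x|} := by
    rintro x ⟨hxD, hx⟩
    refine ⟨hD hxD, hx, ?_⟩
    rw [hpow]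
    exact (by linarith : 2⁻¹ * c < c).trans_le (hcD x hxD)
  refine (measure_mono hsub).trans ((hbound μ hμ0 ε hε).trans_eq (congrArg _ ?_))
  rw [hμ, Real.mul_rpow (by norm_num) hc.le]
  ring
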